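/- arXiv:1606.03828 — 3 statements merged into one kernel-verified Lean document; each statement's English description precedes it below -/
import Mathlib

section
/- For i = 1,2 let ν_i be a Banach space continuously embedded in the dual B_i* of a real separable Banach space B_i; set χ₁ = ν₁⊗̂_π B₂*, χ₂ = B₁*⊗̂_π ν₂, χ̂_i = ν_i⊗̂_π ν_i. Let X be a B₁-valued and Y a B₂-valued a.s. square integrable process. (i) If X admits a χ̂₁-quadratic variation and Y has zero scalar quadratic variation, then [X,Y]_{χ₁} = 0. (ii) If Y admits a χ̂₂-quadratic variation and X has zero scalar quadratic variation, then [X,Y]_{χ₂} = 0. -/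
open MeasureTheory Filter Topology Set
open scoped ENNReal NNReal

noncomputable section

namespace Stmt

variable {Ω : Type*} [mΩ : MeasurableSpace Ω]

def TendstoUcp {ι : Type*} {E : Type*} [NormedAddCommGroup E]
    (μ : Measure Ω) (l : Filter ι) (T : ℝ)
    (Z : ι → ℝ → Ω → E) (L : ℝ → Ω → E) : Prop :=
  ∀ δ : ℝ, 0 < δ →
    Tendsto (fun i => μ {ω | δ ≤ ⨆ t : Icc (0:ℝ) T, ‖Z i (t : ℝ) ω - L (t : ℝ) ω‖})
      l (𝓝 0)

/-- A Banach space `ν` continuously embedded into the dual `B*` of a Banach space `B`. -/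
structure DualPairEmb (B ν : Type*) [NormedAddCommGroup B] [NormedSpace ℝ B]
    [NormedAddCommGroup ν] [NormedSpace ℝ ν] where
  j : ν →L[ℝ] (B →L[ℝ] ℝ)
  inj : Function.Injective j

variable {B₁ B₂ ν₁ ν₂ : Type*} [NormedAddCommGroup B₁] [NormedSpace ℝ B₁]
    [NormedAddCommGroup B₂] [NormedSpace ℝ B₂]
    [NormedAddCommGroup ν₁] [NormedSpace ℝ ν₁]
    [NormedAddCommGroup ν₂] [NormedSpace ℝ ν₂]

/-- The identity embedding of `B*` into itself. -/
def idDual (B : Type*) [NormedAddCommGroup B] [NormedSpace ℝ B] :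
    DualPairEmb B (B →L[ℝ] ℝ) :=
  ⟨ContinuousLinearMap.id ℝ _, fun _ _ h => by simpa using h⟩

/-- The norm of `u ∈ B ⊆ B** ⊆ ν*` as an element of `ν*`. -/
def DualPairEmb.starNorm (e : DualPairEmb B₁ ν₁) (u : B₁) : ℝ :=
  ⨆ z : {z : ν₁ // ‖z‖ ≤ 1}, |e.j z.1 u|

/-- Condition **H1** in the definition of the `(ν₁ ⊗̂π ν₂)`-covariation of `(X,Y)`:
here one uses that `|J(u ⊗ v)|_{(ν₁ ⊗̂π ν₂)*} = |u|_{ν₁*} |v|_{ν₂*}`. -/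
def TensorCondH1 (e₁ : DualPairEmb B₁ ν₁) (e₂ : DualPairEmb B₂ ν₂)
    (μ : Measure Ω) (T : ℝ) (X : ℝ → Ω → B₁) (Y : ℝ → Ω → B₂) : Prop :=
  ∀ e : ℕ → ℝ, (∀ n, 0 < e n) → Antitone e → Tendsto e atTop (𝓝 0) →
    ∃ k : ℕ → ℕ, StrictMono k ∧
      ∀ᵐ ω ∂μ, BddAbove (range fun j =>
        ∫ r in Ioc (0:ℝ) T,
          e₁.starNorm (X (r + e (k j)) ω - X r ω) *
            e₂.starNorm (Y (r + e (k j)) ω - Y r ω) / e (k j))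

/-- `(X,Y)` admits a `χ`-covariation for the Chi-subspace `χ = ν₁ ⊗̂π ν₂` of
`(B₁ ⊗̂π B₂)*`, with representative `G` (with values in
`χ* = (ν₁ ⊗̂π ν₂)* ≅ ν₁ →L ν₂ →L ℝ`, the bounded bilinear forms on `ν₁ × ν₂`).
A generic element `φ` of `ν₁ ⊗̂π ν₂` is represented by an absolutely summable series
`φ = ∑ₖ a k ⊗ b k` with `∑ₖ ‖a k‖ ‖b k‖ < ∞`; its pairing with `J((X(r+ε)-X(r)) ⊗
(Y(r+ε)-Y(r)))` is `∑ₖ ⟨a k, X(r+ε)-X(r)⟩ ⟨b k, Y(r+ε)-Y(r)⟩`. -/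
structure HasChiCovSeries (e₁ : DualPairEmb B₁ ν₁) (e₂ : DualPairEmb B₂ ν₂)
    (μ : Measure Ω) (T : ℝ) (X : ℝ → Ω → B₁) (Y : ℝ → Ω → B₂)
    (G : ℝ → Ω → (ν₁ →L[ℝ] ν₂ →L[ℝ] ℝ)) : Prop where
  h1 : TensorCondH1 e₁ e₂ μ T X Y
  limUcp : ∀ (a : ℕ → ν₁) (b : ℕ → ν₂), Summable (fun k => ‖a k‖ * ‖b k‖) →
    TendstoUcp μ (𝓝[>] (0:ℝ)) T
      (fun ε t ω => ε⁻¹ * ∫ r in Ioc (0:ℝ) t,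
        ∑' k, e₁.j (a k) (X (r + ε) ω - X r ω) * e₂.j (b k) (Y (r + ε) ω - Y r ω))
      (fun t ω => ∑' k, G t ω (a k) (b k))
  limCont : ∀ (a : ℕ → ν₁) (b : ℕ → ν₂), Summable (fun k => ‖a k‖ * ‖b k‖) →
    ∀ᵐ ω ∂μ, ContinuousOn (fun t => ∑' k, G t ω (a k) (b k)) (Icc 0 T)
  measG : StronglyMeasurable (Function.uncurry G)
  bvG : ∀ᵐ ω ∂μ, BoundedVariationOn (fun t => G t ω) (Icc 0 T)

/-- The `(ν₁ ⊗̂π ν₂)`-covariation of `(X,Y)` exists and vanishes. -/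
def HasZeroChiCovSeries (e₁ : DualPairEmb B₁ ν₁) (e₂ : DualPairEmb B₂ ν₂)
    (μ : Measure Ω) (T : ℝ) (X : ℝ → Ω → B₁) (Y : ℝ → Ω → B₂) : Prop :=
  HasChiCovSeries e₁ e₂ μ T X Y (fun _ _ => 0)

/-- `X` admits a scalar quadratic variation `Q = [X,X]^ℝ`. -/
def HasScalarQV {B : Type*} [NormedAddCommGroup B]
    (μ : Measure Ω) (T : ℝ) (X : ℝ → Ω → B) (Q : ℝ → Ω → ℝ) : Prop :=
  (∀ᵐ ω ∂μ, ContinuousOn (fun t => Q t ω) (Icc 0 T)) ∧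
  ∀ t ∈ Icc (0:ℝ) T, TendstoInMeasure μ
    (fun ε ω => ε⁻¹ * ∫ r in Ioc (0:ℝ) t, ‖X (r + ε) ω - X r ω‖ ^ 2)
    (𝓝[>] (0:ℝ)) (Q t)

lemma DualPairEmb.starNorm_eq (e : DualPairEmb B₁ ν₁) (u : B₁) :
    e.starNorm u = ‖e.j.flip u‖ := by
  rw [← ContinuousLinearMap.sSup_unitClosedBall_eq_norm, sSup_image', DualPairEmb.starNorm]
  exact (Equiv.subtypeEquivRight fun z => by simp).iSup_congr fun z => rfl

lemma DualPairEmb.starNorm_nonneg (e : DualPairEmb B₁ ν₁) (u : B₁) : 0 ≤ e.starNorm u := by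
  rw [e.starNorm_eq]
  positivity

lemma DualPairEmb.continuous_starNorm (e : DualPairEmb B₁ ν₁) : Continuous e.starNorm := by
  simp_rw [funext e.starNorm_eq]
  fun_prop

lemma DualPairEmb.starNorm_le (e : DualPairEmb B₁ ν₁) (u : B₁) :
    e.starNorm u ≤ ‖e.j.flip‖ * ‖u‖ := by
  rw [e.starNorm_eq]
  exact e.j.flip.le_opNorm u

lemma DualPairEmb.abs_apply_le (e : DualPairEmb B₁ ν₁) (z : ν₁) (u : B₁) :
    |e.j z u| ≤ ‖z‖ * e.starNorm u := by
  rw [e.starNorm_eq, mul_comm, ← Real.norm_eq_abs]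
  exact (e.j.flip u).le_opNorm z

/-- A path that is square integrable on `(0, T]` and constant after `T` has square integrable
increments on `(0, T]`. -/
lemma memLp_two_increment {B : Type*} [NormedAddCommGroup B] {f : ℝ → B} {T : ℝ} (hT : 0 < T)
    (hf : StronglyMeasurable f)
    (hsq : ∫⁻ r in Ioc (0:ℝ) T, (‖f r‖₊ : ℝ≥0∞) ^ 2 < ⊤)
    (hext : ∀ t ≥ T, f t = f T) {ε : ℝ} (hε : 0 < ε) :
    MemLp (fun r => f (r + ε) - f r) 2 (volume.restrict (Ioc 0 T)) := by
  have h0 : MemLp f 2 (volume.restrict (Ioc 0 T)) := by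
    rw [memLp_two_iff_integrable_sq_norm hf.aestronglyMeasurable]
    refine ⟨(hf.norm.pow 2).aestronglyMeasurable, ?_⟩
    simpa [HasFiniteIntegral, enorm_pow, enorm_norm, enorm_eq_nnnorm] using hsq
  have h1 : MemLp f 2 (volume.restrict (Ioc T (T + ε))) := by
    refine (memLp_const (f T)).congr_norm hf.aestronglyMeasurable ?_
    filter_upwards [ae_restrict_mem measurableSet_Ioc] with r hr
    rw [hext r hr.1.le]
  have h2 : MemLp f 2 (volume.restrict (Ioc 0 (T + ε))) := by
    rw [memLp_two_iff_integrable_sq_norm hf.aestronglyMeasurable] at h0 h1 ⊢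
    rw [← Ioc_union_Ioc_eq_Ioc hT.le (by linarith : T ≤ T + ε)]
    exact IntegrableOn.union h0 h1
  have h3 := h2.comp_measurePreserving
    ((measurePreserving_add_right volume ε).restrict_preimage measurableSet_Ioc)
  refine MemLp.sub (h3.mono_measure (Measure.restrict_mono ?_ le_rfl)) h0
  intro r hr
  simp only [mem_preimage, mem_Ioc] at hr ⊢
  constructor <;> linarith

lemma DualPairEmb.memLp_starNorm (e : DualPairEmb B₁ ν₁) {p : ℝ≥0∞} {f : ℝ → B₁} {m : Measure ℝ}
    (hf : MemLp f p m) : MemLp (fun r => e.starNorm (f r)) p m := by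
  refine hf.of_le_mul (c := ‖e.j.flip‖)
    (e.continuous_starNorm.comp_aestronglyMeasurable hf.aestronglyMeasurable) (.of_forall ?_)
  intro r
  rw [Real.norm_of_nonneg (e.starNorm_nonneg _)]
  exact e.starNorm_le _

/-- The approximating integrals bounding the `ν₁ ⊗̂π ν₂`-covariation of `(X, Y)` on `(0, T]`. -/
def tensorVar (e₁ : DualPairEmb B₁ ν₁) (e₂ : DualPairEmb B₂ ν₂) (T : ℝ)
    (X : ℝ → Ω → B₁) (Y : ℝ → Ω → B₂) (ε : ℝ) (ω : Ω) : ℝ :=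
  ∫ r in Ioc (0:ℝ) T, e₁.starNorm (X (r + ε) ω - X r ω) * e₂.starNorm (Y (r + ε) ω - Y r ω) / ε

set_option linter.unusedSectionVars false in
lemma tensorVar_comm (e₁ : DualPairEmb B₁ ν₁) (e₂ : DualPairEmb B₂ ν₂) (T : ℝ)
    (X : ℝ → Ω → B₁) (Y : ℝ → Ω → B₂) :
    tensorVar e₁ e₂ T X Y = tensorVar e₂ e₁ T Y X := by
  funext ε ω
  simp only [tensorVar, mul_comm]

set_option linter.unusedSectionVars false in
lemma tensorVar_nonneg (e₁ : DualPairEmb B₁ ν₁) (e₂ : DualPairEmb B₂ ν₂) (T : ℝ)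
    (X : ℝ → Ω → B₁) (Y : ℝ → Ω → B₂) {ε : ℝ} (hε : 0 < ε) (ω : Ω) :
    0 ≤ tensorVar e₁ e₂ T X Y ε ω :=
  integral_nonneg fun _ =>
    div_nonneg (mul_nonneg (e₁.starNorm_nonneg _) (e₂.starNorm_nonneg _)) hε.le

lemma stronglyMeasurable_increment {B : Type*} [NormedAddCommGroup B] {X : ℝ → Ω → B}
    (hX : StronglyMeasurable (Function.uncurry X)) (ε : ℝ) :
    StronglyMeasurable fun p : ℝ × Ω => X (p.1 + ε) p.2 - X p.1 p.2 :=
  (hX.comp_measurable (g := fun p : ℝ × Ω => (p.1 + ε, p.2)) (by fun_prop)).sub hX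

lemma stronglyMeasurable_tensorVar (e₁ : DualPairEmb B₁ ν₁) (e₂ : DualPairEmb B₂ ν₂) (T : ℝ)
    {X : ℝ → Ω → B₁} {Y : ℝ → Ω → B₂} (hX : StronglyMeasurable (Function.uncurry X))
    (hY : StronglyMeasurable (Function.uncurry Y)) (ε : ℝ) :
    StronglyMeasurable (tensorVar e₁ e₂ T X Y ε) := by
  have h : StronglyMeasurable fun p : ℝ × Ω => e₁.starNorm (X (p.1 + ε) p.2 - X p.1 p.2) *
      e₂.starNorm (Y (p.1 + ε) p.2 - Y p.1 p.2) / ε := by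
    simp_rw [div_eq_mul_inv]
    exact ((e₁.continuous_starNorm.comp_stronglyMeasurable (stronglyMeasurable_increment hX ε)).mul
      (e₂.continuous_starNorm.comp_stronglyMeasurable
        (stronglyMeasurable_increment hY ε))).mul_const _
  exact h.integral_prod_left'

set_option linter.unusedSectionVars false in
/-- Cauchy–Schwarz for the approximating integrals. -/
lemma tensorVar_le (e₁ : DualPairEmb B₁ ν₁) (e₂ : DualPairEmb B₂ ν₂) (T : ℝ)
    (X : ℝ → Ω → B₁) (Y : ℝ → Ω → B₂) {ε : ℝ} (hε : 0 < ε) (ω : Ω)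
    (hX : MemLp (fun r => X (r + ε) ω - X r ω) 2 (volume.restrict (Ioc 0 T)))
    (hY : MemLp (fun r => Y (r + ε) ω - Y r ω) 2 (volume.restrict (Ioc 0 T))) :
    tensorVar e₁ e₂ T X Y ε ω ≤ √(tensorVar e₁ e₁ T X X ε ω) *
      √(‖e₂.j.flip‖ ^ 2 * (ε⁻¹ * ∫ r in Ioc (0:ℝ) T, ‖Y (r + ε) ω - Y r ω‖ ^ 2)) := by
  have hcs := integral_mul_le_Lp_mul_Lq_of_nonneg (μ := volume.restrict (Ioc 0 T))
    Real.HolderConjugate.two_two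
    (f := fun r => e₁.starNorm (X (r + ε) ω - X r ω))
    (g := fun r => e₂.starNorm (Y (r + ε) ω - Y r ω))
    (.of_forall fun r => e₁.starNorm_nonneg _) (.of_forall fun r => e₂.starNorm_nonneg _)
    (by simpa using e₁.memLp_starNorm hX) (by simpa using e₂.memLp_starNorm hY)
  simp only [Real.rpow_two, ← Real.sqrt_eq_rpow] at hcs
  have hle : ∫ r in Ioc (0:ℝ) T, e₂.starNorm (Y (r + ε) ω - Y r ω) ^ 2 ≤
      ‖e₂.j.flip‖ ^ 2 * ∫ r in Ioc (0:ℝ) T, ‖Y (r + ε) ω - Y r ω‖ ^ 2 := by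
    rw [← integral_const_mul]
    refine integral_mono_of_nonneg (.of_forall fun r => sq_nonneg _)
      (((memLp_two_iff_integrable_sq_norm hY.aestronglyMeasurable).1 hY).const_mul _)
      (.of_forall fun r => ?_)
    simp only [← mul_pow]
    exact pow_le_pow_left₀ (e₂.starNorm_nonneg _) (e₂.starNorm_le _) 2
  have hXX : tensorVar e₁ e₁ T X X ε ω =
      ε⁻¹ * ∫ r in Ioc (0:ℝ) T, e₁.starNorm (X (r + ε) ω - X r ω) ^ 2 := by
    rw [tensorVar, integral_div, div_eq_inv_mul]
    simp only [sq]
  rw [hXX, tensorVar, integral_div, div_eq_inv_mul, mul_left_comm (_ ^ 2),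
    Real.sqrt_mul (inv_nonneg.2 hε.le), Real.sqrt_mul (inv_nonneg.2 hε.le), mul_mul_mul_comm,
    Real.mul_self_sqrt (inv_nonneg.2 hε.le)]
  refine mul_le_mul_of_nonneg_left (hcs.trans ?_) (inv_nonneg.2 hε.le)
  gcongr

/-- If `X` satisfies the tensor condition `H1` and `Y` has zero scalar quadratic variation, then
every null sequence has a subsequence along which `tensorVar e₁ e₂ T X Y` vanishes a.s. -/
lemma exists_subseq_tendsto_tensorVar {e₁ : DualPairEmb B₁ ν₁} (e₂ : DualPairEmb B₂ ν₂)
    {μ : Measure Ω} {T : ℝ} (hT : 0 < T) {X : ℝ → Ω → B₁} {Y : ℝ → Ω → B₂}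
    (hXmeas : StronglyMeasurable (Function.uncurry X))
    (hYmeas : StronglyMeasurable (Function.uncurry Y))
    (hXsq : ∀ᵐ ω ∂μ, ∫⁻ r in Ioc (0:ℝ) T, (‖X r ω‖₊ : ℝ≥0∞) ^ 2 < ⊤)
    (hYsq : ∀ᵐ ω ∂μ, ∫⁻ r in Ioc (0:ℝ) T, (‖Y r ω‖₊ : ℝ≥0∞) ^ 2 < ⊤)
    (hXext : ∀ t ≥ T, ∀ ω, X t ω = X T ω) (hYext : ∀ t ≥ T, ∀ ω, Y t ω = Y T ω)
    (hX : TensorCondH1 e₁ e₁ μ T X X) (hY : HasScalarQV μ T Y (fun _ _ => (0:ℝ)))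
    (e : ℕ → ℝ) (he : ∀ n, 0 < e n) (hanti : Antitone e) (hlim : Tendsto e atTop (𝓝 0)) :
    ∃ k : ℕ → ℕ, StrictMono k ∧
      ∀ᵐ ω ∂μ, Tendsto (fun j => tensorVar e₁ e₂ T X Y (e (k j)) ω) atTop (𝓝 0) := by
  obtain ⟨k, hk, hbdd⟩ := hX e he hanti hlim
  have hek : Tendsto (fun j => e (k j)) atTop (𝓝[>] 0) :=
    tendsto_nhdsWithin_iff.2 ⟨hlim.comp hk.tendsto_atTop, .of_forall fun j => he _⟩
  obtain ⟨l, hl, hQ⟩ := ((hY.2 T ⟨hT.le, le_rfl⟩).comp hek).exists_seq_tendsto_ae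
  refine ⟨k ∘ l, hk.comp hl, ?_⟩
  filter_upwards [hbdd, hQ, hXsq, hYsq] with ω ⟨M, hM⟩ hQω hXω hYω
  have hbound : ∀ j, tensorVar e₁ e₂ T X Y (e (k (l j))) ω ≤ √M *
      √(‖e₂.j.flip‖ ^ 2 * ((e (k (l j)))⁻¹ *
        ∫ r in Ioc (0:ℝ) T, ‖Y (r + e (k (l j))) ω - Y r ω‖ ^ 2)) := fun j =>
    (tensorVar_le e₁ e₂ T X Y (he _) ω
      (memLp_two_increment hT hXmeas.of_uncurry_right hXω (fun t ht => hXext t ht ω) (he _))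
      (memLp_two_increment hT hYmeas.of_uncurry_right hYω (fun t ht => hYext t ht ω) (he _))).trans
    (mul_le_mul_of_nonneg_right (Real.sqrt_le_sqrt (hM ⟨l j, rfl⟩)) (Real.sqrt_nonneg _))
  refine squeeze_zero (fun j => tensorVar_nonneg e₁ e₂ T X Y (he _) ω) hbound ?_
  simpa using (((hQω.const_mul (‖e₂.j.flip‖ ^ 2)).sqrt).const_mul √M)

lemma exists_antitone_subseq {ns : ℕ → ℝ} (hns : Tendsto ns atTop (𝓝[>] 0)) :
    ∃ ms : ℕ → ℕ, (∀ n, 0 < ns (ms n)) ∧ Antitone (fun n => ns (ms n)) ∧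
      Tendsto (fun n => ns (ms n)) atTop (𝓝 0) := by
  obtain ⟨hlim, hpos⟩ := tendsto_nhdsWithin_iff.1 hns
  obtain ⟨N, hN⟩ := eventually_atTop.1 hpos
  have hinv : Tendsto (fun n => (ns (n + N))⁻¹) atTop atTop :=
    tendsto_inv_nhdsGT_zero.comp (hns.comp (tendsto_add_atTop_nat N))
  obtain ⟨φ, hφ, hmono⟩ := strictMono_subseq_of_tendsto_atTop hinv
  have hp : ∀ n, 0 < ns (φ n + N) := fun n => hN _ (Nat.le_add_left _ _)
  exact ⟨fun n => φ n + N, hp, fun m n hmn => (inv_le_inv₀ (hp m) (hp n)).1 (hmono.monotone hmn),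
    hlim.comp ((tendsto_add_atTop_nat N).comp hφ.tendsto_atTop)⟩

set_option linter.unusedSectionVars false in
/-- The approximating covariation integrals are dominated by `tensorVar`, uniformly in time. -/
lemma iSup_norm_integral_tsum_le (e₁ : DualPairEmb B₁ ν₁) (e₂ : DualPairEmb B₂ ν₂) {T : ℝ}
    (X : ℝ → Ω → B₁) (Y : ℝ → Ω → B₂) {a : ℕ → ν₁} {b : ℕ → ν₂}
    (hab : Summable fun k => ‖a k‖ * ‖b k‖) {ε : ℝ} (hε : 0 < ε) (ω : Ω)
    (hX : MemLp (fun r => X (r + ε) ω - X r ω) 2 (volume.restrict (Ioc 0 T)))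
    (hY : MemLp (fun r => Y (r + ε) ω - Y r ω) 2 (volume.restrict (Ioc 0 T))) :
    ⨆ t : Icc (0:ℝ) T, ‖ε⁻¹ * ∫ r in Ioc (0:ℝ) t,
        ∑' k, e₁.j (a k) (X (r + ε) ω - X r ω) * e₂.j (b k) (Y (r + ε) ω - Y r ω)‖ ≤
      (∑' k, ‖a k‖ * ‖b k‖) * tensorVar e₁ e₂ T X Y ε ω := by
  set C := ∑' k, ‖a k‖ * ‖b k‖
  have hC : 0 ≤ C := tsum_nonneg fun k => by positivity
  refine Real.iSup_le (fun t => ?_) (mul_nonneg hC (tensorVar_nonneg e₁ e₂ T X Y hε ω))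
  set g : ℝ → ℝ := fun r =>
    e₁.starNorm (X (r + ε) ω - X r ω) * e₂.starNorm (Y (r + ε) ω - Y r ω)
  have hg0 : ∀ r, 0 ≤ g r := fun r => mul_nonneg (e₁.starNorm_nonneg _) (e₂.starNorm_nonneg _)
  have hg : IntegrableOn g (Ioc 0 T) :=
    (e₁.memLp_starNorm hX).integrable_mul (e₂.memLp_starNorm hY)
  have hsub : Ioc (0:ℝ) t ⊆ Ioc 0 T := Ioc_subset_Ioc_right t.2.2
  have hle : ∀ r, ‖∑' k, e₁.j (a k) (X (r + ε) ω - X r ω) *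
      e₂.j (b k) (Y (r + ε) ω - Y r ω)‖ ≤ C * g r := by
    refine fun r => tsum_of_norm_bounded (hab.hasSum.mul_right (g r)) fun k => ?_
    rw [norm_mul, Real.norm_eq_abs, Real.norm_eq_abs, mul_mul_mul_comm]
    exact mul_le_mul (e₁.abs_apply_le _ _) (e₂.abs_apply_le _ _) (abs_nonneg _)
      (mul_nonneg (norm_nonneg _) (e₁.starNorm_nonneg _))
  have hint := norm_integral_le_of_norm_le (μ := volume.restrict (Ioc (0:ℝ) t))
    ((hg.mono_set hsub).const_mul C) (.of_forall hle)
  have hmono : ∫ r in Ioc (0:ℝ) t, g r ≤ ∫ r in Ioc (0:ℝ) T, g r :=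
    setIntegral_mono_set hg (.of_forall hg0) hsub.eventuallyLE
  rw [integral_const_mul] at hint
  rw [norm_mul, Real.norm_of_nonneg (inv_nonneg.2 hε.le), tensorVar, integral_div, div_eq_inv_mul,
    mul_left_comm]
  exact mul_le_mul_of_nonneg_left (hint.trans (mul_le_mul_of_nonneg_left hmono hC))
    (inv_nonneg.2 hε.le)

lemma hasZeroChiCovSeries_of_tensorVar {e₁ : DualPairEmb B₁ ν₁} {e₂ : DualPairEmb B₂ ν₂}
    {μ : Measure Ω} [IsProbabilityMeasure μ] {T : ℝ} (hT : 0 < T)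
    {X : ℝ → Ω → B₁} {Y : ℝ → Ω → B₂}
    (hXmeas : StronglyMeasurable (Function.uncurry X))
    (hYmeas : StronglyMeasurable (Function.uncurry Y))
    (hXsq : ∀ᵐ ω ∂μ, ∫⁻ r in Ioc (0:ℝ) T, (‖X r ω‖₊ : ℝ≥0∞) ^ 2 < ⊤)
    (hYsq : ∀ᵐ ω ∂μ, ∫⁻ r in Ioc (0:ℝ) T, (‖Y r ω‖₊ : ℝ≥0∞) ^ 2 < ⊤)
    (hXext : ∀ t ≥ T, ∀ ω, X t ω = X T ω) (hYext : ∀ t ≥ T, ∀ ω, Y t ω = Y T ω)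
    (h : ∀ e : ℕ → ℝ, (∀ n, 0 < e n) → Antitone e → Tendsto e atTop (𝓝 0) →
      ∃ k : ℕ → ℕ, StrictMono k ∧
        ∀ᵐ ω ∂μ, Tendsto (fun j => tensorVar e₁ e₂ T X Y (e (k j)) ω) atTop (𝓝 0)) :
    HasZeroChiCovSeries e₁ e₂ μ T X Y where
  h1 e he hanti hlim := by
    obtain ⟨k, hk, hlim'⟩ := h e he hanti hlim
    refine ⟨k, hk, ?_⟩
    filter_upwards [hlim'] with ω hω
    exact hω.bddAbove_range
  limUcp a b hab δ hδ := by
    refine tendsto_of_subseq_tendsto fun ns hns => ?_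
    obtain ⟨ms, hpos, hanti, hlim⟩ := exists_antitone_subseq hns
    obtain ⟨k, hk, hk0⟩ := h _ hpos hanti hlim
    refine ⟨fun n => ms (k n), ?_⟩
    have hmeas : TendstoInMeasure μ (fun n ω => (∑' k, ‖a k‖ * ‖b k‖) *
        tensorVar e₁ e₂ T X Y (ns (ms (k n))) ω) atTop (fun _ => (0:ℝ)) := by
      refine tendstoInMeasure_of_tendsto_ae (fun n =>
        ((stronglyMeasurable_tensorVar e₁ e₂ T hXmeas hYmeas _).const_mul _).aestronglyMeasurable)
        ?_
      filter_upwards [hk0] with ω hω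
      simpa using hω.const_mul (∑' k, ‖a k‖ * ‖b k‖)
    refine tendsto_of_tendsto_of_tendsto_of_le_of_le tendsto_const_nhds
      (tendstoInMeasure_iff_norm.1 hmeas δ hδ) (fun _ => zero_le) fun n => ?_
    refine measure_mono_ae ?_
    filter_upwards [hXsq, hYsq] with ω hXω hYω hδω
    simp only [_root_.zero_apply, tsum_zero, sub_zero] at hδω ⊢
    exact (le_trans hδω (iSup_norm_integral_tsum_le e₁ e₂ X Y hab (hpos _) ω
      (memLp_two_increment hT hXmeas.of_uncurry_right hXω (fun t ht => hXext t ht ω) (hpos _))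
      (memLp_two_increment hT hYmeas.of_uncurry_right hYω (fun t ht => hYext t ht ω)
        (hpos _)))).trans (Real.le_norm_self _)
  limCont a b _ := .of_forall fun ω => by simpa using continuousOn_const
  measG := stronglyMeasurable_const
  bvG := .of_forall fun ω => by
    rw [BoundedVariationOn, eVariationOn.constant_on (by rintro _ ⟨_, _, rfl⟩ _ ⟨_, _, rfl⟩; rfl)]
    simp

/-- Proposition `PFQVZ`.
For `i = 1,2` let `νᵢ` be a Banach space continuously embedded in `Bᵢ*`; consider the
Chi-subspaces `χ₁ = ν₁ ⊗̂π B₂*`, `χ₂ = B₁* ⊗̂π ν₂` and `χ̂ᵢ = νᵢ ⊗̂π νᵢ`.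
(i) If `X` admits a `χ̂₁`-quadratic variation and `Y` has zero scalar quadratic
variation then `[X,Y]_{χ₁} = 0`.
(ii) If `Y` admits a `χ̂₂`-quadratic variation and `X` has zero scalar quadratic
variation then `[X,Y]_{χ₂} = 0`. -/
theorem statement5
    {B₁ B₂ ν₁ ν₂ : Type*}
    [NormedAddCommGroup B₁] [NormedSpace ℝ B₁] [CompleteSpace B₁]
    [TopologicalSpace.SeparableSpace B₁]
    [NormedAddCommGroup B₂] [NormedSpace ℝ B₂] [CompleteSpace B₂]
    [TopologicalSpace.SeparableSpace B₂]
    [NormedAddCommGroup ν₁] [NormedSpace ℝ ν₁] [CompleteSpace ν₁]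
    [NormedAddCommGroup ν₂] [NormedSpace ℝ ν₂] [CompleteSpace ν₂]
    (e₁ : DualPairEmb B₁ ν₁) (e₂ : DualPairEmb B₂ ν₂)
    (μ : Measure Ω) [IsProbabilityMeasure μ]
    (T : ℝ) (hT : 0 < T)
    (X : ℝ → Ω → B₁) (Y : ℝ → Ω → B₂)
    (hXmeas : StronglyMeasurable (Function.uncurry X))
    (hYmeas : StronglyMeasurable (Function.uncurry Y))
    (hXsq : ∀ᵐ ω ∂μ, ∫⁻ r in Ioc (0:ℝ) T, (‖X r ω‖₊ : ℝ≥0∞) ^ 2 < ⊤)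
    (hYsq : ∀ᵐ ω ∂μ, ∫⁻ r in Ioc (0:ℝ) T, (‖Y r ω‖₊ : ℝ≥0∞) ^ 2 < ⊤)
    (hXext : ∀ t ≥ T, ∀ ω, X t ω = X T ω) (hYext : ∀ t ≥ T, ∀ ω, Y t ω = Y T ω) :
    -- (i)
    (((∃ G, HasChiCovSeries e₁ e₁ μ T X X G) ∧ HasScalarQV μ T Y (fun _ _ => (0:ℝ))) →
      HasZeroChiCovSeries e₁ (idDual B₂) μ T X Y) ∧
    -- (ii)
    (((∃ G, HasChiCovSeries e₂ e₂ μ T Y Y G) ∧ HasScalarQV μ T X (fun _ _ => (0:ℝ))) →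
      HasZeroChiCovSeries (idDual B₁) e₂ μ T X Y) := by
  constructor
  · rintro ⟨⟨G, hG⟩, hQ⟩
    exact hasZeroChiCovSeries_of_tensorVar hT hXmeas hYmeas hXsq hYsq hXext hYext
      (exists_subseq_tendsto_tensorVar _ hT hXmeas hYmeas hXsq hYsq hXext hYext hG.h1 hQ)
  · rintro ⟨⟨G, hG⟩, hQ⟩
    refine hasZeroChiCovSeries_of_tensorVar hT hXmeas hYmeas hXsq hYsq hXext hYext ?_
    rw [tensorVar_comm]
    exact exists_subseq_tendsto_tensorVar _ hT hYmeas hXmeas hYsq hXsq hYext hXext hG.h1 hQ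

end Stmt
end
end

section
/- Let H be a real separable Hilbert space, A the generator of a C₀-semigroup on H, χ̄ := D(A*)⊗̂_π D(A*), and F: [0,T]×H → ℝ of class C^{1,2} with (t,x) ↦ ∂ₓF(t,x) belonging to UC([0,T]×H; D(A*)). Let X be an H-valued process admitting a χ̄-quadratic variation such that: (i) there is a càdlàg bounded variation process C: [0,T]×Ω → H⊗̂_π H with C(t,·)(φ) = [X,X]_{χ̄}(φ)(t,·) a.s. for all t and φ ∈ χ̄; and (ii) for every continuous Γ: [0,T]×H → D(A*) the forward integral ∫_0^t ⟨Γ(r,X(r)), d⁻X(r)⟩ exists. Then for all t ∈ [0,T], a.s., F(t,X(t)) = F(0,X(0)) + ∫_0^t ⟨∂ₓF(r,X(r)), d⁻X(r)⟩ + (1/2)∫_0^t ⟨∂²ₓₓF(r,X(r)), dC(r)⟩_{(H⊗̂_π H)*,(H⊗̂_π H)} + ∫_0^t ∂ᵣF(r,X(r)) dr. -/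
open MeasureTheory Filter Topology Set Metric
open scoped ENNReal NNReal RealInnerProductSpace

noncomputable section

namespace Stmt

variable {Ω : Type*} [mΩ : MeasurableSpace Ω]

variable {H : Type*} [NormedAddCommGroup H] [InnerProductSpace ℝ H] [CompleteSpace H]

/-- `S` is a `C₀`-semigroup on `H`. -/
def IsC0Semigroup (S : ℝ → H →L[ℝ] H) : Prop :=
  S 0 = ContinuousLinearMap.id ℝ H ∧
  (∀ s t : ℝ, 0 ≤ s → 0 ≤ t → S (s + t) = (S s).comp (S t)) ∧
  ∀ x : H, ContinuousOn (fun t => S t x) (Ici 0)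

/-- `(domA, Aadj)` is the generator of the adjoint semigroup `t ↦ S(t)*`; equivalently,
`domA = D(A*)` and `Aadj = A*` where `A` is the generator of `S`. -/
def IsAdjointGenerator (S : ℝ → H →L[ℝ] H) (domA : Set H) (Aadj : H → H) : Prop :=
  (∀ z : H, z ∈ domA ↔
    ∃ l : H, Tendsto (fun t : ℝ => t⁻¹ • ((S t).adjoint z - z)) (𝓝[>] (0:ℝ)) (𝓝 l)) ∧
  ∀ z ∈ domA,
    Tendsto (fun t : ℝ => t⁻¹ • ((S t).adjoint z - z)) (𝓝[>] (0:ℝ)) (𝓝 (Aadj z))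

/-- The graph norm of `z ∈ D(A*)`. -/
def graphNorm (Aadj : H → H) (z : H) : ℝ := Real.sqrt (‖z‖ ^ 2 + ‖Aadj z‖ ^ 2)

/-- The norm of `u ∈ H ⊆ H** ⊆ D(A*)*` as an element of the dual of `D(A*)`
(the latter endowed with the graph norm). -/
def domDualNorm (domA : Set H) (Aadj : H → H) (u : H) : ℝ :=
  ⨆ z : {z : H // z ∈ domA ∧ ‖z‖ ^ 2 + ‖Aadj z‖ ^ 2 ≤ 1}, |⟪u, z.1⟫|

/-- Condition **H1** for the `χ̄ = D(A*) ⊗̂π D(A*)`-covariation of `(X,Y)`. -/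
def DomCondH1 (domA : Set H) (Aadj : H → H) (μ : Measure Ω) (T : ℝ)
    (X Y : ℝ → Ω → H) : Prop :=
  ∀ e : ℕ → ℝ, (∀ n, 0 < e n) → Antitone e → Tendsto e atTop (𝓝 0) →
    ∃ k : ℕ → ℕ, StrictMono k ∧
      ∀ᵐ ω ∂μ, BddAbove (range fun j =>
        ∫ r in Ioc (0:ℝ) T,
          domDualNorm domA Aadj (X (r + e (k j)) ω - X r ω) *
            domDualNorm domA Aadj (Y (r + e (k j)) ω - Y r ω) / e (k j))

/-- `u` (an element of `(H ⊗̂π H)**`, viewed as a functional on the bounded bilinear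
forms on `H × H`) belongs to the canonical image of `H ⊗̂π H`. -/
def InProjTensorImage (u : (H →L[ℝ] H →L[ℝ] ℝ) → ℝ) : Prop :=
  ∃ (x : ℕ → H) (y : ℕ → H), Summable (fun k => ‖x k‖ * ‖y k‖) ∧
    ∀ ψ : H →L[ℝ] H →L[ℝ] ℝ, u ψ = ∑' k, ψ (x k) (y k)

/-- `I` is the real-valued forward integral `∫₀^· ⟨Z(r), d⁻X(r)⟩`. -/
def IsForwardPairing (μ : Measure Ω) (T : ℝ) (Z X : ℝ → Ω → H)
    (I : ℝ → Ω → ℝ) : Prop :=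
  (∀ᵐ ω ∂μ, ContinuousOn (fun t => I t ω) (Icc 0 T)) ∧
  ∀ t ∈ Icc (0:ℝ) T,
    TendstoInMeasure μ
      (fun ε ω => ε⁻¹ * ∫ r in Ioc (0:ℝ) t, ⟪Z r ω, X (r + ε) ω - X r ω⟫)
      (𝓝[>] (0:ℝ)) (I t)

/-- Left-point Riemann–Stieltjes sums, along the `n`-th dyadic partition of `[0,T]`, for
the integral `∫₀ᵗ ⟨Ψ(r), dC(r)⟩` of a `(H ⊗̂π H)*`-valued process `Ψ` against an
`(H ⊗̂π H)`-valued bounded variation process `C`. -/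
def dyadicPairingSum (T : ℝ) (Ψ : ℝ → Ω → (H →L[ℝ] H →L[ℝ] ℝ))
    (C : ℝ → Ω → ((H →L[ℝ] H →L[ℝ] ℝ) → ℝ)) (n : ℕ) (t : ℝ) (ω : Ω) : ℝ :=
  ∑ i ∈ Finset.range (2 ^ n),
    (C (min t (T * ((i : ℝ) + 1) / 2 ^ n)) ω (Ψ (T * (i : ℝ) / 2 ^ n) ω) -
      C (min t (T * (i : ℝ) / 2 ^ n)) ω (Ψ (T * (i : ℝ) / 2 ^ n) ω))

section

set_option linter.unusedSectionVars false

/-! ### Convergence in outer measure -/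

theorem measure_eventually_mem_le (μ : Measure Ω) {A : ℕ → Set Ω} {a : ℝ≥0∞}
    (h : ∀ᶠ j in atTop, μ (A j) ≤ a) : μ {ω | ∀ᶠ j in atTop, ω ∈ A j} ≤ a := by
  have hmono : Monotone fun k : ℕ => {ω | ∀ j ≥ k, ω ∈ A j} :=
    fun k l hkl ω hω j hj => hω j (hkl.trans hj)
  have heq : {ω | ∀ᶠ j in atTop, ω ∈ A j} = ⋃ k : ℕ, {ω | ∀ j ≥ k, ω ∈ A j} := by
    ext ω; simp [eventually_atTop]
  rw [heq, hmono.measure_iUnion]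
  refine iSup_le fun k => ?_
  obtain ⟨j, hj, hkj⟩ := (h.and (eventually_ge_atTop k)).exists
  exact (measure_mono fun ω (hω : ∀ j ≥ k, ω ∈ A j) => hω j hkj).trans hj

/-- Finitely many sequences converging in measure converge almost everywhere along a common
subsequence. -/
theorem exists_common_seq_tendsto_ae {ι : Type*} [Fintype ι] (μ : Measure Ω)
    {f : ι → ℕ → Ω → ℝ} {g : ι → Ω → ℝ}
    (h : ∀ i, TendstoInMeasure μ (f i) atTop (g i)) :
    ∃ ns : ℕ → ℕ, StrictMono ns ∧
      ∀ᵐ ω ∂μ, ∀ i, Tendsto (fun n => f i (ns n) ω) atTop (𝓝 (g i ω)) := by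
  have hpi : TendstoInMeasure μ (fun n ω i => f i n ω) atTop (fun ω i => g i ω) := by
    intro ε hε
    have hsum : Tendsto (fun n => ∑ i, μ {ω | ε ≤ edist (f i n ω) (g i ω)}) atTop (𝓝 0) := by
      simpa using tendsto_finsetSum Finset.univ fun i _ => h i ε hε
    refine tendsto_of_tendsto_of_tendsto_of_le_of_le tendsto_const_nhds hsum
      (fun _ => zero_le) fun n => ?_
    refine (measure_mono fun ω hω => ?_).trans (measure_iUnion_fintype_le μ _)
    by_contra hcon
    simp only [mem_iUnion, mem_ofPred_eq, not_exists, not_le] at hcon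
    refine absurd (show ε ≤ _ from hω) (not_le.2 ?_)
    rw [edist_pi_def, Finset.sup_lt_iff hε]
    exact fun i _ => hcon i
  obtain ⟨ns, hns, hae⟩ := hpi.exists_seq_tendsto_ae
  refine ⟨ns, hns, hae.mono fun ω hω i => ?_⟩
  exact tendsto_pi_nhds.1 hω i

/-- A Banach–Steinhaus principle for pathwise continuous additive maps converging in measure. -/
theorem exists_measure_sub_le_of_tendstoInMeasure {E : Type*} [NormedAddCommGroup E]
    [CompleteSpace E] (μ : Measure Ω) {Φ : ℕ → E → Ω → ℝ} {Ψ : E → Ω → ℝ}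
    (hsub : ∀ n x y ω, Φ n (x - y) ω = Φ n x ω - Φ n y ω)
    (hcont : ∀ n ω, Continuous fun x => Φ n x ω)
    (hconv : ∀ x, TendstoInMeasure μ (fun n => Φ n x) atTop (Ψ x))
    {η : ℝ} (hη : 0 < η) :
    ∃ N : ℕ, ∃ ρ > 0, ∀ x, ‖x‖ ≤ ρ →
      μ {ω | 3 * η < |Φ N x ω - Ψ x ω|} ≤ 3 * ENNReal.ofReal η := by
  set a := ENNReal.ofReal η with ha
  have ha0 : 0 < a := ENNReal.ofReal_pos.2 hη
  have hconv' : ∀ x, ∀ δ : ℝ, 0 < δ → ∀ b : ℝ≥0∞, 0 < b →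
      ∀ᶠ n in atTop, μ {ω | δ ≤ |Φ n x ω - Ψ x ω|} ≤ b := by
    intro x δ hδ b hb
    have := tendstoInMeasure_iff_norm.1 (hconv x) δ hδ
    exact (this.eventually_lt_const hb).mono fun n hn => hn.le
  let S : ℕ → Set E := fun N =>
    {x | ∀ n ≥ N, ∀ m ≥ N, μ {ω | η < |Φ n x ω - Φ m x ω|} ≤ a}
  have hclosed : ∀ N, IsClosed (S N) := by
    intro N
    refine IsSeqClosed.isClosed fun u x hu hx n hn m hm => ?_
    refine (measure_mono fun ω hω => ?_).trans
      (measure_eventually_mem_le μ (Eventually.of_forall fun i => hu i n hn m hm))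
    have hc : Continuous fun y => |Φ n y ω - Φ m y ω| :=
      ((hcont n ω).sub (hcont m ω)).abs
    exact (hc.continuousAt.tendsto.comp hx).eventually_const_lt hω
  have hcover : ⋃ N, S N = univ := by
    refine eq_univ_of_forall fun x => mem_iUnion.2 ?_
    obtain ⟨N, hN⟩ := eventually_atTop.1 (hconv' x (η / 2) (half_pos hη) (a / 2)
      (ENNReal.half_pos ha0.ne'))
    refine ⟨N, fun n hn m hm => ?_⟩
    refine (measure_mono fun ω hω => ?_).trans ((measure_union_le _ _).trans
      ((add_le_add (hN n hn) (hN m hm)).trans (ENNReal.add_halves a).le))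
    by_contra hcon
    simp only [mem_union, mem_ofPred_eq, not_or, not_le] at hcon hω
    have := abs_sub_le (Φ n x ω) (Ψ x ω) (Φ m x ω)
    rw [abs_sub_comm (Ψ x ω)] at this
    linarith
  obtain ⟨N, x₀, hx₀⟩ := nonempty_interior_of_iUnion_of_closed hclosed hcover
  obtain ⟨ρ, hρ, hball⟩ := Metric.isOpen_iff.1 isOpen_interior x₀ hx₀
  have hx₀S : x₀ ∈ S N := interior_subset hx₀
  refine ⟨N, ρ / 2, half_pos hρ, fun x hx => ?_⟩
  have hxS : x₀ + x ∈ S N := by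
    refine interior_subset (hball ?_)
    rw [mem_ball, dist_eq_norm, add_sub_cancel_left]
    linarith
  obtain ⟨m, hm, hNm⟩ := ((hconv' x η hη a ha0).and (eventually_ge_atTop N)).exists
  have h3 : a + a + a = 3 * a := by ring
  refine (measure_mono fun ω hω => ?_).trans ((measure_union_le _ _).trans
      ((add_le_add ((measure_union_le _ _).trans
        (add_le_add (hxS N le_rfl m hNm) (hx₀S N le_rfl m hNm))) hm).trans h3.le))
  by_contra hcon
  simp only [mem_union, mem_ofPred_eq, not_or, not_le, not_lt] at hcon hω
  obtain ⟨⟨h1, h2⟩, h3⟩ := hcon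
  have e1 : ∀ k, Φ k x ω = Φ k (x₀ + x) ω - Φ k x₀ ω := fun k => by
    rw [← hsub, add_sub_cancel_left]
  have := abs_sub_le (Φ N x ω) (Φ m x ω) (Ψ x ω)
  have h4 : |Φ N x ω - Φ m x ω| ≤ 2 * η := by
    rw [e1 N, e1 m]
    have := abs_sub (Φ N (x₀ + x) ω - Φ m (x₀ + x) ω) (Φ N x₀ ω - Φ m x₀ ω)
    rw [show Φ N (x₀ + x) ω - Φ N x₀ ω - (Φ m (x₀ + x) ω - Φ m x₀ ω) =
      Φ N (x₀ + x) ω - Φ m (x₀ + x) ω - (Φ N x₀ ω - Φ m x₀ ω) by ring]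
    linarith
  linarith

/-! ### Stability of forward integrals -/

/-- The regularised forward integral `ε⁻¹ ∫₀ᵗ ⟨z(r), x(r+ε) - x(r)⟩ dr` of a path. -/
def regPairing (z x : ℝ → H) (t ε : ℝ) : ℝ :=
  ε⁻¹ * ∫ r in Ioc (0:ℝ) t, ⟪z r, x (r + ε) - x r⟫

theorem integrableOn_pairing {z x : ℝ → H} (hz : Continuous z) (hx : Continuous x) (t ε : ℝ) :
    IntegrableOn (fun r => ⟪z r, x (r + ε) - x r⟫) (Ioc 0 t) :=
  Continuous.integrableOn_Ioc (by fun_prop)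

theorem regPairing_sub {z z' x : ℝ → H} (hz : Continuous z) (hz' : Continuous z')
    (hx : Continuous x) (t ε : ℝ) :
    regPairing (fun r => z r - z' r) x t ε = regPairing z x t ε - regPairing z' x t ε := by
  simp only [regPairing, inner_sub_left]
  rw [integral_sub (integrableOn_pairing hz hx t ε) (integrableOn_pairing hz' hx t ε), mul_sub]

theorem regPairing_congr {z z' x : ℝ → H} {t ε : ℝ} (h : ∀ r ∈ Ioc 0 t, z r = z' r) :
    regPairing z x t ε = regPairing z' x t ε := by
  simp only [regPairing]
  congr 1
  exact setIntegral_congr_fun measurableSet_Ioc fun r hr => by simp only [h r hr]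

theorem abs_regPairing_le {z x : ℝ → H} (hx : Continuous x) {t ε δ : ℝ}
    (h : ∀ r ∈ Ioc 0 t, ‖z r‖ ≤ δ) :
    |regPairing z x t ε| ≤ |ε⁻¹| * (∫ r in Ioc (0:ℝ) t, ‖x (r + ε) - x r‖) * δ := by
  rw [regPairing, abs_mul, mul_assoc]
  refine mul_le_mul_of_nonneg_left ?_ (abs_nonneg _)
  rw [← integral_mul_const, ← Real.norm_eq_abs]
  refine norm_integral_le_of_norm_le (Continuous.integrableOn_Ioc (by fun_prop)) ?_
  refine (ae_restrict_iff' measurableSet_Ioc).2 (Eventually.of_forall fun r hr => ?_)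
  rw [mul_comm]
  exact (norm_inner_le_norm _ _).trans (mul_le_mul_of_nonneg_right (h r hr) (norm_nonneg _))

/-- Radial truncation of a vector to the closed ball of radius `ρ`. -/
def radialTrunc {E : Type*} [NormedAddCommGroup E] [NormedSpace ℝ E] (ρ : ℝ) (v : E) : E :=
  (ρ / max ρ ‖v‖) • v

theorem continuous_radialTrunc {E : Type*} [NormedAddCommGroup E] [NormedSpace ℝ E] {ρ : ℝ}
    (hρ : 0 < ρ) : Continuous (radialTrunc ρ : E → E) :=
  (continuous_const.div (continuous_const.max continuous_norm)
    fun _ => (lt_max_of_lt_left hρ).ne').smul continuous_id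

theorem norm_radialTrunc_le {E : Type*} [NormedAddCommGroup E] [NormedSpace ℝ E] {ρ : ℝ}
    (hρ : 0 < ρ) (v : E) : ‖radialTrunc ρ v‖ ≤ ρ := by
  have hm : 0 < max ρ ‖v‖ := lt_max_of_lt_left hρ
  rw [radialTrunc, norm_smul, Real.norm_of_nonneg (by positivity), div_mul_eq_mul_div,
    div_le_iff₀ hm]
  exact mul_le_mul_of_nonneg_left (le_max_right _ _) hρ.le

theorem radialTrunc_of_norm_le {E : Type*} [NormedAddCommGroup E] [NormedSpace ℝ E] {ρ : ℝ}
    (hρ : 0 < ρ) {v : E} (hv : ‖v‖ ≤ ρ) : radialTrunc ρ v = v := by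
  rw [radialTrunc, max_eq_left hv, div_self hρ.ne', one_smul]

theorem IsForwardPairing.tendsto_regPairing {μ : Measure Ω} {T : ℝ} {Z X : ℝ → Ω → H}
    {I : ℝ → Ω → ℝ} (h : IsForwardPairing μ T Z X I) {t : ℝ} (ht : t ∈ Icc 0 T) {e : ℕ → ℝ}
    (he : Tendsto e atTop (𝓝[>] 0)) :
    TendstoInMeasure μ (fun n ω => regPairing (fun r => Z r ω) (fun r => X r ω) t (e n)) atTop
      (I t) :=
  fun ε hε => (h.2 t ht ε hε).comp he

theorem tendsto_one_div_nhdsGT_zero :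
    Tendsto (fun n : ℕ => 1 / ((n : ℝ) + 1)) atTop (𝓝[>] (0:ℝ)) :=
  tendsto_nhdsWithin_iff.2 ⟨tendsto_one_div_add_atTop_nhds_zero_nat,
    Eventually.of_forall fun _ => mem_Ioi.2 Nat.one_div_pos_of_nat⟩

open scoped BoundedContinuousFunction in
/-- If all continuous `G`-valued integrands have forward integrals, then forward integrals are
stable under convergence of the integrands that is uniform along each path. -/
theorem forwardPairing_stability (μ : Measure Ω) {T : ℝ} {X : ℝ → Ω → H}
    (hX : ∀ ω, Continuous fun t => X t ω) {G : Submodule ℝ (H × H)}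
    (hG : IsClosed (G : Set (H × H)))
    (hFwd : ∀ f : ℝ × H → G, Continuous f →
      ∃ I, IsForwardPairing μ T (fun r ω => (f (r, X r ω) : H × H).1) X I)
    {f : ℕ → ℝ × H → G} {f₀ : ℝ × H → G} (hf : ∀ n, Continuous (f n)) (hf₀ : Continuous f₀)
    (hunif : ∀ ω, TendstoUniformlyOn (fun n r => f n (r, X r ω)) (fun r => f₀ (r, X r ω))
      atTop (Icc 0 T))
    {I : ℕ → ℝ → Ω → ℝ} {I₀ : ℝ → Ω → ℝ}
    (hI : ∀ n, IsForwardPairing μ T (fun r ω => (f n (r, X r ω) : H × H).1) X (I n))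
    (hI₀ : IsForwardPairing μ T (fun r ω => (f₀ (r, X r ω) : H × H).1) X I₀)
    {t : ℝ} (ht : t ∈ Icc 0 T) {J : ℕ → Ω → ℝ} {J₀ : Ω → ℝ}
    (hIJ : ∀ n, ∀ᵐ ω ∂μ, I n t ω = J n ω)
    (hJ : ∀ᵐ ω ∂μ, Tendsto (fun n => J n ω) atTop (𝓝 (J₀ ω))) :
    ∀ᵐ ω ∂μ, I₀ t ω = J₀ ω := by
  have : CompleteSpace G := hG.completeSpace_coe
  have hsubset : Ioc 0 t ⊆ Icc 0 T := fun r hr => ⟨hr.1.le, hr.2.trans ht.2⟩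
  set e : ℕ → ℝ := fun n => 1 / ((n : ℝ) + 1) with he_def
  have he : Tendsto e atTop (𝓝[>] 0) := tendsto_one_div_nhdsGT_zero
  have hpath : ∀ g : ℝ × H → G, Continuous g → ∀ ω,
      Continuous fun r => (g (r, X r ω) : H × H).1 := fun g hg ω =>
    continuous_fst.comp (continuous_subtype_val.comp
      (hg.comp (continuous_id.prodMk (hX ω))))
  let Φ : ℕ → (ℝ × H →ᵇ G) → Ω → ℝ := fun n φ ω =>
    regPairing (fun r => (φ (r, X r ω) : H × H).1) (fun r => X r ω) t (e n)
  have hsub : ∀ n φ ψ ω, Φ n (φ - ψ) ω = Φ n φ ω - Φ n ψ ω := fun n φ ψ ω =>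
    regPairing_sub (hpath φ φ.continuous ω) (hpath ψ ψ.continuous ω) (hX ω) t (e n)
  have hnorm : ∀ v : G, ‖(v : H × H).1‖ ≤ ‖v‖ := fun v => norm_fst_le (v : H × H)
  have hcont : ∀ n ω, Continuous fun φ => Φ n φ ω := by
    intro n ω
    refine (LipschitzWith.of_dist_le_mul (K := Real.toNNReal
      (|(e n)⁻¹| * ∫ r in Ioc (0:ℝ) t, ‖X (r + e n) ω - X r ω‖)) fun φ ψ => ?_).continuous
    have hd : dist φ ψ = ‖φ - ψ‖ := dist_eq_norm φ ψ
    rw [Real.coe_toNNReal _ (by positivity), Real.dist_eq, ← hsub, hd]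
    exact abs_regPairing_le (hX ω) fun r _ => (hnorm _).trans ((φ - ψ).norm_coe_le_norm _)
  choose K hK using fun φ : ℝ × H →ᵇ G => hFwd φ φ.continuous
  have hconv : ∀ φ, TendstoInMeasure μ (fun n => Φ n φ) atTop (K φ t) := fun φ =>
    (hK φ).tendsto_regPairing ht he
  have key : ∀ η : ℝ, 0 < η →
      μ {ω | 4 * η < |I₀ t ω - J₀ ω|} ≤ 3 * ENNReal.ofReal η := by
    intro η hη
    obtain ⟨N, ρ, hρ, hN⟩ := exists_measure_sub_le_of_tendstoInMeasure μ hsub hcont hconv hη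
    let g : ℕ → (ℝ × H →ᵇ G) := fun n => BoundedContinuousFunction.ofNormedAddCommGroup
      (fun p => radialTrunc ρ (f n p - f₀ p))
      ((continuous_radialTrunc hρ).comp ((hf n).sub hf₀)) ρ fun p => norm_radialTrunc_le hρ _
    have hg : ∀ n, ‖g n‖ ≤ ρ := fun n =>
      BoundedContinuousFunction.norm_ofNormedAddCommGroup_le _ hρ.le _
    have hKg : ∀ᵐ ω ∂μ, ∀ n, (∀ r ∈ Icc 0 T, ‖f n (r, X r ω) - f₀ (r, X r ω)‖ ≤ ρ) →
        K (g n) t ω = I n t ω - I₀ t ω := by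
      refine ae_all_iff.2 fun n => ?_
      obtain ⟨ns, hns, hae⟩ := exists_common_seq_tendsto_ae μ
        (f := ![fun k => Φ k (g n), fun k ω => regPairing
            (fun r => (f n (r, X r ω) : H × H).1) (fun r => X r ω) t (e k),
          fun k ω => regPairing
            (fun r => (f₀ (r, X r ω) : H × H).1) (fun r => X r ω) t (e k)])
        (g := ![K (g n) t, I n t, I₀ t]) (by
          intro i
          fin_cases i
          exacts [hconv (g n), (hI n).tendsto_regPairing ht he, hI₀.tendsto_regPairing ht he])
      filter_upwards [hae] with ω hω hsmall
      refine tendsto_nhds_unique (hω 0) (((hω 1).sub (hω 2)).congr fun k => ?_)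
      change regPairing (fun r => (f n (r, X r ω) : H × H).1) (fun r => X r ω) t (e (ns k)) -
        regPairing (fun r => (f₀ (r, X r ω) : H × H).1) (fun r => X r ω) t (e (ns k)) =
        regPairing (fun r => (g n (r, X r ω) : H × H).1) (fun r => X r ω) t (e (ns k))
      rw [← regPairing_sub (hpath _ (hf n) ω) (hpath _ hf₀ ω) (hX ω)]
      refine regPairing_congr fun r hr => ?_
      change _ = ((radialTrunc ρ (f n (r, X r ω) - f₀ (r, X r ω)) : G) : H × H).1
      rw [radialTrunc_of_norm_le hρ (hsmall r (hsubset hr))]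
      rfl
    refine (measure_mono_ae ?_).trans
      (measure_eventually_mem_le μ (Eventually.of_forall fun n => hN (g n) (hg n)))
    filter_upwards [hKg, ae_all_iff.2 hIJ, hJ] with ω h1 h2 h3 h4
    have hΦ : Tendsto (fun n => Φ N (g n) ω) atTop (𝓝 0) := by
      set c := |(e N)⁻¹| * ∫ r in Ioc (0:ℝ) t, ‖X (r + e N) ω - X r ω‖ with hc
      have hc0 : 0 ≤ c := by positivity
      refine Metric.tendsto_atTop'.2 fun δ hδ => ?_
      have hev := Metric.tendstoUniformlyOn_iff.1 (hunif ω) (min ρ (δ / (c + 1)))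
        (lt_min hρ (by positivity))
      obtain ⟨n₀, hn₀⟩ := eventually_atTop.1 hev
      refine ⟨n₀, fun n hn => ?_⟩
      rw [Real.dist_eq, sub_zero]
      refine (abs_regPairing_le (δ := δ / (c + 1)) (hX ω) fun r hr => ?_).trans_lt ?_
      · have h5 := hn₀ n hn.le r (hsubset hr)
        rw [dist_comm, dist_eq_norm, lt_min_iff] at h5
        refine (hnorm _).trans ?_
        change ‖radialTrunc ρ (f n (r, X r ω) - f₀ (r, X r ω))‖ ≤ _
        rw [radialTrunc_of_norm_le hρ h5.1.le]
        exact h5.2.le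
      · rw [← hc, mul_div_assoc', div_lt_iff₀ (by positivity)]
        nlinarith
    have hsm : ∀ᶠ n in atTop, K (g n) t ω = J n ω - I₀ t ω := by
      filter_upwards [Metric.tendstoUniformlyOn_iff.1 (hunif ω) ρ hρ] with n hn
      rw [← h2 n]
      refine h1 n fun r hr => ?_
      have := hn r hr
      rw [dist_comm, dist_eq_norm] at this
      exact this.le
    have hlim : Tendsto (fun n => |Φ N (g n) ω - K (g n) t ω|) atTop
        (𝓝 |0 - (J₀ ω - I₀ t ω)|) :=
      (hΦ.sub ((h3.sub_const _).congr' (hsm.mono fun n hn => hn.symm))).abs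
    refine hlim.eventually_const_lt ?_
    have h4' : 4 * η < |I₀ t ω - J₀ ω| := h4
    rw [zero_sub, neg_sub]
    linarith
  have hnull : ∀ m : ℕ, μ {ω | 4 * (1 / ((m : ℝ) + 1)) < |I₀ t ω - J₀ ω|} = 0 := by
    intro m
    have hlim : Tendsto (fun k : ℕ => 3 * ENNReal.ofReal (e k)) atTop (𝓝 0) := by
      have h0 : Tendsto e atTop (𝓝 0) := tendsto_one_div_add_atTop_nhds_zero_nat
      have := ENNReal.Tendsto.const_mul (a := 3) (ENNReal.tendsto_ofReal h0)
        (Or.inr (by norm_num))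
      simpa using this
    refine le_antisymm (ge_of_tendsto hlim ?_) zero_le
    filter_upwards [eventually_ge_atTop m] with k hk
    refine (measure_mono fun ω hω => ?_).trans (key (e k) Nat.one_div_pos_of_nat)
    have h1 : e k ≤ 1 / ((m : ℝ) + 1) := Nat.one_div_le_one_div hk
    have h2 : 4 * (1 / ((m : ℝ) + 1)) < |I₀ t ω - J₀ ω| := hω
    change 4 * e k < _
    linarith
  have hall : ∀ᵐ ω ∂μ, ∀ m : ℕ, ¬ 4 * (1 / ((m : ℝ) + 1)) < |I₀ t ω - J₀ ω| :=
    ae_all_iff.2 fun m => by simpa [ae_iff] using hnull m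
  filter_upwards [hall] with ω hω
  by_contra hne
  have hpos : 0 < |I₀ t ω - J₀ ω| := abs_pos.2 (sub_ne_zero.2 hne)
  obtain ⟨m, hm⟩ := exists_nat_one_div_lt (div_pos hpos four_pos)
  exact hω m (by linarith)

/-! ### Riemann–Stieltjes integrals -/

theorem InProjTensorImage.exists_clm {u : (H →L[ℝ] H →L[ℝ] ℝ) → ℝ} (hu : InProjTensorImage u) :
    ∃ l : (H →L[ℝ] H →L[ℝ] ℝ) →L[ℝ] ℝ, ∀ ψ, u ψ = l ψ := by
  obtain ⟨x, y, hs, hu⟩ := hu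
  have hb : ∀ (ψ : H →L[ℝ] H →L[ℝ] ℝ) k, ‖ψ (x k) (y k)‖ ≤ ‖ψ‖ * (‖x k‖ * ‖y k‖) :=
    fun ψ k => (ψ.le_opNorm₂ _ _).trans_eq (mul_assoc _ _ _)
  have hsum : ∀ ψ : H →L[ℝ] H →L[ℝ] ℝ, Summable fun k => ψ (x k) (y k) := fun ψ =>
    Summable.of_norm_bounded (hs.mul_left ‖ψ‖) (hb ψ)
  refine ⟨LinearMap.mkContinuous
    { toFun := u
      map_add' := fun ψ φ => by
        simp only [hu, add_apply]
        exact (hsum ψ).tsum_add (hsum φ)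
      map_smul' := fun a ψ => by
        simp only [hu, smul_apply, RingHom.id_apply, smul_eq_mul]
        exact tsum_mul_left } (∑' k, ‖x k‖ * ‖y k‖) fun ψ => ?_, fun ψ => rfl⟩
  change ‖u ψ‖ ≤ _
  rw [hu, mul_comm, ← tsum_mul_left]
  exact tsum_of_norm_bounded (hs.mul_left ‖ψ‖).hasSum (hb ψ)

/-- Elements of the projective tensor product are continuous for bounded pointwise convergence
of bilinear forms. -/
theorem InProjTensorImage.tendsto {u : (H →L[ℝ] H →L[ℝ] ℝ) → ℝ} (hu : InProjTensorImage u)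
    {ψ : ℕ → H →L[ℝ] H →L[ℝ] ℝ} {ψ₀ : H →L[ℝ] H →L[ℝ] ℝ} {K : ℝ}
    (hK : ∀ᶠ n in atTop, ‖ψ n‖ ≤ K)
    (h : ∀ x y, Tendsto (fun n => ψ n x y) atTop (𝓝 (ψ₀ x y))) :
    Tendsto (fun n => u (ψ n)) atTop (𝓝 (u ψ₀)) := by
  obtain ⟨x, y, hs, hu⟩ := hu
  simp only [hu]
  refine tendsto_tsum_of_dominated_convergence (hs.mul_left K) (fun k => h _ _) ?_
  filter_upwards [hK] with n hn k
  exact ((ψ n).le_opNorm₂ _ _).trans ((mul_assoc _ _ _).trans_le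
    (mul_le_mul_of_nonneg_right hn (by positivity)))

/-- Left-point Riemann–Stieltjes sums along dyadic partitions. -/
def rsSum {E : Type*} (T : ℝ) (c : ℝ → E → ℝ) (Ψ : ℝ → E) (n : ℕ) (t : ℝ) : ℝ :=
  ∑ i ∈ Finset.range (2 ^ n),
    (c (min t (T * ((i : ℝ) + 1) / 2 ^ n)) (Ψ (T * (i : ℝ) / 2 ^ n)) -
      c (min t (T * (i : ℝ) / 2 ^ n)) (Ψ (T * (i : ℝ) / 2 ^ n)))

/-- The limit of the dyadic Riemann–Stieltjes sums. -/
def rsIntegral {E : Type*} (T : ℝ) (c : ℝ → E → ℝ) (Ψ : ℝ → E) (t : ℝ) : ℝ :=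
  limUnder atTop fun n => rsSum T c Ψ n t

theorem sum_range_mul_telescope (g : ℕ → ℕ → ℝ) (m q : ℕ) :
    ∑ k ∈ Finset.range (m * q), (g (k + 1) (k / q) - g k (k / q)) =
      ∑ i ∈ Finset.range m, (g ((i + 1) * q) i - g (i * q) i) := by
  induction m with
  | zero => simp
  | succ m ih =>
    rw [Finset.sum_range_succ, ← ih, Nat.succ_mul, Finset.sum_range_add]
    congr 1
    refine .trans ?_ (Finset.sum_range_sub (fun k => g (m * q + k) m) q)
    refine Finset.sum_congr rfl fun x hx => ?_
    have hx := Finset.mem_range.1 hx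
    rw [Nat.add_div_eq_of_add_mod_lt (by rw [Nat.mul_mod_left, zero_add]; exact Nat.mod_lt _ (by lia)),
      Nat.mul_div_cancel _ (by lia), Nat.div_eq_of_lt hx, add_zero, add_assoc]

theorem dyadic_mem_Icc {T : ℝ} (hT : 0 ≤ T) {n k : ℕ} (hk : k ≤ 2 ^ n) :
    T * (k : ℝ) / 2 ^ n ∈ Icc 0 T := by
  refine ⟨by positivity, ?_⟩
  rw [mul_div_assoc]
  refine mul_le_of_le_one_right hT ((div_le_one (by positivity)).2 (by exact_mod_cast hk))

theorem dyadic_succ_mem_Icc {T : ℝ} (hT : 0 ≤ T) {n k : ℕ} (hk : k < 2 ^ n) :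
    T * ((k : ℝ) + 1) / 2 ^ n ∈ Icc 0 T := by
  simpa using dyadic_mem_Icc hT (Nat.succ_le_iff.2 hk)

variable {E : Type*} [NormedAddCommGroup E] [NormedSpace ℝ E]

theorem abs_sub_le_of_iSup_le {u v : E →L[ℝ] ℝ} {a : ℝ}
    (h : (⨆ ψ : {ψ : E // ‖ψ‖ ≤ 1}, |u ψ.1 - v ψ.1|) ≤ a)
    (ψ : E) : |u ψ - v ψ| ≤ a * ‖ψ‖ := by
  have hbdd : BddAbove (range fun ψ : {ψ : E // ‖ψ‖ ≤ 1} =>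
      |u ψ.1 - v ψ.1|) := by
    refine ⟨‖u - v‖, ?_⟩
    rintro _ ⟨φ, rfl⟩
    exact (u - v).unit_le_opNorm φ.1 φ.2
  have ha : 0 ≤ a := (Real.iSup_nonneg fun _ => abs_nonneg _).trans h
  refine (u - v).le_of_opNorm_le (ContinuousLinearMap.opNorm_le_of_unit_norm ha fun φ hφ => ?_) ψ
  exact (le_ciSup hbdd ⟨φ, hφ.le⟩).trans h

theorem abs_sum_increment_le {T : ℝ} (hT : 0 ≤ T) {c : ℝ → E →L[ℝ] ℝ} {V : ℝ → ℝ}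
    (hc : ∀ s ∈ Icc 0 T, ∀ t ∈ Icc 0 T, s ≤ t → ∀ ψ, |c t ψ - c s ψ| ≤ (V t - V s) * ‖ψ‖)
    (hV : MonotoneOn V (Icc 0 T)) {t : ℝ} (ht : t ∈ Icc 0 T) {n : ℕ} {φ : ℕ → E} {η : ℝ}
    (hη : 0 ≤ η) (hφ : ∀ k < 2 ^ n, ‖φ k‖ ≤ η) :
    |∑ k ∈ Finset.range (2 ^ n), (c (min t (T * ((k : ℝ) + 1) / 2 ^ n)) (φ k) -
      c (min t (T * (k : ℝ) / 2 ^ n)) (φ k))| ≤ η * (V T - V 0) := by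
  have hmem : ∀ {s}, s ∈ Icc 0 T → min t s ∈ Icc 0 T := fun hs =>
    ⟨le_min ht.1 hs.1, (min_le_left _ _).trans ht.2⟩
  calc _ ≤ ∑ k ∈ Finset.range (2 ^ n), (V (min t (T * ((k + 1 : ℕ) : ℝ) / 2 ^ n)) -
        V (min t (T * (k : ℝ) / 2 ^ n))) * η := by
        refine (Finset.abs_sum_le_sum_abs _ _).trans (Finset.sum_le_sum fun k hk => ?_)
        have hk := Finset.mem_range.1 hk
        have h1 := hmem (dyadic_mem_Icc hT hk.le)
        have h2 := hmem (dyadic_succ_mem_Icc hT hk)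
        have hle : min t (T * (k : ℝ) / 2 ^ n) ≤ min t (T * ((k : ℝ) + 1) / 2 ^ n) :=
          min_le_min_left _ (by gcongr; linarith)
        push_cast
        exact (hc _ h1 _ h2 hle _).trans
          (mul_le_mul_of_nonneg_left (hφ k hk) (sub_nonneg.2 (hV h1 h2 hle)))
    _ = (V (min t (T * ((2 ^ n : ℕ) : ℝ) / 2 ^ n)) - V (min t (T * ((0 : ℕ) : ℝ) / 2 ^ n))) * η := by
        rw [← Finset.sum_mul, Finset.sum_range_sub
          (fun k : ℕ => V (min t (T * (k : ℝ) / 2 ^ n)))]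
    _ ≤ η * (V T - V 0) := by
        rw [mul_comm]
        refine mul_le_mul_of_nonneg_left (sub_le_sub ?_ ?_) hη
        · exact hV (hmem (dyadic_mem_Icc hT le_rfl)) ⟨hT, le_rfl⟩ ((min_le_left _ _).trans ht.2)
        · exact hV ⟨le_rfl, hT⟩ (hmem (dyadic_mem_Icc hT (by positivity)))
            (hmem (dyadic_mem_Icc hT (by positivity))).1

theorem abs_rsSum_sub_le {T : ℝ} (hT : 0 ≤ T) {c : ℝ → E →L[ℝ] ℝ} {V : ℝ → ℝ}
    (hc : ∀ s ∈ Icc 0 T, ∀ t ∈ Icc 0 T, s ≤ t → ∀ ψ, |c t ψ - c s ψ| ≤ (V t - V s) * ‖ψ‖)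
    (hV : MonotoneOn V (Icc 0 T)) {t : ℝ} (ht : t ∈ Icc 0 T) {Ψ : ℝ → E} {η : ℝ} (hη : 0 ≤ η)
    {N : ℕ} (hΨ : ∀ r ∈ Icc 0 T, ∀ s ∈ Icc 0 T, |r - s| ≤ T / 2 ^ N → ‖Ψ r - Ψ s‖ ≤ η)
    {n : ℕ} (hn : N ≤ n) :
    |rsSum T (fun s => c s) Ψ n t - rsSum T (fun s => c s) Ψ N t| ≤ η * (V T - V 0) := by
  obtain ⟨d, rfl⟩ := Nat.exists_eq_add_of_le hn
  have hnode : ∀ i : ℕ, T * (i : ℝ) / 2 ^ N = T * ((i * 2 ^ d : ℕ) : ℝ) / 2 ^ (N + d) := by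
    intro i
    push_cast
    rw [pow_add]
    field_simp
  have hN : rsSum T (fun s => c s) Ψ N t = ∑ k ∈ Finset.range (2 ^ (N + d)),
      (c (min t (T * ((k : ℝ) + 1) / 2 ^ (N + d))) (Ψ (T * ((k / 2 ^ d : ℕ) : ℝ) / 2 ^ N)) -
        c (min t (T * (k : ℝ) / 2 ^ (N + d))) (Ψ (T * ((k / 2 ^ d : ℕ) : ℝ) / 2 ^ N))) := by
    have := sum_range_mul_telescope (fun k i => c (min t (T * (k : ℝ) / 2 ^ (N + d)))
      (Ψ (T * (i : ℝ) / 2 ^ N))) (2 ^ N) (2 ^ d)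
    rw [← pow_add] at this
    simp only [← hnode] at this
    simpa only [rsSum, Nat.cast_add, Nat.cast_one] using this.symm
  rw [hN, rsSum, ← Finset.sum_sub_distrib]
  refine le_of_eq_of_le ?_ (abs_sum_increment_le hT hc hV ht (n := N + d) hη (φ := fun k =>
    Ψ (T * (k : ℝ) / 2 ^ (N + d)) - Ψ (T * ((k / 2 ^ d : ℕ) : ℝ) / 2 ^ N)) fun k hk => ?_)
  · congr 1
    refine Finset.sum_congr rfl fun k _ => ?_
    simp only [map_sub]
    ring
  · have hk' : k / 2 ^ d ≤ 2 ^ N := by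
      rw [pow_add] at hk
      exact ((Nat.div_lt_iff_lt_mul (by positivity)).2 hk).le
    refine hΨ _ (dyadic_mem_Icc hT hk.le) _ (dyadic_mem_Icc hT hk') ?_
    have h1 : ((k / 2 ^ d * 2 ^ d : ℕ) : ℝ) ≤ k := by exact_mod_cast Nat.div_mul_le_self _ _
    have h2 : (k : ℝ) ≤ ((k / 2 ^ d * 2 ^ d : ℕ) : ℝ) + 2 ^ d := by
      exact_mod_cast (Nat.lt_div_mul_add (a := k) (b := 2 ^ d) (by positivity)).le
    rw [hnode, ← sub_div, ← mul_sub, abs_of_nonneg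
      (div_nonneg (mul_nonneg hT (sub_nonneg.2 h1)) (by positivity)), pow_add,
      div_le_div_iff₀ (by positivity) (by positivity)]
    have h3 : (k : ℝ) - ((k / 2 ^ d * 2 ^ d : ℕ) : ℝ) ≤ 2 ^ d := by linarith
    calc _ ≤ T * 2 ^ d * 2 ^ N := by gcongr
      _ = _ := by ring

theorem tendsto_mesh (T : ℝ) : Tendsto (fun n : ℕ => T / 2 ^ n) atTop (𝓝 0) := by
  have := (tendsto_pow_atTop_nhds_zero_of_lt_one (r := (2⁻¹ : ℝ)) (by norm_num)
    (by norm_num)).const_mul T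
  simpa [div_eq_mul_inv] using this

theorem exists_mesh_modulus {T : ℝ} {Ψ : ℝ → E} (hΨ : ContinuousOn Ψ (Icc 0 T)) {η : ℝ}
    (hη : 0 < η) : ∃ N : ℕ, ∀ r ∈ Icc 0 T, ∀ s ∈ Icc 0 T, |r - s| ≤ T / 2 ^ N →
      ‖Ψ r - Ψ s‖ ≤ η := by
  obtain ⟨δ, hδ, h⟩ := Metric.uniformContinuousOn_iff_le.1
    (isCompact_Icc.uniformContinuousOn_of_continuous hΨ) η hη
  obtain ⟨N, hN⟩ := ((tendsto_mesh T).eventually_lt_const hδ).exists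
  refine ⟨N, fun r hr s hs hrs => ?_⟩
  rw [← dist_eq_norm]
  exact h r hr s hs (hrs.trans hN.le)

theorem tendsto_rsSum {T : ℝ} (hT : 0 ≤ T) {c : ℝ → E →L[ℝ] ℝ} {V : ℝ → ℝ}
    (hc : ∀ s ∈ Icc 0 T, ∀ t ∈ Icc 0 T, s ≤ t → ∀ ψ, |c t ψ - c s ψ| ≤ (V t - V s) * ‖ψ‖)
    (hV : MonotoneOn V (Icc 0 T)) {t : ℝ} (ht : t ∈ Icc 0 T) {Ψ : ℝ → E}
    (hΨ : ContinuousOn Ψ (Icc 0 T)) :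
    Tendsto (fun n => rsSum T (fun s => c s) Ψ n t) atTop
      (𝓝 (rsIntegral T (fun s => c s) Ψ t)) := by
  have hV0 : 0 ≤ V T - V 0 := sub_nonneg.2 (hV ⟨le_rfl, hT⟩ ⟨hT, le_rfl⟩ hT)
  refine CauchySeq.tendsto_limUnder (Metric.cauchySeq_iff'.2 fun ε hε => ?_)
  obtain ⟨N, hN⟩ := exists_mesh_modulus hΨ (η := ε / (V T - V 0 + 1)) (by positivity)
  refine ⟨N, fun n hn => ?_⟩
  refine (abs_rsSum_sub_le hT hc hV ht (by positivity) hN hn).trans_lt ?_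
  rw [div_mul_eq_mul_div, div_lt_iff₀ (by positivity)]
  exact mul_lt_mul_of_pos_left (by linarith) hε

theorem abs_rsSum_sub_rsIntegral_le {T : ℝ} (hT : 0 ≤ T) {c : ℝ → E →L[ℝ] ℝ} {V : ℝ → ℝ}
    (hc : ∀ s ∈ Icc 0 T, ∀ t ∈ Icc 0 T, s ≤ t → ∀ ψ, |c t ψ - c s ψ| ≤ (V t - V s) * ‖ψ‖)
    (hV : MonotoneOn V (Icc 0 T)) {t : ℝ} (ht : t ∈ Icc 0 T) {Ψ : ℝ → E}
    (hΨc : ContinuousOn Ψ (Icc 0 T)) {η : ℝ} (hη : 0 ≤ η)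
    {N : ℕ} (hΨ : ∀ r ∈ Icc 0 T, ∀ s ∈ Icc 0 T, |r - s| ≤ T / 2 ^ N → ‖Ψ r - Ψ s‖ ≤ η) :
    |rsIntegral T (fun s => c s) Ψ t - rsSum T (fun s => c s) Ψ N t| ≤ η * (V T - V 0) :=
  le_of_tendsto (((tendsto_rsSum hT hc hV ht hΨc).sub_const _).abs)
    ((eventually_ge_atTop N).mono fun _ hn => abs_rsSum_sub_le hT hc hV ht hη hΨ hn)

/-- Riemann–Stieltjes integrals converge when the integrands converge weakly at each time and
are uniformly equicontinuous. -/
theorem tendsto_rsIntegral {T : ℝ} (hT : 0 ≤ T) {c : ℝ → E →L[ℝ] ℝ} {V : ℝ → ℝ}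
    (hc : ∀ s ∈ Icc 0 T, ∀ t ∈ Icc 0 T, s ≤ t → ∀ ψ, |c t ψ - c s ψ| ≤ (V t - V s) * ‖ψ‖)
    (hV : MonotoneOn V (Icc 0 T)) {t : ℝ} (ht : t ∈ Icc 0 T) {Ψ : ℕ → ℝ → E} {Ψ₀ : ℝ → E}
    (hΨ : ∀ n, ContinuousOn (Ψ n) (Icc 0 T)) (hΨ₀ : ContinuousOn Ψ₀ (Icc 0 T))
    (hweak : ∀ r ∈ Icc 0 T, ∀ s, Tendsto (fun n => c s (Ψ n r)) atTop (𝓝 (c s (Ψ₀ r))))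
    (hequi : ∀ η > 0, ∃ N : ℕ, ∀ᶠ n in atTop, ∀ r ∈ Icc 0 T, ∀ s ∈ Icc 0 T,
      |r - s| ≤ T / 2 ^ N → ‖Ψ n r - Ψ n s‖ ≤ η) :
    Tendsto (fun n => rsIntegral T (fun s => c s) (Ψ n) t) atTop
      (𝓝 (rsIntegral T (fun s => c s) Ψ₀ t)) := by
  have hV0 : 0 ≤ V T - V 0 := sub_nonneg.2 (hV ⟨le_rfl, hT⟩ ⟨hT, le_rfl⟩ hT)
  refine Metric.tendsto_nhds.2 fun ε hε => ?_
  have hη : 0 < ε / 4 / (V T - V 0 + 1) := by positivity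
  have hηV : ε / 4 / (V T - V 0 + 1) * (V T - V 0) ≤ ε / 4 := by
    rw [div_mul_eq_mul_div, div_le_iff₀ (by positivity)]
    exact mul_le_mul_of_nonneg_left (by linarith) (by positivity)
  obtain ⟨N₁, hN₁⟩ := hequi _ hη
  obtain ⟨N₂, hN₂⟩ := exists_mesh_modulus hΨ₀ hη
  set N := max N₁ N₂
  have hmesh : ∀ {M : ℕ}, M ≤ N → T / 2 ^ N ≤ T / 2 ^ M := fun hM =>
    div_le_div_of_nonneg_left hT (by positivity) (pow_le_pow_right₀ (by norm_num) hM)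
  have hsum : Tendsto (fun n => rsSum T (fun s => c s) (Ψ n) N t) atTop
      (𝓝 (rsSum T (fun s => c s) Ψ₀ N t)) := by
    refine tendsto_finsetSum _ fun i hi => ?_
    have := dyadic_mem_Icc hT (Finset.mem_range.1 hi).le
    exact (hweak _ this _).sub (hweak _ this _)
  filter_upwards [hN₁, Metric.tendsto_nhds.1 hsum (ε / 4) (by positivity)] with n hn hn'
  have h1 := abs_rsSum_sub_rsIntegral_le hT hc hV ht (hΨ n) hη.le (N := N)
    fun r hr s hs h => hn r hr s hs (h.trans (hmesh (le_max_left _ _)))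
  have h2 := abs_rsSum_sub_rsIntegral_le hT hc hV ht hΨ₀ hη.le (N := N)
    fun r hr s hs h => hN₂ r hr s hs (h.trans (hmesh (le_max_right _ _)))
  rw [Real.dist_eq] at hn' ⊢
  rw [abs_le] at h1 h2
  rw [abs_lt] at hn' ⊢
  constructor <;> linarith

/-! ### Regularised increments along a continuous path -/

theorem norm_taylor_remainder_le {f : E → ℝ} {f' : E → E →L[ℝ] ℝ} {f'' : E → E →L[ℝ] E →L[ℝ] ℝ}
    (hf : ∀ x, HasFDerivAt f (f' x) x) (hf' : ∀ x, HasFDerivAt f' (f'' x) x) {x h : E} {η : ℝ}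
    (hη : ∀ θ ∈ Icc (0:ℝ) 1, ‖f'' (x + θ • h) - f'' x‖ ≤ η) :
    |f (x + h) - f x - f' x h - (1 / 2) * f'' x h h| ≤ η * ‖h‖ ^ 2 := by
  have hη0 : 0 ≤ η := (norm_nonneg (f'' (x + (0:ℝ) • h) - f'' x)).trans (hη 0 (by simp))
  have hline : ∀ θ : ℝ, HasDerivAt (fun θ : ℝ => x + θ • h) h θ := fun θ => by
    simpa using ((hasDerivAt_id θ).smul_const h).const_add x
  have h1 : ∀ θ ∈ Icc (0:ℝ) 1, ‖f' (x + θ • h) - f' x - θ • f'' x h‖ ≤ η * ‖h‖ := by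
    intro θ hθ
    have hd : ∀ θ ∈ Icc (0:ℝ) 1, HasDerivWithinAt (fun θ : ℝ => f' (x + θ • h) - θ • f'' x h)
        (f'' (x + θ • h) h - f'' x h) (Icc 0 1) θ := fun θ _ => by
      have := ((hf' (x + θ • h)).comp_hasDerivAt θ (hline θ)).sub
        ((hasDerivAt_id θ).smul_const (f'' x h))
      exact (this.congr_deriv (by simp)).hasDerivWithinAt
    have hb : ∀ θ ∈ Ico (0:ℝ) 1, ‖f'' (x + θ • h) h - f'' x h‖ ≤ η * ‖h‖ := fun θ hθ => by
      exact ContinuousLinearMap.le_of_opNorm_le (f'' (x + θ • h) - f'' x)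
        (hη θ (Ico_subset_Icc_self hθ)) h
    have := norm_image_sub_le_of_norm_deriv_le_segment' hd hb θ hθ
    simp only [zero_smul, add_zero, sub_zero] at this
    rw [sub_right_comm]
    exact this.trans (mul_le_of_le_one_right (by positivity) hθ.2)
  have hd : ∀ θ ∈ Icc (0:ℝ) 1, HasDerivWithinAt
      (fun θ : ℝ => f (x + θ • h) - θ * f' x h - θ ^ 2 * ((1 / 2) * f'' x h h))
      ((f' (x + θ • h) - f' x - θ • f'' x h) h) (Icc 0 1) θ := fun θ _ => by
    have := (((hf (x + θ • h)).comp_hasDerivAt θ (hline θ)).sub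
      ((hasDerivAt_id θ).mul_const (f' x h))).sub
      ((hasDerivAt_pow 2 θ).mul_const ((1 / 2) * f'' x h h))
    refine (this.congr_deriv ?_).hasDerivWithinAt
    simp
    ring
  have := norm_image_sub_le_of_norm_deriv_le_segment_01' (C := η * ‖h‖ ^ 2) hd fun θ hθ => by
    refine (ContinuousLinearMap.le_of_opNorm_le _ (h1 θ (Ico_subset_Icc_self hθ)) h).trans_eq ?_
    ring
  rw [Real.norm_eq_abs] at this
  convert this using 2
  simp
  ring

theorem tendsto_regularised_increment {f : ℝ → ℝ} (hf : Continuous f) (t : ℝ) {e : ℕ → ℝ}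
    (he : Tendsto e atTop (𝓝[>] 0)) :
    Tendsto (fun n => (e n)⁻¹ * ∫ r in (0:ℝ)..t, (f (r + e n) - f r)) atTop
      (𝓝 (f t - f 0)) := by
  have hd : ∀ b, HasDerivAt (fun u => ∫ r in (0:ℝ)..u, f r) (f b) b := fun b =>
    (hf.integral_hasStrictDerivAt 0 b).hasDerivAt
  refine (((hd t).tendsto_slope_zero_right.comp he).sub
    ((hd 0).tendsto_slope_zero_right.comp he)).congr fun n => ?_
  have hi : ∀ a b, IntervalIntegrable f volume a b := fun a b => hf.intervalIntegrable a b
  rw [intervalIntegral.integral_sub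
    (Continuous.intervalIntegrable (u := fun r => f (r + e n)) (by fun_prop) _ _) (hi _ _), intervalIntegral.integral_comp_add_right f (e n)]
  simp only [Function.comp_apply, smul_eq_mul, intervalIntegral.integral_same, zero_add, sub_zero]
  rw [← mul_sub, ← intervalIntegral.integral_interval_sub_left (hi 0 (t + e n)) (hi 0 (e n))]
  ring

theorem tendsto_regularised_time_increment {T : ℝ} {F Dt : ℝ → E → ℝ} {y : ℝ → E}
    (hF : Continuous fun p : ℝ × E => F p.1 p.2) (hDt : Continuous fun p : ℝ × E => Dt p.1 p.2)
    (hFT : ∀ r ≥ T, ∀ x, F r x = F T x) (hy : Continuous y)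
    (htF : ∀ r ∈ Ioo 0 T, ∀ x, HasDerivAt (fun s => F s x) (Dt r x) r)
    {t : ℝ} (ht : t ∈ Icc 0 T) {e : ℕ → ℝ} (he : Tendsto e atTop (𝓝[>] 0)) :
    Tendsto (fun n => (e n)⁻¹ * ∫ r in (0:ℝ)..t, (F (r + e n) (y (r + e n)) - F r (y (r + e n))))
      atTop (𝓝 (∫ r in (0:ℝ)..t, Dt r (y r))) := by
  have he0 : ∀ᶠ n in atTop, 0 < e n := he.eventually self_mem_nhdsWithin
  have he' : Tendsto e atTop (𝓝 0) := he.mono_right nhdsWithin_le_nhds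
  have he1 : ∀ᶠ n in atTop, e n < 1 := he'.eventually_lt_const one_pos
  have hmvt : ∀ r ∈ Ioc 0 t, r ≠ T → ∀ ε > 0, ∀ x, ∃ c ∈ Ioo r (min (r + ε) T),
      F (r + ε) x - F r x = Dt c x * (min (r + ε) T - r) := by
    intro r hr hrT ε hε x
    have hrT : r < T := lt_of_le_of_ne (hr.2.trans ht.2) hrT
    have hlt : r < min (r + ε) T := lt_min (by linarith) hrT
    obtain ⟨c, hc, h⟩ := exists_hasDerivAt_eq_slope (fun s => F s x) (fun s => Dt s x) hlt
      (hF.comp (continuous_id.prodMk continuous_const)).continuousOn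
      fun s hs => htF s ⟨hr.1.trans hs.1, hs.2.trans_le (min_le_right _ _)⟩ x
    refine ⟨c, hc, ?_⟩
    rw [h, div_mul_cancel₀ _ (sub_pos.2 hlt).ne']
    congr 1
    rcases le_total (r + ε) T with h | h
    · rw [min_eq_left h]
    · rw [min_eq_right h, hFT _ h]
  obtain ⟨K, hK⟩ := ((isCompact_Icc (a := 0) (b := T)).prod
    ((isCompact_Icc (a := 0) (b := T + 1)).image hy)).exists_bound_of_continuousOn hDt.continuousOn
  have hae : ∀ᵐ r : ℝ, r ≠ T := by simp [ae_iff]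
  simp_rw [← intervalIntegral.integral_const_mul]
  refine intervalIntegral.tendsto_integral_filter_of_dominated_convergence (fun _ => K) ?_ ?_
    intervalIntegrable_const ?_
  · refine Eventually.of_forall fun n => Continuous.aestronglyMeasurable ?_
    have h1 : Continuous fun r => y (r + e n) := by fun_prop
    exact continuous_const.mul ((hF.comp ((continuous_add_const (e n)).prodMk h1)).sub
      (hF.comp (continuous_id.prodMk h1)))
  · filter_upwards [he0, he1] with n hn hn1
    filter_upwards [hae] with r hrT hr
    rw [uIoc_of_le ht.1] at hr
    obtain ⟨c, hc, h⟩ := hmvt r hr hrT (e n) hn (y (r + e n))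
    have hlt := hc.1.trans hc.2
    rw [h, norm_mul, norm_mul, Real.norm_of_nonneg (inv_nonneg.2 hn.le),
      Real.norm_of_nonneg (sub_nonneg.2 hlt.le), mul_left_comm]
    have hb : ‖Dt c (y (r + e n))‖ ≤ K := hK (c, y (r + e n))
      ⟨⟨hr.1.le.trans hc.1.le, hc.2.le.trans (min_le_right _ _)⟩,
        mem_image_of_mem _ ⟨by linarith [hr.1], by linarith [hr.2, ht.2]⟩⟩
    have hq : (e n)⁻¹ * (min (r + e n) T - r) ≤ 1 := by
      rw [inv_mul_le_one₀ hn]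
      linarith [min_le_left (r + e n) T]
    exact (mul_le_of_le_one_right (norm_nonneg _) hq).trans hb
  · filter_upwards [hae] with r hrT hr
    rw [uIoc_of_le ht.1] at hr
    have hrT' : r < T := lt_of_le_of_ne (hr.2.trans ht.2) hrT
    have hre : Tendsto (fun n => r + e n) atTop (𝓝 r) := by simpa using he'.const_add r
    have hyr : Tendsto (fun n => y (r + e n)) atTop (𝓝 (y r)) := (hy.tendsto r).comp hre
    have : ∀ n, ∃ c, 0 < e n → (c ∈ Ioo r (min (r + e n) T) ∧
        F (r + e n) (y (r + e n)) - F r (y (r + e n)) =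
          Dt c (y (r + e n)) * (min (r + e n) T - r)) := fun n => by
      by_cases h : 0 < e n
      · obtain ⟨c, hc⟩ := hmvt r hr hrT (e n) h (y (r + e n))
        exact ⟨c, fun _ => hc⟩
      · exact ⟨0, fun h' => absurd h' h⟩
    choose c hc using this
    have hcr : Tendsto c atTop (𝓝 r) :=
      tendsto_of_tendsto_of_tendsto_of_le_of_le' tendsto_const_nhds hre
        (he0.mono fun n hn => (hc n hn).1.1.le)
        (he0.mono fun n hn => (hc n hn).1.2.le.trans (min_le_left _ _))
    refine ((hDt.tendsto (r, y r)).comp (hcr.prodMk_nhds hyr)).congr' ?_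
    filter_upwards [he0, hre.eventually_lt_const hrT'] with n hn hnT
    rw [(hc n hn).2, min_eq_left hnT.le, add_sub_cancel_left]
    field_simp
    rfl

theorem tendsto_regularised_quadratic {T : ℝ} (hT : 0 ≤ T) {y : ℝ → E} (hy : Continuous y)
    {Ψ : ℝ → E →L[ℝ] E →L[ℝ] ℝ} (hΨ : Continuous Ψ)
    {q : ℝ → (E →L[ℝ] E →L[ℝ] ℝ) →L[ℝ] ℝ} {V : ℝ → ℝ} (hV : MonotoneOn V (Icc 0 T))
    (hq : ∀ s ∈ Icc 0 T, ∀ t ∈ Icc 0 T, s ≤ t → ∀ ψ, |q t ψ - q s ψ| ≤ (V t - V s) * ‖ψ‖)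
    {e : ℕ → ℝ} (he : ∀ᶠ n in atTop, 0 < e n) {M : ℝ} (hM : 0 ≤ M)
    {t : ℝ} (ht : t ∈ Icc 0 T)
    (h1 : ∀ᶠ n in atTop, (e n)⁻¹ * ∫ r in (0:ℝ)..t, ‖y (r + e n) - y r‖ ^ 2 ≤ M)
    (h2 : ∀ s ∈ Icc 0 T, ∀ t ∈ Icc 0 T, Tendsto (fun n => (e n)⁻¹ *
      ∫ r in (0:ℝ)..t, Ψ s (y (r + e n) - y r) (y (r + e n) - y r)) atTop (𝓝 (q t (Ψ s)))) :
    Tendsto (fun n => (e n)⁻¹ * ∫ r in (0:ℝ)..t, Ψ r (y (r + e n) - y r) (y (r + e n) - y r))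
      atTop (𝓝 (rsIntegral T (fun s => q s) Ψ t)) := by
  have hV0 : 0 ≤ V T - V 0 := sub_nonneg.2 (hV ⟨le_rfl, hT⟩ ⟨hT, le_rfl⟩ hT)
  refine Metric.tendsto_nhds.2 fun ε hε => ?_
  set η := ε / 4 / (M + (V T - V 0) + 1) with hη_def
  have hη : 0 < η := by positivity
  have hηb : ∀ a, 0 ≤ a → a ≤ M + (V T - V 0) → η * a ≤ ε / 4 := fun a ha hab => by
    rw [hη_def, div_mul_eq_mul_div, div_le_iff₀ (by positivity)]
    exact mul_le_mul_of_nonneg_left (by linarith) (by positivity)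
  obtain ⟨N, hN⟩ := exists_mesh_modulus (T := T) (E := E →L[ℝ] E →L[ℝ] ℝ) hΨ.continuousOn hη
  let b : ℕ → ℝ := fun k => min t (T * (k : ℝ) / 2 ^ N)
  have hb0 : b 0 = 0 := by simp [b, ht.1]
  have hbN : b (2 ^ N) = t := by simp [b, ht.2]
  have hbmono : ∀ k, b k ≤ b (k + 1) := fun k => min_le_min_left _ (by gcongr; simp)
  have hbmem : ∀ k ≤ 2 ^ N, b k ∈ Icc 0 T := fun k hk =>
    ⟨le_min ht.1 (dyadic_mem_Icc hT hk).1, (min_le_left _ _).trans ht.2⟩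
  have hquad : ∀ (Φ : ℝ → E →L[ℝ] E →L[ℝ] ℝ) (_ : Continuous Φ) n,
      Continuous fun r => Φ r (y (r + e n) - y r) (y (r + e n) - y r) := fun Φ hΦ n => by
    have : Continuous fun r => y (r + e n) - y r := by fun_prop
    exact (hΦ.clm_apply this).clm_apply this
  have hsum : Tendsto (fun n => ∑ k ∈ Finset.range (2 ^ N), (e n)⁻¹ *
      ∫ r in b k..b (k + 1), Ψ (T * (k : ℝ) / 2 ^ N) (y (r + e n) - y r) (y (r + e n) - y r))
      atTop (𝓝 (rsSum T (fun s => q s) Ψ N t)) := by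
    refine tendsto_finsetSum _ fun k hk => ?_
    have hk := Finset.mem_range.1 hk
    have hs := dyadic_mem_Icc hT hk.le
    have hlim := (h2 _ hs _ (hbmem _ (Nat.succ_le_iff.2 hk))).sub (h2 _ hs _ (hbmem _ hk.le))
    simp only [b, Nat.cast_add, Nat.cast_one, Nat.succ_eq_add_one] at hlim ⊢
    refine hlim.congr fun n => ?_
    rw [← mul_sub, intervalIntegral.integral_interval_sub_left] <;>
      exact (hquad _ continuous_const n).intervalIntegrable _ _
  have hRS := abs_rsSum_sub_rsIntegral_le hT hq hV ht hΨ.continuousOn hη.le hN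
  filter_upwards [he, h1, Metric.tendsto_nhds.1 hsum (ε / 4) (by positivity)] with n hn hn1 hn2
  have hdiff : |(e n)⁻¹ * (∫ r in (0:ℝ)..t, Ψ r (y (r + e n) - y r) (y (r + e n) - y r)) -
      ∑ k ∈ Finset.range (2 ^ N), (e n)⁻¹ * ∫ r in b k..b (k + 1),
        Ψ (T * (k : ℝ) / 2 ^ N) (y (r + e n) - y r) (y (r + e n) - y r)| ≤ η * M := by
    rw [← hb0, ← hbN, ← intervalIntegral.sum_integral_adjacent_intervals (a := b)
      fun k _ => (hquad Ψ hΨ n).intervalIntegrable (μ := volume) _ _, Finset.mul_sum, ← Finset.sum_sub_distrib]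
    have hsq : ∀ a b, IntervalIntegrable (fun r => η * ‖y (r + e n) - y r‖ ^ 2) volume a b :=
      fun a b => Continuous.intervalIntegrable (by fun_prop) a b
    calc _ ≤ ∑ k ∈ Finset.range (2 ^ N),
          (e n)⁻¹ * ∫ r in b k..b (k + 1), η * ‖y (r + e n) - y r‖ ^ 2 := by
          refine (Finset.abs_sum_le_sum_abs _ _).trans (Finset.sum_le_sum fun k hk => ?_)
          have hk := Finset.mem_range.1 hk
          rw [← mul_sub, ← intervalIntegral.integral_sub ((hquad Ψ hΨ n).intervalIntegrable _ _)
            ((hquad _ continuous_const n).intervalIntegrable _ _), abs_mul,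
            abs_of_pos (inv_pos.2 hn)]
          refine mul_le_mul_of_nonneg_left ?_ (inv_pos.2 hn).le
          rw [← Real.norm_eq_abs]
          refine intervalIntegral.norm_integral_le_of_norm_le (hbmono k)
            (Eventually.of_forall fun r hr => ?_) (hsq _ _)
          have hr1 : T * (k : ℝ) / 2 ^ N < r := by
            rcases min_lt_iff.1 hr.1 with h | h
            · exact absurd (hr.2.trans (min_le_left _ _)) h.not_ge
            · exact h
          have hr2 : r ≤ T * ((k + 1 : ℕ) : ℝ) / 2 ^ N := hr.2.trans (min_le_right _ _)
          have hs := dyadic_mem_Icc hT hk.le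
          have hmod := hN r ⟨hs.1.trans hr1.le, (hr.2.trans (min_le_left _ _)).trans ht.2⟩ _ hs (by
            rw [abs_of_pos (sub_pos.2 hr1), sub_le_iff_le_add]
            refine hr2.trans_eq ?_
            push_cast
            ring)
          rw [pow_two, ← mul_assoc]
          exact ContinuousLinearMap.le_of_opNorm₂_le_of_le (Ψ r - Ψ (T * (k : ℝ) / 2 ^ N)) hmod
            le_rfl le_rfl
      _ = η * ((e n)⁻¹ * ∫ r in b 0..b (2 ^ N), ‖y (r + e n) - y r‖ ^ 2) := by
          rw [← Finset.mul_sum, intervalIntegral.sum_integral_adjacent_intervals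
            fun k _ => hsq _ _, intervalIntegral.integral_const_mul]
          ring
      _ ≤ η * M := by
          rw [hb0, hbN]
          exact mul_le_mul_of_nonneg_left hn1 hη.le
  have hM' := hηb M hM (by linarith)
  have hV' := hηb _ hV0 (by linarith)
  rw [Real.dist_eq] at hn2 ⊢
  rw [abs_le] at hdiff hRS
  rw [abs_lt] at hn2 ⊢
  constructor <;> linarith

theorem exists_uniform_modulus_near_path {G : Type*} [NormedAddCommGroup G] {y : ℝ → E}
    (hy : Continuous y) {f : ℝ → E → G} (hf : Continuous fun p : ℝ × E => f p.1 p.2) (t : ℝ)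
    {η : ℝ} (hη : 0 < η) :
    ∃ δ > 0, ∀ ε, 0 < ε → ε < δ → ∀ r ∈ Icc 0 t, ∀ θ ∈ Icc (0:ℝ) 1,
      ‖f r (y r + θ • (y (r + ε) - y r)) - f r (y r)‖ ≤ η := by
  have hK : IsCompact ((fun r => (r, y r)) '' Icc 0 t) :=
    isCompact_Icc.image (continuous_id.prodMk hy)
  have hU := hK.uniformContinuousAt_of_continuousAt (fun p : ℝ × E => f p.1 p.2)
    (fun a _ => hf.continuousAt) (Metric.dist_mem_uniformity hη)
  obtain ⟨δ₁, hδ₁, h₁⟩ := Metric.mem_uniformity_dist.1 hU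
  obtain ⟨δ₂, hδ₂, h₂⟩ := Metric.uniformContinuousOn_iff.1
    ((isCompact_Icc (a := 0) (b := t + 1)).uniformContinuousOn_of_continuous hy.continuousOn)
    δ₁ hδ₁
  refine ⟨min δ₂ 1, by positivity, fun ε hε hεδ r hr θ hθ => ?_⟩
  have hyr : dist (y (r + ε)) (y r) < δ₁ := by
    refine h₂ _ ⟨by linarith [hr.1], by linarith [hr.2, hεδ.trans_le (min_le_right _ _)]⟩ _
      ⟨hr.1, by linarith [hr.2]⟩ ?_
    rw [Real.dist_eq, add_sub_cancel_left, abs_of_pos hε]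
    exact hεδ.trans_le (min_le_left _ _)
  have hd : dist (r, y r) (r, y r + θ • (y (r + ε) - y r)) < δ₁ := by
    rw [Prod.dist_eq, dist_self, dist_self_add_right, norm_smul, Real.norm_of_nonneg hθ.1]
    refine max_lt hδ₁ (lt_of_le_of_lt (mul_le_of_le_one_left (norm_nonneg _) hθ.2) ?_)
    rwa [← dist_eq_norm]
  have := h₁ hd (mem_image_of_mem _ hr)
  rw [← dist_eq_norm, dist_comm]
  exact le_of_lt this

theorem integral_sub_sub_sub_mul {a b c d : ℝ → ℝ} (ha : Continuous a) (hb : Continuous b)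
    (hc : Continuous c) (hd : Continuous d) {k s t : ℝ} :
    ∫ r in s..t, (a r - b r - c r - k * d r) = (∫ r in s..t, a r) - (∫ r in s..t, b r) -
      (∫ r in s..t, c r) - k * ∫ r in s..t, d r := by
  rw [intervalIntegral.integral_sub (Continuous.intervalIntegrable (by fun_prop) _ _)
      (Continuous.intervalIntegrable (by fun_prop) _ _),
    intervalIntegral.integral_sub (Continuous.intervalIntegrable (by fun_prop) _ _)
      (Continuous.intervalIntegrable (by fun_prop) _ _),
    intervalIntegral.integral_sub (Continuous.intervalIntegrable (by fun_prop) _ _)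
      (Continuous.intervalIntegrable (by fun_prop) _ _), intervalIntegral.integral_const_mul]

/-- Deterministic Itô formula: along a path with a quadratic variation, the regularised integrals
of the derivative converge to the remaining terms of the formula. -/
theorem tendsto_regularised_derivative {T : ℝ} (hT : 0 ≤ T) {F Dt : ℝ → E → ℝ}
    {D1 : ℝ → E → E →L[ℝ] ℝ} {D2 : ℝ → E → E →L[ℝ] E →L[ℝ] ℝ}
    (hF : Continuous fun p : ℝ × E => F p.1 p.2) (hDt : Continuous fun p : ℝ × E => Dt p.1 p.2)
    (hD1 : Continuous fun p : ℝ × E => D1 p.1 p.2) (hD2 : Continuous fun p : ℝ × E => D2 p.1 p.2)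
    (hFT : ∀ r ≥ T, ∀ x, F r x = F T x)
    (htF : ∀ r ∈ Ioo 0 T, ∀ x, HasDerivAt (fun s => F s x) (Dt r x) r)
    (hxF : ∀ r x, HasFDerivAt (F r) (D1 r x) x) (hxxF : ∀ r x, HasFDerivAt (D1 r) (D2 r x) x)
    {y : ℝ → E} (hy : Continuous y)
    {q : ℝ → (E →L[ℝ] E →L[ℝ] ℝ) →L[ℝ] ℝ} {V : ℝ → ℝ} (hV : MonotoneOn V (Icc 0 T))
    (hq : ∀ s ∈ Icc 0 T, ∀ t ∈ Icc 0 T, s ≤ t → ∀ ψ, |q t ψ - q s ψ| ≤ (V t - V s) * ‖ψ‖)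
    {e : ℕ → ℝ} (he : Tendsto e atTop (𝓝[>] 0)) {M : ℝ} (hM : 0 ≤ M)
    {t : ℝ} (ht : t ∈ Icc 0 T)
    (h1 : ∀ᶠ n in atTop, (e n)⁻¹ * ∫ r in (0:ℝ)..t, ‖y (r + e n) - y r‖ ^ 2 ≤ M)
    (h2 : ∀ s ∈ Icc 0 T, ∀ t ∈ Icc 0 T, Tendsto (fun n => (e n)⁻¹ *
      ∫ r in (0:ℝ)..t, D2 s (y s) (y (r + e n) - y r) (y (r + e n) - y r)) atTop
        (𝓝 (q t (D2 s (y s))))) :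
    Tendsto (fun n => (e n)⁻¹ * ∫ r in (0:ℝ)..t, D1 r (y r) (y (r + e n) - y r)) atTop
      (𝓝 (F t (y t) - F 0 (y 0) - (1 / 2) * rsIntegral T (fun s => q s) (fun r => D2 r (y r)) t -
        ∫ r in (0:ℝ)..t, Dt r (y r))) := by
  have he0 : ∀ᶠ n in atTop, 0 < e n := he.eventually self_mem_nhdsWithin
  have he' : Tendsto e atTop (𝓝 0) := he.mono_right nhdsWithin_le_nhds
  have hΨ : Continuous fun r => D2 r (y r) := hD2.comp (continuous_id.prodMk hy)
  have hf : Continuous fun r => F r (y r) := hF.comp (continuous_id.prodMk hy)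
  have hΔ : ∀ n, Continuous fun r => y (r + e n) - y r := fun n => by fun_prop
  have hshift : ∀ n, Continuous fun r => y (r + e n) := fun n => by fun_prop
  have hc1 : ∀ n, Continuous fun r => D1 r (y r) (y (r + e n) - y r) := fun n =>
    (hD1.comp (continuous_id.prodMk hy)).clm_apply (hΔ n)
  have hc2 : ∀ n, Continuous fun r => D2 r (y r) (y (r + e n) - y r) (y (r + e n) - y r) :=
    fun n => (hΨ.clm_apply (hΔ n)).clm_apply (hΔ n)
  have hc3 : ∀ n, Continuous fun r => F (r + e n) (y (r + e n)) - F r (y (r + e n)) := fun n =>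
    (hF.comp ((continuous_add_const (e n)).prodMk (hshift n))).sub
      (hF.comp (continuous_id.prodMk (hshift n)))
  have hc4 : ∀ n, Continuous fun r => F (r + e n) (y (r + e n)) - F r (y r) := fun n =>
    (hF.comp ((continuous_add_const (e n)).prodMk (hshift n))).sub hf
  let R : ℕ → ℝ → ℝ := fun n r => F r (y (r + e n)) - F r (y r) - D1 r (y r) (y (r + e n) - y r) -
    (1 / 2) * D2 r (y r) (y (r + e n) - y r) (y (r + e n) - y r)
  have hR : Tendsto (fun n => (e n)⁻¹ * ∫ r in (0:ℝ)..t, R n r) atTop (𝓝 0) := by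
    refine Metric.tendsto_nhds.2 fun ε hε => ?_
    obtain ⟨δ, hδ, hmod⟩ := exists_uniform_modulus_near_path (G := E →L[ℝ] E →L[ℝ] ℝ) hy hD2 t
      (η := ε / (M + 1)) (by positivity)
    filter_upwards [he0, h1, he'.eventually_lt_const hδ] with n hn hn1 hnδ
    rw [Real.dist_eq, sub_zero, abs_mul, abs_of_pos (inv_pos.2 hn)]
    have hle : |∫ r in (0:ℝ)..t, R n r| ≤
        ∫ r in (0:ℝ)..t, ε / (M + 1) * ‖y (r + e n) - y r‖ ^ 2 := by
      rw [← Real.norm_eq_abs]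
      refine intervalIntegral.norm_integral_le_of_norm_le ht.1
        (Eventually.of_forall fun r hr => ?_)
        (Continuous.intervalIntegrable (continuous_const.mul ((hΔ n).norm.pow 2)) _ _)
      have := norm_taylor_remainder_le (hxF r) (hxxF r) (x := y r) (h := y (r + e n) - y r)
        fun θ hθ => hmod (e n) hn hnδ r (Ioc_subset_Icc_self hr) θ hθ
      rwa [add_sub_cancel] at this
    calc _ ≤ (e n)⁻¹ * ∫ r in (0:ℝ)..t, ε / (M + 1) * ‖y (r + e n) - y r‖ ^ 2 :=
          mul_le_mul_of_nonneg_left hle (inv_pos.2 hn).le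
      _ = ε / (M + 1) * ((e n)⁻¹ * ∫ r in (0:ℝ)..t, ‖y (r + e n) - y r‖ ^ 2) := by
          rw [intervalIntegral.integral_const_mul]
          ring
      _ ≤ ε / (M + 1) * M := mul_le_mul_of_nonneg_left hn1 (by positivity)
      _ < ε := by
          rw [div_mul_eq_mul_div, div_lt_iff₀ (by positivity)]
          exact mul_lt_mul_of_pos_left (by linarith) hε
  have hA1 := tendsto_regularised_increment hf t he
  have hA2 := tendsto_regularised_time_increment hF hDt hFT hy htF ht he
  have hA3 := tendsto_regularised_quadratic hT hy hΨ hV hq he0 hM ht h1 h2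
  have hlim := ((hA1.sub (hA3.const_mul (1 / 2))).sub hA2).sub hR
  rw [sub_zero] at hlim
  refine hlim.congr fun n => ?_
  have hsplit : (∫ r in (0:ℝ)..t, R n r) = ((∫ r in (0:ℝ)..t, (F (r + e n) (y (r + e n)) -
      F r (y r))) - (∫ r in (0:ℝ)..t, (F (r + e n) (y (r + e n)) - F r (y (r + e n)))) -
      ∫ r in (0:ℝ)..t, D1 r (y r) (y (r + e n) - y r)) -
      (1 / 2) * ∫ r in (0:ℝ)..t, D2 r (y r) (y (r + e n) - y r) (y (r + e n) - y r) := by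
    rw [← integral_sub_sub_sub_mul (hc4 n) (hc3 n) (hc1 n) (hc2 n)]
    exact intervalIntegral.integral_congr fun r _ => by simp only [R]; ring
  rw [hsplit]
  ring

/-! ### Strong approximation of the state variable -/

theorem tendsto_clm_apply_of_strong {ι α G : Type*} [NormedAddCommGroup G] [NormedSpace ℝ G]
    {l : Filter ι} {L : ι → E →L[ℝ] G} {L₀ : E →L[ℝ] G} {K : ℝ} (hK : ∀ i, ‖L i‖ ≤ K)
    (h : ∀ v, Tendsto (fun i => L i v) l (𝓝 (L₀ v))) {a : Filter α} {φ : α → ι}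
    (hφ : Tendsto φ a l) {v : α → E} {v₀ : E} (hv : Tendsto v a (𝓝 v₀)) :
    Tendsto (fun x => L (φ x) (v x)) a (𝓝 (L₀ v₀)) := by
  have h1 : Tendsto (fun x => L (φ x) (v x - v₀)) a (𝓝 0) := by
    have h0 : Tendsto (fun x => K * ‖v x - v₀‖) a (𝓝 0) := by
      simpa using ((hv.sub_const v₀).norm).const_mul K
    exact squeeze_zero_norm (fun x => ContinuousLinearMap.le_of_opNorm_le _ (hK _) _) h0
  simpa using h1.add ((h v₀).comp hφ)

theorem tendstoUniformlyOn_of_forall_tendsto {G : Type*} [NormedAddCommGroup G]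
    {f : ℕ → ℝ → G} {f₀ : ℝ → G} (hf₀ : Continuous f₀) {s : Set ℝ} (hs : IsCompact s)
    (h : ∀ r, Tendsto (fun p : ℕ × ℝ => f p.1 p.2) (atTop ×ˢ 𝓝 r) (𝓝 (f₀ r))) :
    TendstoUniformlyOn f f₀ atTop s := by
  refine (tendstoLocallyUniformlyOn_iff_tendstoUniformlyOn_of_compact hs).1
    (tendstoLocallyUniformlyOn_iff_forall_tendsto.2 fun r _ => ?_)
  have h1 : Tendsto (fun p : ℕ × ℝ => (f₀ p.2, f p.1 p.2)) (atTop ×ˢ 𝓝 r)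
      (𝓝 (f₀ r) ×ˢ 𝓝 (f₀ r)) := ((hf₀.tendsto r).comp tendsto_snd).prodMk (h r)
  exact (h1.mono_left (prod_mono le_rfl nhdsWithin_le_nhds)).mono_right (by
    rw [← nhds_prod_eq]
    exact nhds_le_uniformity _)

theorem tendsto_path_of_strong {B : ℕ → E →L[ℝ] E} {B₀ : E →L[ℝ] E} {K : ℝ}
    (hK : ∀ n, ‖B n‖ ≤ K) (hB : ∀ v, Tendsto (fun n => B n v) atTop (𝓝 (B₀ v)))
    {x : ℝ → E} (hx : Continuous x) (r : ℝ) :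
    Tendsto (fun p : ℕ × ℝ => (p.2, B p.1 (x p.2))) (atTop ×ˢ 𝓝 r) (𝓝 (r, B₀ (x r))) :=
  tendsto_snd.prodMk_nhds
    (tendsto_clm_apply_of_strong hK hB tendsto_fst ((hx.tendsto r).comp tendsto_snd))

theorem tendstoUniformlyOn_comp_strong {G : Type*} [NormedAddCommGroup G]
    {f : ℝ → E → G} (hf : Continuous fun p : ℝ × E => f p.1 p.2) {B : ℕ → E →L[ℝ] E}
    {B₀ : E →L[ℝ] E} {K : ℝ} (hK : ∀ n, ‖B n‖ ≤ K)
    (hB : ∀ v, Tendsto (fun n => B n v) atTop (𝓝 (B₀ v))) {x : ℝ → E} (hx : Continuous x)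
    {s : Set ℝ} (hs : IsCompact s) :
    TendstoUniformlyOn (fun n r => f r (B n (x r))) (fun r => f r (B₀ (x r))) atTop s :=
  tendstoUniformlyOn_of_forall_tendsto (hf.comp (continuous_id.prodMk (B₀.continuous.comp hx))) hs
    fun r => (hf.tendsto (r, B₀ (x r))).comp (tendsto_path_of_strong hK hB hx r)

theorem norm_bilinearComp_le (ψ : E →L[ℝ] E →L[ℝ] ℝ) (B : E →L[ℝ] E) :
    ‖ψ.bilinearComp B B‖ ≤ ‖B‖ * ‖B‖ * ‖ψ‖ := by
  refine ContinuousLinearMap.opNorm_le_bound₂ _ (by positivity) fun x y => ?_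
  calc ‖ψ (B x) (B y)‖ ≤ ‖ψ‖ * (‖B‖ * ‖x‖) * (‖B‖ * ‖y‖) :=
        ContinuousLinearMap.le_of_opNorm₂_le_of_le ψ le_rfl (B.le_opNorm x) (B.le_opNorm y)
    _ = ‖B‖ * ‖B‖ * ‖ψ‖ * ‖x‖ * ‖y‖ := by ring

/-- Precomposition of a bilinear form with an operator. -/
def pullback (B : E →L[ℝ] E) : (E →L[ℝ] E →L[ℝ] ℝ) →L[ℝ] (E →L[ℝ] E →L[ℝ] ℝ) :=
  LinearMap.mkContinuous (E := E →L[ℝ] E →L[ℝ] ℝ) (F := E →L[ℝ] E →L[ℝ] ℝ)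
    { toFun := fun ψ => ψ.bilinearComp B B
      map_add' := fun ψ φ => by ext; rfl
      map_smul' := fun a ψ => by ext; rfl } (‖B‖ * ‖B‖) fun ψ => norm_bilinearComp_le ψ B

@[simp]
theorem pullback_apply (B : E →L[ℝ] E) (ψ : E →L[ℝ] E →L[ℝ] ℝ) (x y : E) :
    pullback B ψ x y = ψ (B x) (B y) := rfl

theorem norm_pullback_apply_le (B : E →L[ℝ] E) (ψ : E →L[ℝ] E →L[ℝ] ℝ) :
    ‖pullback B ψ‖ ≤ ‖B‖ * ‖B‖ * ‖ψ‖ :=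
  norm_bilinearComp_le ψ B

theorem tendsto_bilin_apply {ι : Type*} {l : Filter ι} {ψ : ι → E →L[ℝ] E →L[ℝ] ℝ}
    {ψ₀ : E →L[ℝ] E →L[ℝ] ℝ} (hψ : Tendsto ψ l (𝓝 ψ₀)) {u v : ι → E} {u₀ v₀ : E}
    (hu : Tendsto u l (𝓝 u₀)) (hv : Tendsto v l (𝓝 v₀)) :
    Tendsto (fun i => ψ i (u i) (v i)) l (𝓝 (ψ₀ u₀ v₀)) := by
  have hc : Continuous fun p : (E →L[ℝ] E →L[ℝ] ℝ) × E × E => p.1 p.2.1 p.2.2 := by fun_prop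
  exact (hc.tendsto (ψ₀, u₀, v₀)).comp (hψ.prodMk_nhds (hu.prodMk_nhds hv))

/-- The terms of the Itô formula for `F(t, Bx(t))` other than the forward integral. -/
def itoRemainder (T : ℝ) (F Dt : ℝ → E → ℝ) (D2 : ℝ → E → E →L[ℝ] E →L[ℝ] ℝ)
    (q : ℝ → (E →L[ℝ] E →L[ℝ] ℝ) →L[ℝ] ℝ) (x : ℝ → E) (B : E →L[ℝ] E) (t : ℝ) : ℝ :=
  F t (B (x t)) - F 0 (B (x 0)) -
    (1 / 2) * rsIntegral T (fun s => q s) (fun r => pullback B (D2 r (B (x r)))) t -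
    ∫ r in (0:ℝ)..t, Dt r (B (x r))

theorem tendsto_itoRemainder {T : ℝ} (hT : 0 ≤ T) {F Dt : ℝ → H → ℝ}
    {D2 : ℝ → H → H →L[ℝ] H →L[ℝ] ℝ}
    (hF : Continuous fun p : ℝ × H => F p.1 p.2) (hDt : Continuous fun p : ℝ × H => Dt p.1 p.2)
    (hD2 : Continuous fun p : ℝ × H => D2 p.1 p.2)
    {q : ℝ → (H →L[ℝ] H →L[ℝ] ℝ) →L[ℝ] ℝ} {V : ℝ → ℝ} (hV : MonotoneOn V (Icc 0 T))
    (hq : ∀ s ∈ Icc 0 T, ∀ t ∈ Icc 0 T, s ≤ t → ∀ ψ, |q t ψ - q s ψ| ≤ (V t - V s) * ‖ψ‖)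
    (hqim : ∀ s, InProjTensorImage (q s)) {x : ℝ → H} (hx : Continuous x)
    {B : ℕ → H →L[ℝ] H} {B₀ : H →L[ℝ] H} {K : ℝ} (hK : ∀ n, ‖B n‖ ≤ K)
    (hB : ∀ v, Tendsto (fun n => B n v) atTop (𝓝 (B₀ v))) {t : ℝ} (ht : t ∈ Icc 0 T) :
    Tendsto (fun n => itoRemainder T F Dt D2 q x (B n) t) atTop
      (𝓝 (itoRemainder T F Dt D2 q x B₀ t)) := by
  have hK0 : 0 ≤ K := (norm_nonneg _).trans (hK 0)
  have hpt : ∀ s, Tendsto (fun n => F s (B n (x s))) atTop (𝓝 (F s (B₀ (x s)))) := fun s =>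
    (hF.tendsto (s, B₀ (x s))).comp (tendsto_const_nhds.prodMk_nhds (hB _))
  have hpath : ∀ B : H →L[ℝ] H, Continuous fun r => (r, B (x r)) := fun B =>
    continuous_id.prodMk (B.continuous.comp hx)
  have hint : Tendsto (fun n => ∫ r in (0:ℝ)..t, Dt r (B n (x r))) atTop
      (𝓝 (∫ r in (0:ℝ)..t, Dt r (B₀ (x r)))) := by
    have hu := tendstoUniformlyOn_comp_strong hDt hK hB hx (isCompact_Icc (a := 0) (b := t))
    refine intervalIntegral.tendsto_integral_filter_of_dominated_convergence
      (fun r => ‖Dt r (B₀ (x r))‖ + 1)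
      (Eventually.of_forall fun n => (hDt.comp (hpath (B n))).aestronglyMeasurable) ?_
      (Continuous.intervalIntegrable ((hDt.comp (hpath B₀)).norm.add continuous_const) _ _)
      (Eventually.of_forall fun r _ =>
        (hDt.tendsto (r, B₀ (x r))).comp (tendsto_const_nhds.prodMk_nhds (hB _)))
    filter_upwards [Metric.tendstoUniformlyOn_iff.1 hu 1 one_pos] with n hn
    refine Eventually.of_forall fun r hr => ?_
    rw [uIoc_of_le ht.1] at hr
    have := hn r (Ioc_subset_Icc_self hr)
    rw [dist_comm, dist_eq_norm] at this
    have := norm_sub_norm_le (Dt r (B n (x r))) (Dt r (B₀ (x r)))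
    linarith
  have hD2r : ∀ r, Tendsto (fun n => D2 r (B n (x r))) atTop (𝓝 (D2 r (B₀ (x r)))) := fun r =>
    (hD2.tendsto (r, B₀ (x r))).comp (tendsto_const_nhds.prodMk_nhds (hB _))
  have hnorm : ∀ n ψ, ‖pullback (B n) ψ‖ ≤ K * K * ‖ψ‖ := fun n ψ =>
    (norm_pullback_apply_le _ _).trans (by gcongr <;> exact hK n)
  have hrs : Tendsto (fun n => rsIntegral T (fun s => q s)
      (fun r => pullback (B n) (D2 r (B n (x r)))) t) atTop
      (𝓝 (rsIntegral T (fun s => q s) (fun r => pullback B₀ (D2 r (B₀ (x r)))) t)) := by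
    have hΨc : ∀ B : H →L[ℝ] H, Continuous fun r => pullback B (D2 r (B (x r))) := fun B =>
      (pullback B).continuous.comp (hD2.comp (hpath B))
    refine tendsto_rsIntegral (E := H →L[ℝ] H →L[ℝ] ℝ) hT hq hV ht
      (fun n => (hΨc (B n)).continuousOn) (hΨc B₀).continuousOn ?_ ?_
    · intro r _ s
      refine (hqim s).tendsto (K := K * K * (‖D2 r (B₀ (x r))‖ + 1)) ?_ fun u v => ?_
      · have hn := Tendsto.norm (E := H →L[ℝ] H →L[ℝ] ℝ) (hD2r r)
        filter_upwards [hn.eventually_le_const (lt_add_one _)] with n hn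
        exact (hnorm n _).trans (mul_le_mul_of_nonneg_left hn (by positivity))
      · exact tendsto_bilin_apply (hD2r r) (hB u) (hB v)
    · intro η hη
      set η' := η / 3 / (K * K + 1)
      have hη' : 0 < η' := by positivity
      obtain ⟨N, hN⟩ := exists_mesh_modulus (T := T) (E := H →L[ℝ] H →L[ℝ] ℝ)
        (hD2.comp (hpath B₀)).continuousOn hη'
      refine ⟨N, ?_⟩
      filter_upwards [Metric.tendstoUniformlyOn_iff.1 (tendstoUniformlyOn_comp_strong
        (G := H →L[ℝ] H →L[ℝ] ℝ) hD2 hK hB hx (isCompact_Icc (a := 0) (b := T))) η' hη']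
        with n hn r hr s hs hrs
      have h1 := hn r hr
      have h2 := hn s hs
      have h3 := hN r hr s hs hrs
      simp only [Function.comp_apply] at h3
      rw [← dist_eq_norm] at h3
      have hsub := (hnorm n (D2 r (B n (x r)) - D2 s (B n (x s)))).trans_eq
        (congrArg _ (dist_eq_norm (D2 r (B n (x r))) (D2 s (B n (x s)))).symm)
      rw [map_sub (pullback (B n)) (D2 r (B n (x r))) (D2 s (B n (x s)))] at hsub
      refine hsub.trans ?_
      have h4 : dist (D2 r (B n (x r))) (D2 s (B n (x s))) ≤ η' + η' + η' := by
        refine (dist_triangle4 _ (D2 r (B₀ (x r))) (D2 s (B₀ (x s))) _).trans ?_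
        rw [dist_comm] at h1
        gcongr
      calc K * K * dist (D2 r (B n (x r))) (D2 s (B n (x s)))
          ≤ (K * K + 1) * (η' + η' + η') := by
            gcongr
            linarith
        _ = η := by
            simp only [η']
            field_simp
            ring
  exact (((hpt t).sub (hpt 0)).sub (hrs.const_mul _)).sub hint

/-! ### The Itô formula for cylindrical transformations of the process -/

/-- The bilinear form `(x, y) ↦ ⟪z, x⟫ ⟪w, y⟫`. -/
def rankOneForm (z w : H) : H →L[ℝ] H →L[ℝ] ℝ := (innerSL ℝ z).smulRight (innerSL ℝ w)

theorem rankOneForm_apply (z w x y : H) : rankOneForm z w x y = ⟪z, x⟫ * ⟪w, y⟫ := by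
  simp [rankOneForm]

theorem apply_cylindrical {m : ℕ} {z b : Fin m → H} {B : H →L[ℝ] H}
    (hB : ∀ x, B x = ∑ i, ⟪z i, x⟫ • b i) (φ : H →L[ℝ] H →L[ℝ] ℝ) (x y : H) :
    φ (B x) (B y) = ∑ i, ∑ j, φ (b i) (b j) * rankOneForm (z i) (z j) x y := by
  simp only [hB, map_sum, map_smul, sum_apply, smul_apply, smul_eq_mul,
    rankOneForm_apply, Finset.mul_sum]
  rw [Finset.sum_comm]
  exact Finset.sum_congr rfl fun i _ => Finset.sum_congr rfl fun j _ => by ring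

theorem pullback_cylindrical {m : ℕ} {z b : Fin m → H} {B : H →L[ℝ] H}
    (hB : ∀ x, B x = ∑ i, ⟪z i, x⟫ • b i) (φ : H →L[ℝ] H →L[ℝ] ℝ) :
    pullback B φ = ∑ i, ∑ j, φ (b i) (b j) • rankOneForm (z i) (z j) := by
  ext x y
  rw [pullback_apply, apply_cylindrical hB]
  simp

theorem tendsto_quadratic_of_cylindrical {m : ℕ} {z b : Fin m → H} {B : H →L[ℝ] H}
    (hB : ∀ x, B x = ∑ i, ⟪z i, x⟫ • b i) {x : ℝ → H} (hx : Continuous x) {e : ℕ → ℝ} {s : ℝ}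
    {qs : (H →L[ℝ] H →L[ℝ] ℝ) →L[ℝ] ℝ}
    (h : ∀ i j, Tendsto (fun n => (e n)⁻¹ * ∫ r in (0:ℝ)..s,
      rankOneForm (z i) (z j) (x (r + e n) - x r) (x (r + e n) - x r)) atTop
        (𝓝 (qs (rankOneForm (z i) (z j))))) (φ : H →L[ℝ] H →L[ℝ] ℝ) :
    Tendsto (fun n => (e n)⁻¹ * ∫ r in (0:ℝ)..s,
      φ (B (x (r + e n)) - B (x r)) (B (x (r + e n)) - B (x r))) atTop
        (𝓝 (qs (pullback B φ))) := by
  have h1 : qs (pullback B φ) = ∑ i, ∑ j, φ (b i) (b j) * qs (rankOneForm (z i) (z j)) := by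
    rw [pullback_cylindrical hB]
    simp [map_sum]
  rw [h1]
  refine (tendsto_finsetSum _ fun i _ => tendsto_finsetSum _ fun j _ =>
    (h i j).const_mul (φ (b i) (b j))).congr fun n => ?_
  have hc : Continuous fun r => x (r + e n) - x r := by fun_prop
  have hci : ∀ i j, IntervalIntegrable (fun r => φ (b i) (b j) *
      rankOneForm (z i) (z j) (x (r + e n) - x r) (x (r + e n) - x r)) volume 0 s := fun i j =>
    Continuous.intervalIntegrable (by fun_prop) _ _
  simp_rw [← map_sub, apply_cylindrical hB]
  rw [intervalIntegral.integral_finsetSum fun i _ => Continuous.intervalIntegrable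
    (by fun_prop) _ _, Finset.mul_sum]
  refine Finset.sum_congr rfl fun i _ => ?_
  rw [intervalIntegral.integral_finsetSum fun j _ => hci i j, Finset.mul_sum]
  refine Finset.sum_congr rfl fun j _ => ?_
  rw [intervalIntegral.integral_const_mul]
  ring

theorem TendstoUcp.tendstoInMeasure_iSup {μ : Measure Ω} {T : ℝ} {Z : ℝ → ℝ → Ω → ℝ}
    {L : ℝ → Ω → ℝ} (h : TendstoUcp μ (𝓝[>] (0:ℝ)) T Z L) {e : ℕ → ℝ}
    (he : Tendsto e atTop (𝓝[>] 0)) :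
    TendstoInMeasure μ (fun n ω => ⨆ t : Icc (0:ℝ) T, ‖Z (e n) (t : ℝ) ω - L (t : ℝ) ω‖)
      atTop (fun _ => 0) := by
  rw [tendstoInMeasure_iff_norm]
  intro ε hε
  refine ((h ε hε).comp he).congr fun n => ?_
  simp only [Function.comp_apply, sub_zero]
  congr 1
  ext ω
  simp only [mem_ofPred_eq]
  rw [Real.norm_of_nonneg (Real.iSup_nonneg fun _ => norm_nonneg _)]

/-- On a path along which the suprema converge, the regularised quadratic variations converge
at each time. -/
theorem tendsto_quadratic_of_iSup {T : ℝ} {x : ℝ → H} (hx : Continuous x)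
    {q : ℝ → (H →L[ℝ] H →L[ℝ] ℝ) →L[ℝ] ℝ} {V : ℝ → ℝ} (hV : MonotoneOn V (Icc 0 T))
    (hq : ∀ s ∈ Icc 0 T, ∀ t ∈ Icc 0 T, s ≤ t → ∀ ψ, |q t ψ - q s ψ| ≤ (V t - V s) * ‖ψ‖)
    {ψ : H →L[ℝ] H →L[ℝ] ℝ} {e : ℕ → ℝ}
    (h : Tendsto (fun n => ⨆ t : Icc (0:ℝ) T, ‖(e n)⁻¹ * (∫ r in Ioc (0:ℝ) t,
      ψ (x (r + e n) - x r) (x (r + e n) - x r)) - q t ψ‖) atTop (𝓝 0)) {s : ℝ}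
    (hs : s ∈ Icc 0 T) :
    Tendsto (fun n => (e n)⁻¹ * ∫ r in (0:ℝ)..s,
      ψ (x (r + e n) - x r) (x (r + e n) - x r)) atTop (𝓝 (q s ψ)) := by
  have hT : 0 ≤ T := hs.1.trans hs.2
  rw [tendsto_iff_norm_sub_tendsto_zero]
  refine squeeze_zero (fun _ => norm_nonneg _) (fun n => ?_) h
  have hcont : Continuous fun r => ψ (x (r + e n) - x r) (x (r + e n) - x r) := by
    have hc : Continuous fun r => x (r + e n) - x r := by fun_prop
    fun_prop
  rw [intervalIntegral.integral_of_le hs.1]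
  refine le_ciSup (f := fun t : Icc (0:ℝ) T => ‖(e n)⁻¹ * (∫ r in Ioc (0:ℝ) t,
      ψ (x (r + e n) - x r) (x (r + e n) - x r)) - q t ψ‖) ?_ ⟨s, hs⟩
  obtain ⟨M, hM⟩ := isCompact_Icc.exists_bound_of_continuousOn (s := Icc 0 T)
    (f := fun t : ℝ => ∫ r in (0:ℝ)..t, ψ (x (r + e n) - x r) (x (r + e n) - x r))
    (intervalIntegral.continuous_primitive (fun a b => hcont.intervalIntegrable a b) 0).continuousOn
  refine ⟨|(e n)⁻¹| * M + (|q 0 ψ| + (V T - V 0) * ‖ψ‖), ?_⟩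
  rintro _ ⟨⟨t, ht⟩, rfl⟩
  have h1 := hM t ht
  rw [intervalIntegral.integral_of_le ht.1] at h1
  have h2 := hq 0 ⟨le_rfl, hT⟩ t ht ht.1 ψ
  have h3 : (V t - V 0) * ‖ψ‖ ≤ (V T - V 0) * ‖ψ‖ := by
    gcongr
    exact hV ht ⟨hT, le_rfl⟩ ht.2
  have h4 : |q t ψ| ≤ |q 0 ψ| + (V T - V 0) * ‖ψ‖ := by
    have := abs_sub_abs_le_abs_sub (q t ψ) (q 0 ψ)
    linarith
  refine (norm_sub_le _ _).trans (add_le_add ?_ h4)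
  rw [norm_mul, Real.norm_eq_abs]
  gcongr

theorem pairing_quadratic_rankOne {μ : Measure Ω} {T : ℝ} {domA : Set H} {Aadj : H → H}
    {X : ℝ → Ω → H} {C : ℝ → Ω → ((H →L[ℝ] H →L[ℝ] ℝ) → ℝ)} (h0 : (0:H) ∈ domA)
    (hCrep : ∀ (z w : ℕ → H), (∀ k, z k ∈ domA) → (∀ k, w k ∈ domA) →
      Summable (fun k => graphNorm Aadj (z k) * graphNorm Aadj (w k)) →
      ∀ ψ : H →L[ℝ] H →L[ℝ] ℝ,
        (∀ x y : H, ψ x y = ∑' k, ⟪x, z k⟫ * ⟪y, w k⟫) →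
        TendstoUcp μ (𝓝[>] (0:ℝ)) T
          (fun ε t ω => ε⁻¹ * ∫ r in Ioc (0:ℝ) t,
            ψ (X (r + ε) ω - X r ω) (X (r + ε) ω - X r ω))
          (fun t ω => C t ω ψ)) (hA0 : Aadj 0 = 0) {z w : H} (hz : z ∈ domA) (hw : w ∈ domA) :
    TendstoUcp μ (𝓝[>] (0:ℝ)) T
      (fun ε t ω => ε⁻¹ * ∫ r in Ioc (0:ℝ) t,
        rankOneForm z w (X (r + ε) ω - X r ω) (X (r + ε) ω - X r ω))
      (fun t ω => C t ω (rankOneForm z w)) := by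
  refine hCrep (fun k => if k = 0 then z else 0) (fun k => if k = 0 then w else 0)
    (fun k => by split_ifs <;> assumption)
    (fun k => by split_ifs <;> assumption)
    (summable_of_ne_finset_zero (s := {0}) fun k hk => ?_) _ fun x y => ?_
  · have : k ≠ 0 := by simpa using hk
    simp [this, graphNorm, hA0]
  · rw [tsum_eq_single 0 fun k hk => by simp [hk]]
    simp [rankOneForm_apply, real_inner_comm]

/-- `F` is of class `C^{1,2}` on `[0,T] × E` and extended constantly in time beyond `T`. -/
structure IsC12 (T : ℝ) (F Dt : ℝ → E → ℝ) (D1 : ℝ → E → E →L[ℝ] ℝ)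
    (D2 : ℝ → E → E →L[ℝ] E →L[ℝ] ℝ) : Prop where
  cont : Continuous fun p : ℝ × E => F p.1 p.2
  cont_dt : Continuous fun p : ℝ × E => Dt p.1 p.2
  cont_dx : Continuous fun p : ℝ × E => D1 p.1 p.2
  cont_dxx : Continuous fun p : ℝ × E => D2 p.1 p.2
  eq_of_ge : ∀ r ≥ T, ∀ x, F r x = F T x
  hasDerivAt : ∀ r ∈ Ioo 0 T, ∀ x, HasDerivAt (fun s => F s x) (Dt r x) r
  hasFDerivAt : ∀ r x, HasFDerivAt (F r) (D1 r x) x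
  hasFDerivAt_dx : ∀ r x, HasFDerivAt (D1 r) (D2 r x) x

/-- `q` has variation dominated by the monotone function `V` on `[0,T]`. -/
def IsVariationBound (T : ℝ) (q : ℝ → (E →L[ℝ] E →L[ℝ] ℝ) →L[ℝ] ℝ) (V : ℝ → ℝ) : Prop :=
  MonotoneOn V (Icc 0 T) ∧
    ∀ s ∈ Icc 0 T, ∀ t ∈ Icc 0 T, s ≤ t → ∀ ψ, |q t ψ - q s ψ| ≤ (V t - V s) * ‖ψ‖

theorem IsVariationBound.comp_pullback {T : ℝ} {q : ℝ → (E →L[ℝ] E →L[ℝ] ℝ) →L[ℝ] ℝ} {V : ℝ → ℝ}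
    (h : IsVariationBound T q V) (B : E →L[ℝ] E) :
    IsVariationBound T (fun s => (q s).comp (pullback B)) (fun s => ‖B‖ * ‖B‖ * V s) := by
  refine ⟨fun s hs t ht hst => mul_le_mul_of_nonneg_left (h.1 hs ht hst) (by positivity),
    fun s hs t ht hst ψ => (h.2 s hs t ht hst (pullback B ψ)).trans ?_⟩
  calc (V t - V s) * ‖pullback B ψ‖ ≤ (V t - V s) * (‖B‖ * ‖B‖ * ‖ψ‖) :=
        mul_le_mul_of_nonneg_left (norm_pullback_apply_le B ψ) (sub_nonneg.2 (h.1 hs ht hst))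
    _ = (‖B‖ * ‖B‖ * V t - ‖B‖ * ‖B‖ * V s) * ‖ψ‖ := by ring

/-- Convergence of the regularised derivative along a path whose image under `B` has a
quadratic variation. -/
theorem tendsto_regularised_derivative_comp {T : ℝ} (hT : 0 ≤ T) {F Dt : ℝ → H → ℝ}
    {D1 : ℝ → H → H →L[ℝ] ℝ} {D2 : ℝ → H → H →L[ℝ] H →L[ℝ] ℝ} (hF : IsC12 T F Dt D1 D2)
    {x : ℝ → H} (hx : Continuous x) {q : ℝ → (H →L[ℝ] H →L[ℝ] ℝ) →L[ℝ] ℝ} {V : ℝ → ℝ}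
    (hq : IsVariationBound T q V) (B : H →L[ℝ] H) {e : ℕ → ℝ} (he : Tendsto e atTop (𝓝[>] 0))
    (h : ∀ φ : H →L[ℝ] H →L[ℝ] ℝ, ∀ s ∈ Icc 0 T, Tendsto (fun n => (e n)⁻¹ *
      ∫ r in (0:ℝ)..s, φ (B (x (r + e n)) - B (x r)) (B (x (r + e n)) - B (x r))) atTop
        (𝓝 (q s (pullback B φ)))) {t : ℝ} (ht : t ∈ Icc 0 T) :
    Tendsto (fun n => (e n)⁻¹ * ∫ r in (0:ℝ)..t, D1 r (B (x r)) (B (x (r + e n)) - B (x r)))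
      atTop (𝓝 (itoRemainder T F Dt D2 q x B t)) := by
  obtain ⟨hV', hq'⟩ := hq.comp_pullback B
  refine tendsto_regularised_derivative hT hF.cont hF.cont_dt hF.cont_dx hF.cont_dxx hF.eq_of_ge
    hF.hasDerivAt hF.hasFDerivAt hF.hasFDerivAt_dx (y := fun r => B (x r))
    (B.continuous.comp hx) hV' hq' he (M := |q t (pullback B (innerSL ℝ))| + 1) (by positivity) ht
    ?_ fun s _ u hu => h _ u hu
  filter_upwards [(h (innerSL ℝ) t ht).eventually_le_const
    (lt_of_le_of_lt (le_abs_self _) (lt_add_one _))] with n hn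
  refine hn.trans_eq' (congrArg _ (intervalIntegral.integral_congr fun r _ => ?_))
  exact real_inner_self_eq_norm_sq (B (x (r + e n)) - B (x r))

theorem forwardPairing_cylindrical {μ : Measure Ω} {T : ℝ} (hT : 0 ≤ T) {D : Set H}
    {X : ℝ → Ω → H} (hX : ∀ ω, Continuous fun t => X t ω)
    {q : ℝ → Ω → (H →L[ℝ] H →L[ℝ] ℝ) →L[ℝ] ℝ}
    (hq : ∀ᵐ ω ∂μ, ∃ V, IsVariationBound T (fun s => q s ω) V)
    (hrep : ∀ z ∈ D, ∀ w ∈ D, TendstoUcp μ (𝓝[>] (0:ℝ)) T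
      (fun ε t ω => ε⁻¹ * ∫ r in Ioc (0:ℝ) t,
        rankOneForm z w (X (r + ε) ω - X r ω) (X (r + ε) ω - X r ω))
      (fun t ω => q t ω (rankOneForm z w)))
    {F Dt : ℝ → H → ℝ} {g : ℝ → H → H} {D2 : ℝ → H → H →L[ℝ] H →L[ℝ] ℝ}
    (hF : IsC12 T F Dt (fun r x => innerSL ℝ (g r x)) D2)
    {m : ℕ} {z b : Fin m → H} (hz : ∀ i, z i ∈ D) {B : H →L[ℝ] H}
    (hB : ∀ x, B x = ∑ i, ⟪z i, x⟫ • b i) {I : ℝ → Ω → ℝ}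
    (hI : IsForwardPairing μ T (fun r ω => B.adjoint (g r (B (X r ω)))) X I)
    {t : ℝ} (ht : t ∈ Icc 0 T) :
    ∀ᵐ ω ∂μ, I t ω = itoRemainder T F Dt D2 (fun s => q s ω) (fun s => X s ω) B t := by
  have hconv : ∀ o : Option (Fin m × Fin m), TendstoInMeasure μ
      (o.elim (fun (n : ℕ) ω => regPairing (fun r => B.adjoint (g r (B (X r ω)))) (fun r => X r ω) t
        (1 / ((n : ℝ) + 1)))
        fun ij (n : ℕ) ω => ⨆ s : Icc (0:ℝ) T, ‖(1 / ((n : ℝ) + 1))⁻¹ * (∫ r in Ioc (0:ℝ) s,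
          rankOneForm (z ij.1) (z ij.2) (X (r + 1 / ((n : ℝ) + 1)) ω - X r ω)
            (X (r + 1 / ((n : ℝ) + 1)) ω - X r ω)) - q s ω (rankOneForm (z ij.1) (z ij.2))‖)
      atTop (o.elim (I t) fun _ _ => 0) := by
    rintro (_ | ij)
    · exact hI.tendsto_regPairing ht tendsto_one_div_nhdsGT_zero
    · exact (hrep _ (hz ij.1) _ (hz ij.2)).tendstoInMeasure_iSup tendsto_one_div_nhdsGT_zero
  obtain ⟨ns, hns, hae⟩ := exists_common_seq_tendsto_ae μ hconv
  filter_upwards [hae, hq] with ω hω ⟨V, hV⟩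
  have he := tendsto_one_div_nhdsGT_zero.comp hns.tendsto_atTop
  refine tendsto_nhds_unique (hω none) ((tendsto_regularised_derivative_comp hT hF (hX ω) hV B he
    (fun φ s hs => tendsto_quadratic_of_cylindrical hB (hX ω) (fun i j =>
      tendsto_quadratic_of_iSup (hX ω) hV.1 hV.2 (hω (some (i, j))) hs) φ) ht).congr fun n => ?_)
  simp only [Option.elim, regPairing, Function.comp_apply, intervalIntegral.integral_of_le ht.1,
    innerSL_apply_apply, ContinuousLinearMap.adjoint_inner_left, ← map_sub B]

/-! ### Regularisation by means of the semigroup -/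

/-- `J h` is the mean of the semigroup `S` over `[0,h]`, for `0 < h ≤ 1`, and these operators
are bounded by `M`. -/
structure IsMean (S J : ℝ → H →L[ℝ] H) (M : ℝ) : Prop where
  norm_semigroup_le : ∀ h ∈ Icc (0:ℝ) 1, ‖S h‖ ≤ M
  norm_le : ∀ h ∈ Ioc (0:ℝ) 1, ‖J h‖ ≤ M
  eq_integral : ∀ h ∈ Ioc (0:ℝ) 1, ∀ x, J h x = h⁻¹ • ∫ s in (0:ℝ)..h, S s x

theorem eventually_mem_Ioc_zero_one : ∀ᶠ h in 𝓝[>] (0:ℝ), h ∈ Ioc (0:ℝ) 1 :=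
  Ioc_mem_nhdsGT one_pos

namespace IsC0Semigroup

variable {S : ℝ → H →L[ℝ] H}

theorem intervalIntegrable (hS : IsC0Semigroup S) {a b : ℝ} (ha : 0 ≤ a) (hb : 0 ≤ b) (x : H) :
    IntervalIntegrable (fun s => S s x) volume a b :=
  ((hS.2.2 x).mono fun _ hr => (le_min ha hb).trans hr.1).intervalIntegrable

theorem exists_isMean (hS : IsC0Semigroup S) : ∃ J M, IsMean S J M := by
  obtain ⟨M, hM⟩ := banach_steinhaus (g := fun s : Icc (0:ℝ) 1 => S s) fun x => by
    obtain ⟨C, hC⟩ := isCompact_Icc.exists_bound_of_continuousOn (s := Icc (0:ℝ) 1)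
      ((hS.2.2 x).mono Icc_subset_Ici_self)
    exact ⟨C, fun s => hC s s.2⟩
  have hM' : ∀ h ∈ Icc (0:ℝ) 1, ‖S h‖ ≤ M := fun h hh => hM ⟨h, hh⟩
  have hJ : ∀ h : ℝ, ∃ J : H →L[ℝ] H, h ∈ Ioc (0:ℝ) 1 →
      ‖J‖ ≤ M ∧ ∀ x, J x = h⁻¹ • ∫ s in (0:ℝ)..h, S s x := by
    intro h
    by_cases hh : h ∈ Ioc (0:ℝ) 1
    swap
    · exact ⟨0, fun h' => absurd h' hh⟩
    have hM0 : 0 ≤ M := (norm_nonneg _).trans (hM' h ⟨hh.1.le, hh.2⟩)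
    let L : H →ₗ[ℝ] H :=
      { toFun := fun x => h⁻¹ • ∫ s in (0:ℝ)..h, S s x
        map_add' := fun x y => by
          simp only [map_add]
          rw [intervalIntegral.integral_add (hS.intervalIntegrable le_rfl hh.1.le x)
            (hS.intervalIntegrable le_rfl hh.1.le y), smul_add]
        map_smul' := fun c x => by
          simp only [map_smul, intervalIntegral.integral_smul, RingHom.id_apply]
          rw [smul_comm] }
    have hL : ∀ x, ‖L x‖ ≤ M * ‖x‖ := fun x => by
      have h1 : ‖∫ s in (0:ℝ)..h, S s x‖ ≤ M * ‖x‖ * |h - 0| := by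
        refine intervalIntegral.norm_integral_le_of_norm_le_const fun s hs => ?_
        rw [uIoc_of_le hh.1.le] at hs
        exact (S s).le_of_opNorm_le (hM' s ⟨hs.1.le, hs.2.trans hh.2⟩) x
      change ‖h⁻¹ • ∫ s in (0:ℝ)..h, S s x‖ ≤ _
      rw [sub_zero, abs_of_pos hh.1] at h1
      rw [norm_smul, norm_inv, Real.norm_of_nonneg hh.1.le, inv_mul_le_iff₀ hh.1]
      linarith
    exact ⟨L.mkContinuous M hL, fun _ => ⟨L.mkContinuous_norm_le hM0 hL, fun x => rfl⟩⟩
  choose J hJ using hJ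
  exact ⟨J, M, hM', fun h hh => (hJ h hh).1, fun h hh => (hJ h hh).2⟩

end IsC0Semigroup

namespace IsMean

variable {S J : ℝ → H →L[ℝ] H} {M : ℝ}

theorem nonneg (hJ : IsMean S J M) : 0 ≤ M :=
  (norm_nonneg _).trans (hJ.norm_le 1 ⟨one_pos, le_rfl⟩)

theorem tendsto (hJ : IsMean S J M) (hS : IsC0Semigroup S) (x : H) :
    Tendsto (fun h => J h x) (𝓝[>] 0) (𝓝 x) := by
  have hc : ContinuousWithinAt (fun s => S s x) (Ici 0) 0 := hS.2.2 x 0 self_mem_Ici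
  rw [Metric.tendsto_nhds]
  intro ε hε
  have h1 := (Metric.tendsto_nhds.1 hc (ε / 2) (half_pos hε))
  simp only [hS.1, ContinuousLinearMap.id_apply] at h1
  obtain ⟨δ, hδ, h2⟩ := Metric.mem_nhdsWithin_iff.1 h1
  filter_upwards [eventually_mem_Ioc_zero_one, Ioo_mem_nhdsGT hδ] with h hh hhδ
  have h3 : J h x - x = h⁻¹ • ∫ s in (0:ℝ)..h, (S s x - x) := by
    rw [intervalIntegral.integral_sub (hS.intervalIntegrable le_rfl hh.1.le x)
      intervalIntegrable_const, hJ.eq_integral h hh, intervalIntegral.integral_const, smul_sub,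
      sub_zero, inv_smul_smul₀ hh.1.ne']
  have h4 : ‖∫ s in (0:ℝ)..h, (S s x - x)‖ ≤ ε / 2 * |h - 0| := by
    refine intervalIntegral.norm_integral_le_of_norm_le_const fun s hs => ?_
    rw [uIoc_of_le hh.1.le] at hs
    rw [← dist_eq_norm]
    refine (h2 ⟨?_, hs.1.le⟩).le
    rw [mem_ball, Real.dist_eq, sub_zero, abs_of_pos hs.1]
    exact hs.2.trans_lt hhδ.2
  rw [sub_zero, abs_of_pos hh.1] at h4
  rw [dist_eq_norm, h3, norm_smul, norm_inv, Real.norm_of_nonneg hh.1.le]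
  calc h⁻¹ * ‖∫ s in (0:ℝ)..h, (S s x - x)‖ ≤ h⁻¹ * (ε / 2 * h) := by
        gcongr
        exact inv_nonneg.2 hh.1.le
    _ = ε / 2 := by field_simp [hh.1.ne']
    _ < ε := half_lt_self hε

theorem apply_sub (hJ : IsMean S J M) (hS : IsC0Semigroup S) {h t : ℝ} (hh : h ∈ Ioc (0:ℝ) 1)
    (ht : t ∈ Ioc (0:ℝ) 1) (x : H) :
    t⁻¹ • J h (S t x - x) = h⁻¹ • J t (S h x - x) := by
  have key : ∀ a ∈ Ioc (0:ℝ) 1, ∀ b ∈ Ioc (0:ℝ) 1, J a (S b x - x) =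
      a⁻¹ • ((∫ s in (0:ℝ)..a + b, S s x) - (∫ s in (0:ℝ)..b, S s x) -
        ∫ s in (0:ℝ)..a, S s x) := by
    intro a ha b hb
    have h1 : ∫ s in (0:ℝ)..a, S s (S b x) = ∫ s in (0:ℝ)..a, S (s + b) x := by
      refine intervalIntegral.integral_congr fun s hs => ?_
      rw [uIcc_of_le ha.1.le] at hs
      exact (congrArg (fun L : H →L[ℝ] H => L x) (hS.2.1 s b hs.1 hb.1.le)).symm
    rw [map_sub, hJ.eq_integral a ha, hJ.eq_integral a ha, h1,
      intervalIntegral.integral_comp_add_right (fun s => S s x), zero_add, ← smul_sub,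
      intervalIntegral.integral_interval_sub_left]
    · exact hS.intervalIntegrable le_rfl (add_pos ha.1 hb.1).le x
    · exact hS.intervalIntegrable le_rfl hb.1.le x
  rw [key h hh t ht, key t ht h hh, smul_comm, add_comm t h, sub_right_comm]

theorem adjoint_sub (hJ : IsMean S J M) (hS : IsC0Semigroup S) {h t : ℝ} (hh : h ∈ Ioc (0:ℝ) 1)
    (ht : t ∈ Ioc (0:ℝ) 1) (z : H) :
    t⁻¹ • ((S t).adjoint ((J h).adjoint z) - (J h).adjoint z) =
      h⁻¹ • ((S h).adjoint ((J t).adjoint z) - (J t).adjoint z) := by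
  refine ext_inner_right ℝ fun x => ?_
  have := congrArg (fun y => ⟪z, y⟫) (hJ.apply_sub hS hh ht x)
  simpa [inner_sub_left, inner_smul_left, inner_smul_right, inner_sub_right,
    ContinuousLinearMap.adjoint_inner_left] using this

theorem adjoint_comm (hJ : IsMean S J M) (hS : IsC0Semigroup S) {h t : ℝ} (hh : h ∈ Ioc (0:ℝ) 1)
    (ht : 0 ≤ t) (z : H) :
    (S t).adjoint ((J h).adjoint z) = (J h).adjoint ((S t).adjoint z) := by
  refine ext_inner_right ℝ fun x => ?_
  simp only [ContinuousLinearMap.adjoint_inner_left]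
  congr 1
  rw [hJ.eq_integral h hh, hJ.eq_integral h hh, map_smul,
    ← ContinuousLinearMap.intervalIntegral_comp_comm _ (hS.intervalIntegrable le_rfl hh.1.le x)]
  congr 1
  refine intervalIntegral.integral_congr fun s hs => ?_
  rw [uIcc_of_le hh.1.le] at hs
  have h1 := congrArg (fun L : H →L[ℝ] H => L x) (hS.2.1 s t hs.1 ht)
  have h2 := congrArg (fun L : H →L[ℝ] H => L x) (hS.2.1 t s ht hs.1)
  rw [add_comm] at h2
  exact h1.symm.trans h2

theorem tendsto_adjoint_semigroup (hJ : IsMean S J M) (hS : IsC0Semigroup S) (z : H) :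
    Tendsto (fun t => (S t).adjoint z) (𝓝[>] 0) (𝓝 z) := by
  have hbd : ∀ t ∈ Ioc (0:ℝ) 1, ∀ w, ‖(S t).adjoint w‖ ≤ M * ‖w‖ := fun t ht w =>
    (S t).adjoint.le_of_opNorm_le (by
      rw [LinearIsometryEquiv.norm_map]
      exact hJ.norm_semigroup_le t ⟨ht.1.le, ht.2⟩) w
  have hJbd : ∀ t ∈ Ioc (0:ℝ) 1, ∀ w, ‖(J t).adjoint w‖ ≤ M * ‖w‖ := fun t ht w =>
    (J t).adjoint.le_of_opNorm_le (by
      rw [LinearIsometryEquiv.norm_map]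
      exact hJ.norm_le t ht) w
  have hM := hJ.nonneg
  let N : Submodule ℝ H :=
    { carrier := {w | Tendsto (fun t => (S t).adjoint w) (𝓝[>] 0) (𝓝 w)}
      add_mem' := fun {a b} ha hb => by simpa using ha.add hb
      zero_mem' := by simp
      smul_mem' := fun c a ha => by simpa using ha.const_smul c }
  have hrange : ∀ h ∈ Ioc (0:ℝ) 1, ∀ w, (J h).adjoint w ∈ N := by
    intro h hh w
    change Tendsto _ _ _
    rw [tendsto_iff_norm_sub_tendsto_zero]
    have h0 : Tendsto (fun t : ℝ => t * (h⁻¹ * (M * (M * ‖w‖) + M * ‖w‖))) (𝓝[>] 0) (𝓝 0) := by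
      simpa using (tendsto_id.mono_left nhdsWithin_le_nhds : Tendsto id (𝓝[>] (0:ℝ)) _).mul_const
        (h⁻¹ * (M * (M * ‖w‖) + M * ‖w‖))
    refine squeeze_zero' (Eventually.of_forall fun _ => norm_nonneg _) ?_ h0
    filter_upwards [eventually_mem_Ioc_zero_one] with t ht
    have h1 := congrArg (fun v : H => t • v) (hJ.adjoint_sub hS hh ht w)
    simp only [smul_inv_smul₀ ht.1.ne'] at h1
    rw [h1, norm_smul, norm_smul, norm_inv, Real.norm_of_nonneg ht.1.le,
      Real.norm_of_nonneg hh.1.le]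
    have hJt := hJbd t ht w
    have hht := hbd h hh ((J t).adjoint w)
    have := mul_le_mul_of_nonneg_left hJt hM
    have h5 := norm_sub_le ((S h).adjoint ((J t).adjoint w)) ((J t).adjoint w)
    have ht0 := ht.1.le
    have hh0 := inv_nonneg.2 hh.1.le
    gcongr
    linarith
  have hN : Nᗮ = ⊥ := by
    rw [Submodule.eq_bot_iff]
    intro y hy
    refine tendsto_nhds_unique (hJ.tendsto hS y) (tendsto_const_nhds.congr' ?_)
    filter_upwards [eventually_mem_Ioc_zero_one] with h hh
    refine ext_inner_left ℝ fun w => ?_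
    rw [inner_zero_right, ← ContinuousLinearMap.adjoint_inner_left]
    exact (hy _ (hrange h hh w)).symm
  have hdense : z ∈ closure (N : Set H) := by
    have h1 := Submodule.topologicalClosure_eq_top_iff.2 hN
    rw [← Submodule.topologicalClosure_coe, h1]
    trivial
  rw [Metric.tendsto_nhds]
  intro ε hε
  obtain ⟨w, hw, hwz⟩ := Metric.mem_closure_iff.1 hdense (ε / (2 * (M + 2))) (by positivity)
  have hw' : Tendsto (fun t => (S t).adjoint w) (𝓝[>] 0) (𝓝 w) := hw
  filter_upwards [eventually_mem_Ioc_zero_one, Metric.tendsto_nhds.1 hw' (ε / 2) (half_pos hε)]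
    with t ht h1
  have h2 := hbd t ht (z - w)
  rw [map_sub, ← dist_eq_norm, ← dist_eq_norm] at h2
  have h3 : (M + 2) * dist z w < ε / 2 := by
    rw [lt_div_iff₀ (by positivity)] at hwz
    linarith
  have h4 := dist_triangle4 ((S t).adjoint z) ((S t).adjoint w) w z
  rw [dist_comm w z] at h4
  have := dist_nonneg (x := z) (y := w)
  linarith

theorem tendsto_adjoint (hJ : IsMean S J M) (hS : IsC0Semigroup S) (z : H) :
    Tendsto (fun h => (J h).adjoint z) (𝓝[>] 0) (𝓝 z) := by
  rw [Metric.tendsto_nhds]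
  intro ε hε
  have h1 := Metric.tendsto_nhds.1 (hJ.tendsto_adjoint_semigroup hS z) (ε / 2) (half_pos hε)
  obtain ⟨δ, hδ, h2⟩ := Metric.mem_nhdsWithin_iff.1 h1
  filter_upwards [eventually_mem_Ioc_zero_one, Ioo_mem_nhdsGT hδ] with h hh hhδ
  refine lt_of_le_of_lt ?_ (half_lt_self hε)
  rw [dist_eq_norm]
  refine ContinuousLinearMap.opNorm_le_bound (innerSL ℝ ((J h).adjoint z - z)) (by positivity)
    (fun x => ?_) |>.trans' (innerSL_apply_norm ℝ _).ge
  have h3 : innerSL ℝ ((J h).adjoint z - z) x =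
      h⁻¹ * ∫ s in (0:ℝ)..h, ⟪(S s).adjoint z - z, x⟫ := by
    have hi : ∀ s, ⟪(S s).adjoint z - z, x⟫ = innerSL ℝ z (S s x) - ⟪z, x⟫ := fun s => by
      rw [inner_sub_left, ContinuousLinearMap.adjoint_inner_left, innerSL_apply_apply]
    have hint := hS.intervalIntegrable le_rfl hh.1.le x
    simp only [hi]
    rw [intervalIntegral.integral_sub ⟨(innerSL ℝ z).integrable_comp hint.1,
      (innerSL ℝ z).integrable_comp hint.2⟩ intervalIntegrable_const, ContinuousLinearMap.intervalIntegral_comp_comm _ hint,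
      intervalIntegral.integral_const, innerSL_apply_apply, inner_sub_left,
      ContinuousLinearMap.adjoint_inner_left, hJ.eq_integral h hh, inner_smul_right, mul_sub,
      innerSL_apply_apply, sub_zero, smul_eq_mul, inv_mul_cancel_left₀ hh.1.ne']
  have h4 : ‖∫ s in (0:ℝ)..h, ⟪(S s).adjoint z - z, x⟫‖ ≤ ε / 2 * ‖x‖ * |h - 0| := by
    refine intervalIntegral.norm_integral_le_of_norm_le_const fun s hs => ?_
    rw [uIoc_of_le hh.1.le] at hs
    refine (norm_inner_le_norm _ _).trans ?_
    gcongr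
    rw [← dist_eq_norm]
    refine (h2 ⟨?_, hs.1⟩).le
    rw [mem_ball, Real.dist_eq, sub_zero, abs_of_pos hs.1]
    exact hs.2.trans_lt hhδ.2
  rw [sub_zero, abs_of_pos hh.1] at h4
  rw [h3, norm_mul, norm_inv, Real.norm_of_nonneg hh.1.le, inv_mul_le_iff₀ hh.1]
  linarith

end IsMean

namespace IsAdjointGenerator

variable {S J : ℝ → H →L[ℝ] H} {M : ℝ} {domA : Set H} {Aadj : H → H}

theorem eq_of_tendsto (hA : IsAdjointGenerator S domA Aadj) {z l : H}
    (h : Tendsto (fun t : ℝ => t⁻¹ • ((S t).adjoint z - z)) (𝓝[>] (0:ℝ)) (𝓝 l)) :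
    z ∈ domA ∧ Aadj z = l := by
  have hz := (hA.1 z).2 ⟨l, h⟩
  exact ⟨hz, tendsto_nhds_unique (hA.2 z hz) h⟩

theorem adjoint_mean (hA : IsAdjointGenerator S domA Aadj) (hS : IsC0Semigroup S)
    (hJ : IsMean S J M) {h : ℝ} (hh : h ∈ Ioc (0:ℝ) 1) (z : H) :
    (J h).adjoint z ∈ domA ∧ Aadj ((J h).adjoint z) = h⁻¹ • ((S h).adjoint z - z) := by
  refine hA.eq_of_tendsto ?_
  have h1 := hJ.tendsto_adjoint hS z
  have h2 := ((((S h).adjoint.continuous.tendsto z).comp h1).sub h1).const_smul h⁻¹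
  refine h2.congr' ?_
  filter_upwards [eventually_mem_Ioc_zero_one] with t ht
  exact (hJ.adjoint_sub hS hh ht z).symm

theorem adjoint_mean_of_mem (hA : IsAdjointGenerator S domA Aadj) (hS : IsC0Semigroup S)
    (hJ : IsMean S J M) {h : ℝ} (hh : h ∈ Ioc (0:ℝ) 1) {z : H} (hz : z ∈ domA) :
    Aadj ((J h).adjoint z) = (J h).adjoint (Aadj z) := by
  refine (hA.eq_of_tendsto ?_).2
  refine (((J h).adjoint.continuous.tendsto _).comp (hA.2 z hz)).congr' ?_
  filter_upwards [self_mem_nhdsWithin] with t ht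
  simp only [Function.comp_apply, map_smul, map_sub, hJ.adjoint_comm hS hh (le_of_lt ht)]

theorem exists_closed_graph (hA : IsAdjointGenerator S domA Aadj) (hS : IsC0Semigroup S) :
    ∃ G : Submodule ℝ (H × H), IsClosed (G : Set (H × H)) ∧
      ∀ p : H × H, p ∈ G ↔ p.1 ∈ domA ∧ Aadj p.1 = p.2 := by
  obtain ⟨J, M, hJ⟩ := hS.exists_isMean
  have hmem : ∀ p : H × H, Tendsto (fun t : ℝ => t⁻¹ • ((S t).adjoint p.1 - p.1)) (𝓝[>] (0:ℝ))
      (𝓝 p.2) ↔ p.1 ∈ domA ∧ Aadj p.1 = p.2 := fun p =>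
    ⟨hA.eq_of_tendsto, fun h => h.2 ▸ hA.2 _ h.1⟩
  refine ⟨{ carrier := {p | Tendsto (fun t : ℝ => t⁻¹ • ((S t).adjoint p.1 - p.1)) (𝓝[>] (0:ℝ))
              (𝓝 p.2)}
            add_mem' := fun {a b} ha hb => ?_
            zero_mem' := by simp
            smul_mem' := fun c a ha => ?_ }, ?_, hmem⟩
  · refine (Filter.Tendsto.add ha hb).congr fun t => ?_
    simp only [Prod.fst_add, map_add, ← smul_add]
    congr 1
    abel
  · refine (Filter.Tendsto.const_smul ha c).congr fun t => ?_
    simp only [Prod.smul_fst, map_smul, ← smul_sub]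
    rw [smul_comm]
  · have hset : {p : H × H | Tendsto (fun t : ℝ => t⁻¹ • ((S t).adjoint p.1 - p.1)) (𝓝[>] (0:ℝ))
        (𝓝 p.2)} = ⋂ h ∈ Ioc (0:ℝ) 1,
          {p : H × H | h⁻¹ • ((S h).adjoint p.1 - p.1) = (J h).adjoint p.2} := by
      ext p
      simp only [mem_iInter, mem_ofPred_eq]
      constructor
      · intro hp h hh
        obtain ⟨h1, h2⟩ := (hmem p).1 hp
        rw [← (hA.adjoint_mean hS hJ hh p.1).2, hA.adjoint_mean_of_mem hS hJ hh h1, h2]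
      · intro hp
        refine (hJ.tendsto_adjoint hS p.2).congr' ?_
        filter_upwards [eventually_mem_Ioc_zero_one] with h hh
        exact (hp h hh).symm
    exact hset.symm.subst (motive := IsClosed) <| isClosed_biInter fun h _ => isClosed_eq (by fun_prop) (by fun_prop)

end IsAdjointGenerator

/-! ### Removing the regularisation -/

theorem exists_finiteRank_projections [TopologicalSpace.SeparableSpace H] :
    ∃ P : ℕ → H →L[ℝ] H, (∀ n, IsSelfAdjoint (P n)) ∧ (∀ n, ‖P n‖ ≤ 1) ∧
      (∀ v, Tendsto (fun n => P n v) atTop (𝓝 v)) ∧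
      ∀ n, ∃ (m : ℕ) (b : Fin m → H), ∀ x, P n x = ∑ i, ⟪b i, x⟫ • b i := by
  let s : ℕ → Set H := fun n => TopologicalSpace.denseSeq H '' Iio n
  have hfin : ∀ n, FiniteDimensional ℝ (Submodule.span ℝ (s n)) := fun n =>
    FiniteDimensional.span_of_finite ℝ ((finite_Iio n).image _)
  refine ⟨fun n => (Submodule.span ℝ (s n)).starProjection, fun n => isSelfAdjoint_starProjection _,
    fun n => Submodule.starProjection_norm_le _,
    fun v => Submodule.starProjection_tendsto_self (fun n => Submodule.span ℝ (s n))
      (fun a b hab => Submodule.span_mono (image_mono (Iio_subset_Iio hab))) v fun x _ => ?_,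
    fun n => ⟨_, fun i => stdOrthonormalBasis ℝ (Submodule.span ℝ (s n)) i, fun x => ?_⟩⟩
  · rw [← SetLike.mem_coe, Submodule.topologicalClosure_coe]
    refine closure_mono ?_ (TopologicalSpace.denseRange_denseSeq H x)
    rintro _ ⟨k, rfl⟩
    exact Submodule.mem_iSup_of_mem (k + 1)
      (Submodule.subset_span (mem_image_of_mem _ (Nat.lt_succ_self k)))
  · change (Submodule.span ℝ (s n)).starProjection x = _
    rw [(stdOrthonormalBasis ℝ (Submodule.span ℝ (s n))).starProjection_eq_sum_rankOne]
    simp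

/-- The Itô formula for `F(t, BX(t))`, with forward integrand `B* g(r, BX(r))`. -/
def ItoFormulaFor (μ : Measure Ω) (T : ℝ) (F Dt : ℝ → H → ℝ) (g : ℝ → H → H)
    (D2 : ℝ → H → H →L[ℝ] H →L[ℝ] ℝ) (q : ℝ → Ω → (H →L[ℝ] H →L[ℝ] ℝ) →L[ℝ] ℝ)
    (X : ℝ → Ω → H) (B : H →L[ℝ] H) : Prop :=
  ∀ I, IsForwardPairing μ T (fun r ω => B.adjoint (g r (B (X r ω)))) X I →
    ∀ t ∈ Icc 0 T, ∀ᵐ ω ∂μ,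
      I t ω = itoRemainder T F Dt D2 (fun s => q s ω) (fun s => X s ω) B t

theorem ItoFormulaFor.of_strong_limit {μ : Measure Ω} {T : ℝ} (hT : 0 ≤ T) {X : ℝ → Ω → H}
    (hX : ∀ ω, Continuous fun t => X t ω)
    {q : ℝ → Ω → (H →L[ℝ] H →L[ℝ] ℝ) →L[ℝ] ℝ}
    (hq : ∀ᵐ ω ∂μ, ∃ V, IsVariationBound T (fun s => q s ω) V)
    (hqim : ∀ s ω, InProjTensorImage (q s ω))
    {F Dt : ℝ → H → ℝ} {g : ℝ → H → H} {D2 : ℝ → H → H →L[ℝ] H →L[ℝ] ℝ}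
    (hF : IsC12 T F Dt (fun r x => innerSL ℝ (g r x)) D2)
    {G : Submodule ℝ (H × H)} (hG : IsClosed (G : Set (H × H)))
    (hFwd : ∀ f : ℝ × H → G, Continuous f →
      ∃ I, IsForwardPairing μ T (fun r ω => (f (r, X r ω) : H × H).1) X I)
    {w : ℝ × H → H × H} (hw : Continuous w) (hwG : ∀ p, w p ∈ G) (hwg : ∀ p, (w p).1 = g p.1 p.2)
    {B : ℕ → H →L[ℝ] H} {B₀ : H →L[ℝ] H} {K : ℝ} (hK : ∀ n, ‖B n‖ ≤ K)
    (hB : ∀ v, Tendsto (fun n => B n v) atTop (𝓝 (B₀ v)))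
    {L : ℕ → H × H →L[ℝ] H × H} {L₀ : H × H →L[ℝ] H × H} {K' : ℝ} (hK' : ∀ n, ‖L n‖ ≤ K')
    (hL : ∀ v, Tendsto (fun n => L n v) atTop (𝓝 (L₀ v)))
    (hLG : ∀ n, ∀ p ∈ G, L n p ∈ G ∧ (L n p).1 = (B n).adjoint p.1)
    (hLG₀ : ∀ p ∈ G, L₀ p ∈ G ∧ (L₀ p).1 = B₀.adjoint p.1)
    (h : ∀ n, ItoFormulaFor μ T F Dt g D2 q X (B n)) :
    ItoFormulaFor μ T F Dt g D2 q X B₀ := by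
  intro I₀ hI₀ t ht
  let f : ℕ → ℝ × H → G := fun n p => ⟨L n (w (p.1, B n p.2)), (hLG n _ (hwG _)).1⟩
  let f₀ : ℝ × H → G := fun p => ⟨L₀ (w (p.1, B₀ p.2)), (hLG₀ _ (hwG _)).1⟩
  have hf : ∀ n, Continuous (f n) := fun n => Continuous.subtype_mk (by fun_prop) _
  have hf₀ : Continuous f₀ := Continuous.subtype_mk (by fun_prop) _
  have hfeq : ∀ n, (fun r ω => (B n).adjoint (g r (B n (X r ω)))) =
      fun r ω => (f n (r, X r ω) : H × H).1 := fun n => by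
    funext r ω
    rw [(hLG n _ (hwG _)).2, hwg]
  have hfeq₀ : (fun r ω => B₀.adjoint (g r (B₀ (X r ω)))) =
      fun r ω => (f₀ (r, X r ω) : H × H).1 := by
    funext r ω
    rw [(hLG₀ _ (hwG _)).2, hwg]
  choose I hI using fun n => hFwd (f n) (hf n)
  refine forwardPairing_stability μ hX hG hFwd hf hf₀ (fun ω => ?_) hI (hfeq₀ ▸ hI₀) ht
    (fun n => h n (I n) (by rw [hfeq]; exact hI n) t ht) ?_
  · refine tendstoUniformlyOn_of_forall_tendsto (hf₀.comp (continuous_id.prodMk (hX ω)))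
      isCompact_Icc fun r => tendsto_subtype_rng.2 ?_
    exact tendsto_clm_apply_of_strong hK' hL tendsto_fst
      ((hw.tendsto _).comp (tendsto_path_of_strong hK hB (hX ω) r))
  · filter_upwards [hq] with ω ⟨V, hV⟩
    exact tendsto_itoRemainder hT hF.cont hF.cont_dt hF.cont_dxx hV.1 hV.2 (fun s => hqim s ω)
      (hX ω) hK hB ht

theorem itoFormulaFor_id [TopologicalSpace.SeparableSpace H] {μ : Measure Ω} {T : ℝ} (hT : 0 ≤ T)
    {S : ℝ → H →L[ℝ] H} (hS : IsC0Semigroup S) {domA : Set H} {Aadj : H → H}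
    (hA : IsAdjointGenerator S domA Aadj) {X : ℝ → Ω → H} (hX : ∀ ω, Continuous fun t => X t ω)
    {q : ℝ → Ω → (H →L[ℝ] H →L[ℝ] ℝ) →L[ℝ] ℝ}
    (hq : ∀ᵐ ω ∂μ, ∃ V, IsVariationBound T (fun s => q s ω) V)
    (hqim : ∀ s ω, InProjTensorImage (q s ω))
    (hrep : ∀ z ∈ domA, ∀ w ∈ domA, TendstoUcp μ (𝓝[>] (0:ℝ)) T
      (fun ε t ω => ε⁻¹ * ∫ r in Ioc (0:ℝ) t,
        rankOneForm z w (X (r + ε) ω - X r ω) (X (r + ε) ω - X r ω))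
      (fun t ω => q t ω (rankOneForm z w)))
    {F Dt : ℝ → H → ℝ} {g : ℝ → H → H} {D2 : ℝ → H → H →L[ℝ] H →L[ℝ] ℝ}
    (hF : IsC12 T F Dt (fun r x => innerSL ℝ (g r x)) D2) (hgdom : ∀ r x, g r x ∈ domA)
    (hg : Continuous fun p : ℝ × H => (g p.1 p.2, Aadj (g p.1 p.2)))
    (hFwd : ∀ Γ : ℝ → H → H, (∀ t x, Γ t x ∈ domA) →
      Continuous (fun p : ℝ × H => (Γ p.1 p.2, Aadj (Γ p.1 p.2))) →
      ∃ I : ℝ → Ω → ℝ, IsForwardPairing μ T (fun r ω => Γ r (X r ω)) X I) :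
    ItoFormulaFor μ T F Dt g D2 q X (ContinuousLinearMap.id ℝ H) := by
  obtain ⟨G, hG, hmem⟩ := hA.exists_closed_graph hS
  obtain ⟨J, M, hJ⟩ := hS.exists_isMean
  obtain ⟨P, hPadj, hP1, hPlim, hPrank⟩ := exists_finiteRank_projections (H := H)
  have hM := hJ.nonneg
  have hFwd' : ∀ f : ℝ × H → G, Continuous f →
      ∃ I, IsForwardPairing μ T (fun r ω => (f (r, X r ω) : H × H).1) X I := by
    intro f hf
    refine hFwd (fun t x => (f (t, x) : H × H).1) (fun t x => ((hmem _).1 (f (t, x)).2).1) ?_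
    have : (fun p : ℝ × H => ((f p : H × H).1, Aadj (f p : H × H).1)) = fun p => (f p : H × H) :=
      funext fun p => Prod.ext rfl ((hmem _).1 (f p).2).2
    exact this ▸ continuous_subtype_val.comp hf
  have hwG : ∀ p : ℝ × H, (g p.1 p.2, Aadj (g p.1 p.2)) ∈ G := fun p =>
    (hmem _).2 ⟨hgdom _ _, rfl⟩
  have hmean : ∀ h ∈ Ioc (0:ℝ) 1, ItoFormulaFor μ T F Dt g D2 q X (J h) := by
    intro h hh
    let R : H →L[ℝ] H := h⁻¹ • ((S h).adjoint - ContinuousLinearMap.id ℝ H)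
    let Q : H →L[ℝ] H × H := (J h).adjoint.prod R
    have hQG : ∀ z, Q z ∈ G := fun z => (hmem _).2 (hA.adjoint_mean hS hJ hh z)
    refine ItoFormulaFor.of_strong_limit hT hX hq hqim hF hG hFwd' hg hwG (fun _ => rfl)
      (B := fun n => (P n).comp (J h)) (K := 1 * ‖J h‖)
      (fun n => ((P n).opNorm_comp_le _).trans (by gcongr; exact hP1 n)) (fun v => hPlim _)
      (L := fun n => Q.comp ((P n).comp (ContinuousLinearMap.fst ℝ H H)))
      (L₀ := Q.comp (ContinuousLinearMap.fst ℝ H H))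
      (K' := ‖Q‖ * (1 * ‖ContinuousLinearMap.fst ℝ H H‖))
      (fun n => (Q.opNorm_comp_le _).trans (by
        gcongr
        exact ((P n).opNorm_comp_le _).trans (by gcongr; exact hP1 n)))
      (fun v => (Q.continuous.tendsto _).comp (hPlim _))
      (fun n p _ => ⟨hQG _, ?_⟩) (fun p _ => ⟨hQG _, rfl⟩) fun n I hI t ht => ?_
    · rw [ContinuousLinearMap.adjoint_comp, (hPadj n).adjoint_eq]
      rfl
    · obtain ⟨m, b, hb⟩ := hPrank n
      refine forwardPairing_cylindrical hT hX hq hrep hF (b := b) (z := fun i => (J h).adjoint (b i))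
        (fun i => (hA.adjoint_mean hS hJ hh (b i)).1) (fun x => ?_) hI ht
      simp only [ContinuousLinearMap.comp_apply, hb, ContinuousLinearMap.adjoint_inner_left]
  have hh : ∀ n : ℕ, 1 / ((n : ℝ) + 1) ∈ Ioc (0:ℝ) 1 := fun n =>
    ⟨Nat.one_div_pos_of_nat, by
      rw [div_le_one (by positivity)]
      linarith [(Nat.cast_nonneg n : (0:ℝ) ≤ n)]⟩
  have hadj : ∀ v, Tendsto (fun n : ℕ => (J (1 / ((n : ℝ) + 1))).adjoint v) atTop (𝓝 v) :=
    fun v => (hJ.tendsto_adjoint hS v).comp tendsto_one_div_nhdsGT_zero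
  refine ItoFormulaFor.of_strong_limit hT hX hq hqim hF hG hFwd' hg hwG (fun _ => rfl)
    (B := fun n => J (1 / ((n : ℝ) + 1))) (fun n => hJ.norm_le _ (hh n))
    (fun v => (hJ.tendsto hS v).comp tendsto_one_div_nhdsGT_zero)
    (L := fun n => (J (1 / ((n : ℝ) + 1))).adjoint.prodMap (J (1 / ((n : ℝ) + 1))).adjoint)
    (L₀ := ContinuousLinearMap.id ℝ (H × H)) (K' := M)
    (fun n => ContinuousLinearMap.opNorm_le_bound _ hM fun p => ?_)
    (fun v => (hadj v.1).prodMk_nhds (hadj v.2)) (fun n p hp => ⟨(hmem _).2 ?_, rfl⟩)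
    (fun p hp => ⟨hp, ?_⟩) fun n => hmean _ (hh n)
  · have hK : ‖(J (1 / ((n : ℝ) + 1))).adjoint‖ ≤ M := by
      rw [LinearIsometryEquiv.norm_map]
      exact hJ.norm_le _ (hh n)
    refine norm_prod_le_iff.2 ⟨?_, ?_⟩
    · exact (ContinuousLinearMap.le_of_opNorm_le _ hK _).trans (by gcongr; exact norm_fst_le p)
    · exact (ContinuousLinearMap.le_of_opNorm_le _ hK _).trans (by gcongr; exact norm_snd_le p)
  · obtain ⟨h1, h2⟩ := (hmem p).1 hp
    exact ⟨(hA.adjoint_mean hS hJ (hh n) _).1,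
      (hA.adjoint_mean_of_mem hS hJ (hh n) h1).trans (by rw [h2]; rfl)⟩
  · refine ext_inner_right ℝ fun v => ?_
    rw [ContinuousLinearMap.adjoint_inner_left]
    rfl

/-! ### Extension of the data beyond `[0,T]` -/

theorem continuous_comp_projIcc {Y : Type*} [TopologicalSpace Y] {T : ℝ} (hT : 0 ≤ T)
    {f : ℝ × E → Y} (hf : ContinuousOn f (Icc 0 T ×ˢ univ)) :
    Continuous fun p : ℝ × E => f (projIcc 0 T hT p.1, p.2) :=
  hf.comp_continuous
    ((continuous_subtype_val.comp (continuous_projIcc.comp continuous_fst)).prodMk continuous_snd)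
    fun p => ⟨(projIcc 0 T hT p.1).2, mem_univ _⟩

theorem continuousOn_prod_univ_of_closedBall {Y : Type*} [TopologicalSpace Y] {s : Set ℝ}
    {f : ℝ × E → Y} (hf : ∀ R : ℝ, 0 < R → ContinuousOn f (s ×ˢ closedBall 0 R)) :
    ContinuousOn f (s ×ˢ univ) := by
  rintro ⟨r, x⟩ ⟨hr, -⟩
  have hR : 0 < ‖x‖ + 1 := by positivity
  refine (hf _ hR (r, x) ⟨hr, by simp⟩).mono_of_mem_nhdsWithin ?_
  rw [nhdsWithin_prod_eq, nhdsWithin_univ]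
  exact prod_mem_prod self_mem_nhdsWithin (mem_of_superset
    (isOpen_ball.mem_nhds (by simp : x ∈ ball 0 (‖x‖ + 1))) ball_subset_closedBall)

theorem isC12_comp_projIcc {T : ℝ} (hT : 0 ≤ T) {F DtF : ℝ → E → ℝ} {DxF : ℝ → E → E →L[ℝ] ℝ}
    {DxxF : ℝ → E → E →L[ℝ] E →L[ℝ] ℝ}
    (htF : ∀ t x, HasDerivAt (fun s => F s x) (DtF t x) t)
    (hxF : ∀ t x, HasFDerivAt (F t) (DxF t x) x)
    (hxxF : ∀ t x, HasFDerivAt (DxF t) (DxxF t x) x)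
    (hFc : ContinuousOn (fun p : ℝ × E => F p.1 p.2) (Icc 0 T ×ˢ univ))
    (htFc : ContinuousOn (fun p : ℝ × E => DtF p.1 p.2) (Icc 0 T ×ˢ univ))
    (hxFc : ContinuousOn (fun p : ℝ × E => DxF p.1 p.2) (Icc 0 T ×ˢ univ))
    (hxxFc : ContinuousOn (fun p : ℝ × E => DxxF p.1 p.2) (Icc 0 T ×ˢ univ)) :
    IsC12 T (fun t => F (projIcc 0 T hT t)) (fun t => DtF (projIcc 0 T hT t))
      (fun t => DxF (projIcc 0 T hT t)) (fun t => DxxF (projIcc 0 T hT t)) where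
  cont := continuous_comp_projIcc hT hFc
  cont_dt := continuous_comp_projIcc hT htFc
  cont_dx := continuous_comp_projIcc hT hxFc
  cont_dxx := continuous_comp_projIcc hT hxxFc
  eq_of_ge r hr x := by rw [projIcc_of_right_le hT hr, projIcc_right]
  hasDerivAt r hr x := by
    rw [projIcc_of_mem hT (Ioo_subset_Icc_self hr)]
    refine (htF r x).congr_of_eventuallyEq ?_
    filter_upwards [isOpen_Ioo.mem_nhds hr] with s hs
    rw [projIcc_of_mem hT (Ioo_subset_Icc_self hs)]
  hasFDerivAt r x := hxF _ x
  hasFDerivAt_dx r x := hxxF _ x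

theorem isForwardPairing_congr {μ : Measure Ω} {T : ℝ} {Z Z' X : ℝ → Ω → H}
    {I : ℝ → Ω → ℝ} (h : ∀ r ∈ Icc 0 T, ∀ ω, Z r ω = Z' r ω) (hI : IsForwardPairing μ T Z X I) :
    IsForwardPairing μ T Z' X I := by
  refine ⟨hI.1, fun t ht => ?_⟩
  convert hI.2 t ht using 3 with ε ω
  refine congrArg _ (setIntegral_congr_fun measurableSet_Ioc fun r hr => ?_)
  simp only [h r ⟨hr.1.le, hr.2.trans ht.2⟩ ω]

theorem rsSum_congr {T : ℝ} (hT : 0 ≤ T) {c : ℝ → E → ℝ} {Ψ Ψ' : ℝ → E}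
    (h : ∀ r ∈ Icc 0 T, Ψ r = Ψ' r) (n : ℕ) (t : ℝ) : rsSum T c Ψ n t = rsSum T c Ψ' n t :=
  Finset.sum_congr rfl fun _ hi => by
    rw [h _ (dyadic_mem_Icc hT (Finset.mem_range.1 hi).le)]

end

/-- Theorem `th:exlmIto`.
Let `A` be the generator of a `C₀`-semigroup on `H`, `χ̄ = D(A*) ⊗̂π D(A*)`, and
`F : [0,T] × H → ℝ` of class `C^{1,2}` with `∂ₓF ∈ UC([0,T] × H; D(A*))`.
Let `X` admit a `χ̄`-quadratic variation such that:
(i) there is a càdlàg bounded variation `(H ⊗̂π H)`-valued process `C` representing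
`[X,X]_χ̄`; and (ii) for every continuous `Γ : [0,T] × H → D(A*)` the forward integral
`∫₀ᵗ ⟨Γ(r,X(r)), d⁻X(r)⟩` exists. Then, for all `t ∈ [0,T]`, a.s.,
`F(t,X(t)) = F(0,X(0)) + ∫₀ᵗ ⟨∂ₓF(r,X(r)), d⁻X(r)⟩
  + ½ ∫₀ᵗ ⟨∂²ₓₓF(r,X(r)), dC(r)⟩ + ∫₀ᵗ ∂ᵣF(r,X(r)) dr`. -/
theorem statement15
    {H : Type*} [NormedAddCommGroup H] [InnerProductSpace ℝ H] [CompleteSpace H]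
    [TopologicalSpace.SeparableSpace H]
    (μ : Measure Ω) [IsProbabilityMeasure μ]
    (T : ℝ) (hT : 0 < T)
    (S : ℝ → H →L[ℝ] H) (hS : IsC0Semigroup S)
    (domA : Set H) (Aadj : H → H) (hgen : IsAdjointGenerator S domA Aadj)
    -- F of class C^{1,2}
    (F : ℝ → H → ℝ) (DtF : ℝ → H → ℝ) (DxF : ℝ → H → (H →L[ℝ] ℝ))
    (DxxF : ℝ → H → (H →L[ℝ] H →L[ℝ] ℝ))
    (htF : ∀ t x, HasDerivAt (fun s => F s x) (DtF t x) t)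
    (hxF : ∀ t x, HasFDerivAt (F t) (DxF t x) x)
    (hxxF : ∀ t x, HasFDerivAt (DxF t) (DxxF t x) x)
    (hFc : ContinuousOn (fun p : ℝ × H => F p.1 p.2) (Icc 0 T ×ˢ univ))
    (htFc : ContinuousOn (fun p : ℝ × H => DtF p.1 p.2) (Icc 0 T ×ˢ univ))
    (hxxFc : ContinuousOn (fun p : ℝ × H => DxxF p.1 p.2) (Icc 0 T ×ˢ univ))
    -- ∂ₓF belongs to UC([0,T] × H; D(A*)) : it is represented by G₀ with values in
    -- D(A*), uniformly continuously in the graph norm on [0,T] × (closed balls of H)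
    (G₀ : ℝ → H → H)
    (hG₀ : ∀ t x, DxF t x = (innerSL ℝ) (G₀ t x))
    (hG₀dom : ∀ t x, G₀ t x ∈ domA)
    (hG₀uc : ∀ R : ℝ, 0 < R →
      UniformContinuousOn (fun p : ℝ × H => (G₀ p.1 p.2, Aadj (G₀ p.1 p.2)))
        (Icc 0 T ×ˢ closedBall 0 R))
    -- X : an H-valued process admitting a χ̄-quadratic variation
    (X : ℝ → Ω → H)
    (hXcont : ∀ ω, Continuous fun t => X t ω)
    (hXext : ∀ t ≥ T, ∀ ω, X t ω = X T ω) (hXext0 : ∀ t ≤ (0:ℝ), ∀ ω, X t ω = X 0 ω)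
    (hH1 : DomCondH1 domA Aadj μ T X X)
    -- (i) the (H ⊗̂π H)-valued càdlàg bounded variation process C represents [X,X]_χ̄
    (C : ℝ → Ω → ((H →L[ℝ] H →L[ℝ] ℝ) → ℝ))
    (hCim : ∀ t ω, InProjTensorImage (C t ω))
    (hCcadlag : ∀ᵐ ω ∂μ, ∀ ψ : H →L[ℝ] H →L[ℝ] ℝ, ∀ t ∈ Ico (0:ℝ) T,
      ContinuousWithinAt (fun s => C s ω ψ) (Ici t) t)
    (hCbv : ∀ᵐ ω ∂μ, ∃ V : ℝ → ℝ, MonotoneOn V (Icc 0 T) ∧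
      ∀ s ∈ Icc (0:ℝ) T, ∀ t ∈ Icc (0:ℝ) T, s ≤ t →
        (⨆ ψ : {ψ : H →L[ℝ] H →L[ℝ] ℝ // ‖ψ‖ ≤ 1}, |C t ω ψ.1 - C s ω ψ.1|)
          ≤ V t - V s)
    (hCrep : ∀ (z w : ℕ → H), (∀ k, z k ∈ domA) → (∀ k, w k ∈ domA) →
      Summable (fun k => graphNorm Aadj (z k) * graphNorm Aadj (w k)) →
      ∀ ψ : H →L[ℝ] H →L[ℝ] ℝ,
        (∀ x y : H, ψ x y = ∑' k, ⟪x, z k⟫ * ⟪y, w k⟫) →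
        TendstoUcp μ (𝓝[>] (0:ℝ)) T
          (fun ε t ω => ε⁻¹ * ∫ r in Ioc (0:ℝ) t,
            ψ (X (r + ε) ω - X r ω) (X (r + ε) ω - X r ω))
          (fun t ω => C t ω ψ))
    -- (ii) forward integrals of continuous D(A*)-valued integrands exist
    (hFwd : ∀ Γ : ℝ → H → H, (∀ t x, Γ t x ∈ domA) →
      Continuous (fun p : ℝ × H => (Γ p.1 p.2, Aadj (Γ p.1 p.2))) →
      ∃ I : ℝ → Ω → ℝ, IsForwardPairing μ T (fun r ω => Γ r (X r ω)) X I) :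
    -- conclusion: the Itô formula
    ∃ I₁ I₂ : ℝ → Ω → ℝ,
      IsForwardPairing μ T (fun r ω => G₀ r (X r ω)) X I₁ ∧
      (∀ᵐ ω ∂μ, ∀ t ∈ Icc (0:ℝ) T,
        Tendsto (fun n => dyadicPairingSum T (fun r ω' => DxxF r (X r ω')) C n t ω)
          atTop (𝓝 (I₂ t ω))) ∧
      ∀ t ∈ Icc (0:ℝ) T, ∀ᵐ ω ∂μ,
        F t (X t ω) = F 0 (X 0 ω) + I₁ t ω + (1 / 2) * I₂ t ω +
          ∫ r in Ioc (0:ℝ) t, DtF r (X r ω) := by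
  have hT' : 0 ≤ T := hT.le
  choose q hCq using fun t ω => (hCim t ω).exists_clm
  have hqim : ∀ s ω, InProjTensorImage (q s ω) := fun s ω => funext (hCq s ω) ▸ hCim s ω
  have hq : ∀ᵐ ω ∂μ, ∃ V, IsVariationBound T (fun s => q s ω) V := by
    filter_upwards [hCbv] with ω ⟨V, hV, hle⟩
    simp only [hCq] at hle
    exact ⟨V, hV, fun s hs t ht hst =>
      abs_sub_le_of_iSup_le (E := H →L[ℝ] H →L[ℝ] ℝ) (hle s hs t ht hst)⟩
  obtain ⟨h0, hA0⟩ := hgen.eq_of_tendsto (z := 0) (l := 0) (by simp)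
  have hrep : ∀ z ∈ domA, ∀ w ∈ domA, TendstoUcp μ (𝓝[>] (0:ℝ)) T
      (fun ε t ω => ε⁻¹ * ∫ r in Ioc (0:ℝ) t,
        rankOneForm z w (X (r + ε) ω - X r ω) (X (r + ε) ω - X r ω))
      (fun t ω => q t ω (rankOneForm z w)) := fun z hz w hw => by
    simpa only [hCq] using pairing_quadratic_rankOne h0 hCrep hA0 hz hw
  have hκ : ∀ r ∈ Icc 0 T, (projIcc 0 T hT' r : ℝ) = r := fun r hr => by
    rw [projIcc_of_mem hT' hr]
  have hGc : ContinuousOn (fun p : ℝ × H => (G₀ p.1 p.2, Aadj (G₀ p.1 p.2))) (Icc 0 T ×ˢ univ) :=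
    continuousOn_prod_univ_of_closedBall fun R hR => (hG₀uc R hR).continuousOn
  have hDxc : ContinuousOn (fun p : ℝ × H => innerSL ℝ (G₀ p.1 p.2)) (Icc 0 T ×ˢ univ) :=
    (innerSL ℝ).continuous.comp_continuousOn hGc.fst
  have hDx : DxF = fun t x => innerSL ℝ (G₀ t x) := funext fun t => funext fun x => hG₀ t x
  have hF := isC12_comp_projIcc hT' htF hxF hxxF hFc htFc
    (by simpa only [hDx] using hDxc) hxxFc
  simp only [hDx] at hF
  have hg := continuous_comp_projIcc hT' hGc
  obtain ⟨I₁, hI₁⟩ := hFwd (fun r => G₀ (projIcc 0 T hT' r)) (fun _ _ => hG₀dom _ _) hg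
  have key := itoFormulaFor_id hT' hS hgen hXcont hq hqim hrep hF (fun _ _ => hG₀dom _ _) hg hFwd
    I₁ (by simpa only [ContinuousLinearMap.adjoint_id, ContinuousLinearMap.id_apply] using hI₁)
  refine ⟨I₁, fun t ω => rsIntegral T (fun s => q s ω)
    (fun r => DxxF (projIcc 0 T hT' r) (X r ω)) t,
    isForwardPairing_congr (fun r hr ω => by rw [hκ r hr]) hI₁, ?_, fun t ht => ?_⟩
  · filter_upwards [hq] with ω ⟨V, hV, hle⟩ t ht
    have hΨ : Continuous fun r => DxxF (projIcc 0 T hT' r) (X r ω) :=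
      hF.cont_dxx.comp (continuous_id.prodMk (hXcont ω))
    refine (tendsto_rsSum (E := H →L[ℝ] H →L[ℝ] ℝ) hT' hle hV ht hΨ.continuousOn).congr fun n => ?_
    refine (rsSum_congr hT' (Ψ' := fun r => DxxF r (X r ω)) (fun r hr => ?_) n t).trans ?_
    · rw [hκ r hr]
    · simp only [rsSum, dyadicPairingSum, hCq]
  · filter_upwards [key t ht] with ω hω
    have hI : ∫ r in Ioc (0:ℝ) t, DtF (projIcc 0 T hT' r) (X r ω) =
        ∫ r in Ioc (0:ℝ) t, DtF r (X r ω) :=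
      setIntegral_congr_fun measurableSet_Ioc fun r hr => by
        simp only [hκ r ⟨hr.1.le, hr.2.trans ht.2⟩]
    have hp : ∀ ψ : H →L[ℝ] H →L[ℝ] ℝ, pullback (ContinuousLinearMap.id ℝ H) ψ = ψ := fun _ => rfl
    simp only [itoRemainder, hp, intervalIntegral.integral_of_le ht.1, hκ t ht,
      hκ 0 ⟨le_rfl, hT'⟩, ContinuousLinearMap.id_apply, hI] at hω
    rw [hω]
    ring

end Stmt
end
end

section
/- Let H₁, H₂ be real separable Hilbert spaces. Then H₁*⊗̂_π H₂* (viewed inside (H₁⊗̂_π H₂)* via the canonical map sending a*⊗b* to the functional x⊗y ↦ ⟨a*,x⟩⟨b*,y⟩) is sequentially dense in (H₁⊗̂_π H₂)* in the weak-* topology: for every ℓ ∈ (H₁⊗̂_π H₂)* there is a sequence ℓₙ ∈ H₁*⊗̂_π H₂* with ⟨ℓₙ, u⟩ → ⟨ℓ, u⟩ for every u ∈ H₁⊗̂_π H₂. -/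
open Set Filter Topology
open scoped RealInnerProductSpace

noncomputable section

namespace Stmt

/-- A bilinear form whose first argument is projected onto a finite-dimensional subspace is a
finite sum of products of inner products. -/
theorem exists_sum_inner_mul_inner_of_starProjection
    {E F : Type*} [NormedAddCommGroup E] [InnerProductSpace ℝ E]
    [NormedAddCommGroup F] [InnerProductSpace ℝ F] [CompleteSpace F]
    (ψ : E →L[ℝ] F →L[ℝ] ℝ) (U : Submodule ℝ E) [FiniteDimensional ℝ U] :
    ∃ (m : ℕ) (a : Fin m → E) (b : Fin m → F),
      ∀ x y, ψ (U.starProjection x) y = ∑ i : Fin m, ⟪a i, x⟫ * ⟪b i, y⟫ := by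
  let e := stdOrthonormalBasis ℝ U
  refine ⟨_, fun i => (e i : E), fun i => (InnerProductSpace.toDual ℝ F).symm (ψ (e i)),
    fun x y => ?_⟩
  have h : U.starProjection x = ∑ i, ⟪(e i : E), x⟫ • (e i : E) := by
    simp [e.starProjection_eq_sum_rankOne]
  simp [h]

/-- A separable inner product space carries an increasing sequence of finite-dimensional subspaces
whose union is dense. -/
theorem exists_monotone_finiteDimensional_dense
    (E : Type*) [NormedAddCommGroup E] [InnerProductSpace ℝ E]
    [TopologicalSpace.SeparableSpace E] :
    ∃ U : ℕ → Submodule ℝ E, Monotone U ∧ (∀ n, FiniteDimensional ℝ (U n)) ∧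
      ⊤ ≤ (⨆ n, U n).topologicalClosure := by
  let d := TopologicalSpace.denseSeq E
  refine ⟨fun n => Submodule.span ℝ (d '' Iic n),
    fun m n h => Submodule.span_mono (image_mono (Iic_subset_Iic.2 h)),
    fun n => FiniteDimensional.span_of_finite ℝ ((finite_Iic n).image d), ?_⟩
  intro x _
  refine closure_mono ?_ (TopologicalSpace.denseRange_denseSeq E x)
  rintro _ ⟨n, rfl⟩
  exact Submodule.mem_iSup_of_mem n (Submodule.subset_span ⟨n, le_refl n, rfl⟩)

/-- Lemma `lemmaTensor`.
Let `H₁`, `H₂` be real separable Hilbert spaces. Then `H₁* ⊗̂π H₂*`, viewed inside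
`(H₁ ⊗̂π H₂)*` via the canonical map sending `a* ⊗ b*` to the functional
`x ⊗ y ↦ ⟨a*, x⟩ ⟨b*, y⟩`, is sequentially dense in `(H₁ ⊗̂π H₂)*` in the weak-*
topology.

Formalization: the dual `(H₁ ⊗̂π H₂)*` is isometrically identified with the space
`H₁ →L H₂ →L ℝ` of bounded bilinear forms; the elements of (the image of the algebraic
part of) `H₁* ⊗̂π H₂*` are the finite sums of elementary forms `(x,y) ↦ ⟨aᵢ,x⟩⟨bᵢ,y⟩`.
An element `u` of `H₁ ⊗̂π H₂` is represented by an absolutely convergent series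
`u = ∑ₖ x k ⊗ y k` with `∑ₖ ‖x k‖ ‖y k‖ < ∞`, and the pairing of a bilinear form `ψ`
with `u` is `∑ₖ ψ(x k)(y k)`; weak-* convergence of `ℓₙ → ℓ` means convergence of the
pairings against every such `u`. -/
theorem statement19
    {H₁ H₂ : Type*}
    [NormedAddCommGroup H₁] [InnerProductSpace ℝ H₁] [CompleteSpace H₁]
    [TopologicalSpace.SeparableSpace H₁]
    [NormedAddCommGroup H₂] [InnerProductSpace ℝ H₂] [CompleteSpace H₂]
    [TopologicalSpace.SeparableSpace H₂]
    (ψ : H₁ →L[ℝ] H₂ →L[ℝ] ℝ) :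
    ∃ ψseq : ℕ → (H₁ →L[ℝ] H₂ →L[ℝ] ℝ),
      -- each ψseq n lies in (the algebraic part of) H₁* ⊗̂π H₂*
      (∀ n : ℕ, ∃ (m : ℕ) (a : Fin m → H₁) (b : Fin m → H₂),
        ∀ x : H₁, ∀ y : H₂, ψseq n x y = ∑ i : Fin m, ⟪a i, x⟫ * ⟪b i, y⟫) ∧
      -- ψseq n → ψ in the weak-* topology of (H₁ ⊗̂π H₂)*
      (∀ (x : ℕ → H₁) (y : ℕ → H₂), Summable (fun k => ‖x k‖ * ‖y k‖) →
        Tendsto (fun n => ∑' k, ψseq n (x k) (y k)) atTop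
          (𝓝 (∑' k, ψ (x k) (y k)))) := by
  obtain ⟨U, hU, hfin, hdense⟩ := exists_monotone_finiteDimensional_dense H₁
  refine ⟨fun n => ψ ∘L (U n).starProjection,
    fun n => exists_sum_inner_mul_inner_of_starProjection ψ (U n), fun x y hxy => ?_⟩
  refine tendsto_tsum_of_dominated_convergence (hxy.mul_left ‖ψ‖) (fun k => ?_)
    (Eventually.of_forall fun n k => ?_)
  · have hP := Submodule.starProjection_tendsto_self U hU (x k) hdense
    exact ((ψ.flip (y k)).continuous.tendsto (x k)).comp hP
  · calc ‖ψ ((U n).starProjection (x k)) (y k)‖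
        ≤ ‖ψ‖ * ‖(U n).starProjection (x k)‖ * ‖y k‖ := ψ.le_opNorm₂ _ _
      _ ≤ ‖ψ‖ * ‖x k‖ * ‖y k‖ := by
        gcongr
        exact (U n).norm_starProjection_apply_le (x k)
      _ = ‖ψ‖ * (‖x k‖ * ‖y k‖) := mul_assoc _ _ _

end Stmt
end
end
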